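/- Suppose that ℓ ≥ r ≥ 2 are integers and F ∈ 𝓕_{ℓ+1}^r. Then there exist constants N_0 and c_F > 0 such that for all integers n ≥ N_0 and all integers t with 0 ≤ t ≤ c_F·n, one has EX(n,(t+1)H_{ℓ+1}^F) = { K_t^r ⋈ T_r(n−t,ℓ) }. -/

import Mathlib

open Filter

namespace DensityCH

/-- An `r`-uniform hypergraph with vertices in `ℕ`:
a finite vertex set together with a set of `r`-element edges. -/
structure HGraph (r : ℕ) where
  verts : Finset ℕ
  edges : Finset (Finset ℕ)
  edges_sub : ∀ e ∈ edges, e ⊆ verts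
  edges_card : ∀ e ∈ edges, e.card = r

namespace HGraph

/-- Build an `r`-graph from a vertex set and a set of candidate edges,
keeping exactly the well-formed candidates. -/
def ofEdges (r : ℕ) (V : Finset ℕ) (E : Finset (Finset ℕ)) : HGraph r where
  verts := V
  edges := E.filter fun e => e ⊆ V ∧ e.card = r
  edges_sub := fun e he => ((Finset.mem_filter.mp he).2).1
  edges_card := fun e he => ((Finset.mem_filter.mp he).2).2

variable {r : ℕ}

/-- `H` contains a copy of `F`, i.e. a subgraph isomorphic to `F`. -/
def IsCopyIn (F H : HGraph r) : Prop :=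
  ∃ f : ℕ → ℕ, Set.InjOn f ↑F.verts ∧ (∀ v ∈ F.verts, f v ∈ H.verts) ∧
    ∀ e ∈ F.edges, e.image f ∈ H.edges

/-- The subgraph of `H` induced on `S`. -/
def induce (H : HGraph r) (S : Finset ℕ) : HGraph r :=
  ofEdges r (H.verts ∩ S) (H.edges.filter fun e => e ⊆ S)

/-- Delete a vertex from `H`. -/
def deleteVert (H : HGraph r) (v : ℕ) : HGraph r :=
  ofEdges r (H.verts.erase v) (H.edges.filter fun e => v ∉ e)

/-- The degree of a vertex. -/
def deg (H : HGraph r) (v : ℕ) : ℕ := (H.edges.filter fun e => v ∈ e).card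

/-- The maximum degree `Δ(H)`. -/
def maxDeg (H : HGraph r) : ℕ := H.verts.sup H.deg

/-- The minimum degree `δ(H)`. -/
def minDeg (H : HGraph r) : ℕ :=
  if h : H.verts.Nonempty then H.verts.inf' h H.deg else 0

/-- The average degree `d(H) = r·|E(H)|/|V(H)|`. -/
noncomputable def avgDeg (H : HGraph r) : ℝ :=
  (r : ℝ) * (H.edges.card : ℝ) / (H.verts.card : ℝ)

/-- `H` contains `k` pairwise vertex-disjoint copies of `F`, i.e. `ν(F,H) ≥ k`. -/
def HasMatching (F H : HGraph r) (k : ℕ) : Prop :=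
  ∃ S : Fin k → Finset ℕ,
    (∀ i, S i ⊆ H.verts ∧ (S i).card = F.verts.card) ∧
    (∀ i j, i ≠ j → Disjoint (S i) (S j)) ∧
    ∀ i, F.IsCopyIn (H.induce (S i))

/-- Isomorphism of hypergraphs. -/
def Iso (G H : HGraph r) : Prop :=
  ∃ f : ℕ → ℕ, Set.BijOn f ↑G.verts ↑H.verts ∧
    ∀ e ∈ Finset.powersetCard r G.verts, (e ∈ G.edges ↔ e.image f ∈ H.edges)

/-- The join `G ⋈ H`: all edges of `G`, all edges of `H`, and all `r`-sets meeting
both vertex sets. -/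
def join (G H : HGraph r) : HGraph r :=
  ofEdges r (G.verts ∪ H.verts)
    (G.edges ∪ H.edges ∪ ((Finset.powersetCard r (G.verts ∪ H.verts)).filter
      fun e => (e ∩ G.verts).Nonempty ∧ (e ∩ H.verts).Nonempty))

end HGraph

/-- The complete `r`-graph on a vertex set `S`. -/
def completeOn (r : ℕ) (S : Finset ℕ) : HGraph r :=
  HGraph.ofEdges r S (Finset.powersetCard r S)

/-- The `r`-graph on `V` with no edges. -/
def emptyOn (r : ℕ) (V : Finset ℕ) : HGraph r := HGraph.ofEdges r V ∅

/-- The Turán number `ex(n,F)`. -/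
noncomputable def exN (r n : ℕ) (F : HGraph r) : ℕ :=
  sSup {m | ∃ H : HGraph r, H.verts.card = n ∧ ¬ F.IsCopyIn H ∧ H.edges.card = m}

/-- `d(n,F) = r·ex(n,F)/n`. -/
noncomputable def dN (r n : ℕ) (F : HGraph r) : ℝ := (r : ℝ) * (exN r n F : ℝ) / (n : ℝ)

/-- `δ(n,F) = ex(n,F) − ex(n−1,F)` (as a real number). -/
noncomputable def deltaN (r n : ℕ) (F : HGraph r) : ℝ := (exN r n F : ℝ) - (exN r (n-1) F : ℝ)

/-- `x` is the Turán density `π(F)`, i.e. the limit of `ex(n,F)/C(n,r)`. -/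
def HasTuranDensity (r : ℕ) (F : HGraph r) (x : ℝ) : Prop :=
  Tendsto (fun n : ℕ => (exN r n F : ℝ) / (n.choose r : ℝ)) atTop (nhds x)

/-- `ex(n,(t+1)F)`: the maximum number of edges of an `n`-vertex `r`-graph with no
`t+1` pairwise vertex-disjoint copies of `F`. -/
noncomputable def exMatchN (r n t : ℕ) (F : HGraph r) : ℕ :=
  sSup {m | ∃ H : HGraph r, H.verts.card = n ∧ ¬ F.HasMatching H (t+1) ∧ H.edges.card = m}

/-- `H ∈ EX(n,F)`. -/
def IsExtremalFree (r n : ℕ) (F H : HGraph r) : Prop :=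
  H.verts.card = n ∧ ¬ F.IsCopyIn H ∧ H.edges.card = exN r n F

/-- `H ∈ EX(n,(t+1)F)`. -/
def IsExtremalMatchingFree (r n t : ℕ) (F H : HGraph r) : Prop :=
  H.verts.card = n ∧ ¬ F.HasMatching H (t+1) ∧ H.edges.card = exMatchN r n t F

/-- `F` is `(f1, f2)`-bounded at `n`. -/
def BoundedAt (r n : ℕ) (F : HGraph r) (f1 f2 : ℝ) : Prop :=
  ∀ H : HGraph r, H.verts.card = n → ¬ F.IsCopyIn H →
    dN r n F - f1 ≤ H.avgDeg → (H.maxDeg : ℝ) ≤ dN r n F + f2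

/-- `ex(·,F)` is `g`-smooth at `n`: `|δ(n,F) − d(n−1,F)| ≤ g(n)`. -/
def SmoothAt (r n : ℕ) (F : HGraph r) (g : ℝ) : Prop :=
  |deltaN r n F - dN r (n-1) F| ≤ g

/-- The collection `H 0, …, H t` (on a common vertex set) has a rainbow `F`-matching. -/
def HasRainbowMatching (r t : ℕ) (F : HGraph r) (H : Fin (t+1) → HGraph r) : Prop :=
  ∃ S : Fin (t+1) → Finset ℕ,
    (∀ i, S i ⊆ (H i).verts ∧ (S i).card = F.verts.card) ∧
    (∀ i j, i ≠ j → Disjoint (S i) (S j)) ∧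
    ∀ i, F.IsCopyIn ((H i).induce (S i))

/-!  Patterns -/

/-- An `r`-uniform pattern: a finite index set together with a collection of
`r`-multisets on it. -/
structure Pattern (r : ℕ) where
  idx : Finset ℕ
  mE : Finset (Multiset ℕ)
  card_eq : ∀ s ∈ mE, Multiset.card s = r
  mem_idx : ∀ s ∈ mE, ∀ i ∈ s, i ∈ idx

namespace Pattern

variable {r : ℕ}

/-- The pattern `P − i`. -/
def erase (P : Pattern r) (i : ℕ) : Pattern r where
  idx := P.idx.erase i
  mE := P.mE.filter fun s => i ∉ s
  card_eq := fun s hs => P.card_eq s (Finset.mem_filter.mp hs).1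
  mem_idx := by
    intro s hs j hj
    have h1 := Finset.mem_filter.mp hs
    refine Finset.mem_erase.mpr ⟨?_, P.mem_idx s h1.1 j hj⟩
    rintro rfl
    exact h1.2 hj

/-- `H` is a `P`-construction: a blowup of the pattern `P`. -/
def IsConstruction (P : Pattern r) (H : HGraph r) : Prop :=
  ∃ part : ℕ → ℕ, (∀ v ∈ H.verts, part v ∈ P.idx) ∧
    ∀ e : Finset ℕ, e ∈ H.edges ↔ (e ⊆ H.verts ∧ e.card = r ∧ Multiset.map part e.val ∈ P.mE)

/-- `H` is a `P`-subconstruction: a subgraph of a `P`-construction. -/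
def IsSubconstruction (P : Pattern r) (H : HGraph r) : Prop :=
  ∃ G : HGraph r, P.IsConstruction G ∧ H.verts ⊆ G.verts ∧ H.edges ⊆ G.edges

end Pattern

/-- `Λ(P,n)`: the maximum number of edges of an `n`-vertex `P`-construction. -/
noncomputable def patEx (r : ℕ) (P : Pattern r) (n : ℕ) : ℕ :=
  sSup {m | ∃ H : HGraph r, P.IsConstruction H ∧ H.verts.card = n ∧ H.edges.card = m}

/-- The Lagrangian `λ(P) = lim Λ(P,n)/C(n,r)`. -/
noncomputable def patLagrangian (r : ℕ) (P : Pattern r) : ℝ :=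
  limUnder atTop fun n : ℕ => (patEx r P n : ℝ) / (n.choose r : ℝ)

/-- The pattern `P` is minimal: `λ(P−i) < λ(P)` for all `i`. -/
def Pattern.Minimal {r : ℕ} (P : Pattern r) : Prop :=
  ∀ i ∈ P.idx, patLagrangian r (P.erase i) < patLagrangian r P

/-- `(F,P)` is a Turán pair. -/
def IsTuranPair (r : ℕ) (F : HGraph r) (P : Pattern r) : Prop :=
  (∀ H : HGraph r, P.IsConstruction H → ¬ F.IsCopyIn H) ∧
  (∀ H : HGraph r, ¬ F.IsCopyIn H → H.edges.card = exN r H.verts.card F →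
    P.IsConstruction H)

/-- `F` is edge-stable with respect to `P` (with Turán density `π`). -/
def EdgeStable (r : ℕ) (F : HGraph r) (P : Pattern r) (π : ℝ) : Prop :=
  ∀ δ : ℝ, 0 < δ → ∃ N₀ : ℕ, ∃ ζ : ℝ, 0 < ζ ∧
    ∀ H : HGraph r, N₀ ≤ H.verts.card → ¬ F.IsCopyIn H →
      (π - ζ) * (H.verts.card.choose r : ℝ) ≤ (H.edges.card : ℝ) →
      ∃ H' : HGraph r, H'.verts ⊆ H.verts ∧ H'.edges ⊆ H.edges ∧
        (π - δ) * (H.verts.card.choose r : ℝ) ≤ (H'.edges.card : ℝ) ∧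
        P.IsSubconstruction H'

/-- `F` is weakly vertex-extendable with respect to `P` (with Turán density `π`). -/
def WeaklyVertexExtendable (r : ℕ) (F : HGraph r) (P : Pattern r) (π : ℝ) : Prop :=
  ∀ δ : ℝ, 0 < δ → ∃ N₀ : ℕ, ∃ ζ : ℝ, 0 < ζ ∧
    ∀ H : HGraph r, N₀ ≤ H.verts.card → ¬ F.IsCopyIn H →
      (π - ζ) * (((H.verts.card - 1).choose (r-1) : ℕ) : ℝ) ≤ (H.minDeg : ℝ) →
      ∀ v ∈ H.verts, P.IsSubconstruction (H.deleteVert v) →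
        (H.deg v : ℝ) ≤ (π + δ) * (((H.verts.card - 1).choose (r-1) : ℕ) : ℝ)

/-- `F` is degree-stable with respect to `P` (with Turán density `π`). -/
def DegreeStable (r : ℕ) (F : HGraph r) (P : Pattern r) (π : ℝ) : Prop :=
  ∃ ζ : ℝ, 0 < ζ ∧ ∃ N₀ : ℕ,
    ∀ H : HGraph r, N₀ ≤ H.verts.card → ¬ F.IsCopyIn H →
      (π - ζ) * (((H.verts.card - 1).choose (r-1) : ℕ) : ℝ) ≤ (H.minDeg : ℝ) →
      P.IsSubconstruction H

/-!  Concrete constructions -/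

/-- The generalized Turán graph `T_r(·,ℓ)` on vertex set `V` (parts are residue
classes mod `ℓ`; on an interval these are balanced). -/
def turanOn (r ℓ : ℕ) (V : Finset ℕ) : HGraph r :=
  HGraph.ofEdges r V ((Finset.powersetCard r V).filter
    fun e => ∀ u ∈ e, ∀ v ∈ e, u % ℓ = v % ℓ → u = v)

/-- The `r`-graph on `V₁ ∪ V₂` whose edges are all `r`-sets meeting both parts. -/
def crossOn (r : ℕ) (V₁ V₂ : Finset ℕ) : HGraph r :=
  HGraph.ofEdges r (V₁ ∪ V₂) ((Finset.powersetCard r (V₁ ∪ V₂)).filter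
    fun e => (e ∩ V₁).Nonempty ∧ (e ∩ V₂).Nonempty)

/-- The `r`-graph on `V₁ ∪ V₂` whose edges are all `r`-sets meeting `V₁` in an odd
number of vertices. -/
def oddCross (r : ℕ) (V₁ V₂ : Finset ℕ) : HGraph r :=
  HGraph.ofEdges r (V₁ ∪ V₂) ((Finset.powersetCard r (V₁ ∪ V₂)).filter
    fun e => Odd (e ∩ V₁).card)

/-- The Fano plane. -/
def fano : HGraph 3 :=
  HGraph.ofEdges 3 (Finset.Icc 1 7)
    {({1,2,3} : Finset ℕ), {3,4,5}, {5,6,1}, {1,7,4}, {2,7,5}, {3,7,6}, {2,4,6}}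

/-- The generalized triangle `𝕋_r`, with edges `{1,…,r}`, `{1,…,r−1,r+1}` and
`{r,…,2r−1}`. -/
def genTri (r : ℕ) : HGraph r :=
  HGraph.ofEdges r (Finset.Icc 1 (2*r - 1))
    {Finset.Icc 1 r, Finset.Icc 1 (r-1) ∪ {r+1}, Finset.Icc r (2*r - 1)}

/-- `G` is a blowup of the `r`-graph `W` (viewing `W` as a pattern). -/
def IsBlowupOf {r : ℕ} (W G : HGraph r) : Prop :=
  ∃ part : ℕ → ℕ, (∀ v ∈ G.verts, part v ∈ W.verts) ∧
    ∀ e : Finset ℕ, e ∈ G.edges ↔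
      (e ⊆ G.verts ∧ e.card = r ∧ ∃ f ∈ W.edges, Multiset.map part e.val = f.val)

/-- The expansion `H^F` of an `r`-graph `F`: for every pair of vertices not covered
by an edge of `F`, add an edge consisting of this pair plus `r−2` new vertices,
these sets of new vertices being pairwise disjoint. -/
def HGraph.expansion {r : ℕ} (F : HGraph r) : HGraph r :=
  HGraph.ofEdges r
    (F.verts ∪ (((F.verts ×ˢ F.verts).filter fun p =>
        p.1 < p.2 ∧ ∀ e ∈ F.edges, ¬ (p.1 ∈ e ∧ p.2 ∈ e)).biUnion fun p =>
      (Finset.range (r-2)).image fun s =>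
        (F.verts.sup id + 1) + (p.1 * (F.verts.sup id + 1) + p.2) * r + s))
    (F.edges ∪ (((F.verts ×ˢ F.verts).filter fun p =>
        p.1 < p.2 ∧ ∀ e ∈ F.edges, ¬ (p.1 ∈ e ∧ p.2 ∈ e)).image fun p =>
      insert p.1 (insert p.2 ((Finset.range (r-2)).image fun s =>
        (F.verts.sup id + 1) + (p.1 * (F.verts.sup id + 1) + p.2) * r + s))))

/-- A `2`-graph is a tree on `k` vertices: `k` vertices, `k−1` edges, connected. -/
def IsTreeGraph (k : ℕ) (T : HGraph 2) : Prop :=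
  T.verts.card = k ∧ T.edges.card = k - 1 ∧
  ∀ S : Finset ℕ, S ⊆ T.verts → S.Nonempty → S ≠ T.verts →
    ∃ e ∈ T.edges, (e ∩ S).Nonempty ∧ (e \ S).Nonempty

/-- `T` satisfies the Erdős–Sós property for `k`: every graph with average degree
greater than `k−2` contains `T`. -/
def ErdosSos (k : ℕ) (T : HGraph 2) : Prop :=
  ∀ G : HGraph 2, ((k : ℝ) - 2) * (G.verts.card : ℝ) < 2 * (G.edges.card : ℝ) →
    T.IsCopyIn G

/-- The `(r−2)`-expansion `Exp(T)` of a `2`-graph `T`: enlarge every edge by one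
common fixed set of `r−2` new vertices. -/
def expTree (r : ℕ) (T : HGraph 2) : HGraph r :=
  HGraph.ofEdges r
    (T.verts ∪ ((Finset.range (r-2)).image fun s => T.verts.sup id + 1 + s))
    (T.edges.image fun e =>
      e ∪ ((Finset.range (r-2)).image fun s => T.verts.sup id + 1 + s))

/-- The chromatic number of a `2`-graph. -/
noncomputable def chrom (F : HGraph 2) : ℕ :=
  sInf {k | ∃ c : ℕ → ℕ, (∀ v ∈ F.verts, c v < k) ∧
    ∀ e ∈ F.edges, ∀ u ∈ e, ∀ v ∈ e, u ≠ v → c u ≠ c v}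

/-- A graph is edge-critical if deleting some edge lowers its chromatic number. -/
def EdgeCritical (F : HGraph 2) : Prop :=
  ∃ e ∈ F.edges, chrom (HGraph.ofEdges 2 F.verts (F.edges.erase e)) < chrom F

/-- `H` is semibipartite: the vertex set splits into `V₁ ∪ V₂` so that every edge
has exactly one vertex in `V₁`. -/
def Semibipartite (r : ℕ) (H : HGraph r) : Prop :=
  ∃ V₁ ⊆ H.verts, ∀ e ∈ H.edges, (e ∩ V₁).card = 1

/-- `H` is a `K_ℓ^r`-subconstruction, i.e. an `ℓ`-partite `r`-graph. -/
def IsKlSub (r ℓ : ℕ) (H : HGraph r) : Prop :=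
  ∃ f : ℕ → ℕ, (∀ v ∈ H.verts, f v < ℓ) ∧
    ∀ e ∈ H.edges, ∀ u ∈ e, ∀ v ∈ e, f u = f v → u = v

/-- The Lagrangian `λ(W)` of an `r`-graph `W`, viewing `W` as a pattern. -/
noncomputable def hgLagrangian (r : ℕ) (W : HGraph r) : ℝ :=
  limUnder atTop fun n : ℕ =>
    ((sSup {m | ∃ G : HGraph r, IsBlowupOf W G ∧ G.verts.card = n ∧ G.edges.card = m} : ℕ) : ℝ)
      / (n.choose r : ℝ)

/-- The `r`-graph `B(r,ℓ+1)`. -/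
def BGraph (r ℓ : ℕ) : HGraph r :=
  HGraph.ofEdges r (Finset.Icc 1 (ℓ+1))
    (insert (Finset.Icc 1 r)
      ((Finset.powersetCard r (Finset.Icc 2 (ℓ+1))).filter
        fun e => (e ∩ Finset.Icc 2 r).card ≤ 1))

/-- The `r`-uniform matching of size two, `M_2^r`. -/
def matching2 (r : ℕ) : HGraph r :=
  HGraph.ofEdges r (Finset.Icc 1 (2*r)) {Finset.Icc 1 r, Finset.Icc (r+1) (2*r)}

/-- The expanded triangle `𝓒_3^{2r}`. -/
def expandedTriangle (r : ℕ) : HGraph (2*r) :=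
  HGraph.ofEdges (2*r) (Finset.Icc 1 (3*r))
    {Finset.Icc 1 (2*r), Finset.Icc (r+1) (3*r), Finset.Icc 1 r ∪ Finset.Icc (2*r+1) (3*r)}

/-- The `4`-graph `𝔽_{4,3}`. -/
def F43 : HGraph 4 :=
  HGraph.ofEdges 4 (Finset.Icc 1 7)
    {({1,2,3,4} : Finset ℕ), {1,2,3,5}, {1,2,3,6}, {1,2,3,7}, {4,5,6,7}}

/-- The `3`-graph `𝔽_{3,2}`. -/
def F32 : HGraph 3 :=
  HGraph.ofEdges 3 (Finset.Icc 1 5)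
    {({1,2,3} : Finset ℕ), {1,2,4}, {1,2,5}, {3,4,5}}

/-- `H` contains pairwise vertex-disjoint copies of `F i`, `ts i` many of each. -/
def HasMixedMatching (r k : ℕ) (F : Fin k → HGraph r) (ts : Fin k → ℕ)
    (H : HGraph r) : Prop :=
  ∃ S : (i : Fin k) → Fin (ts i) → Finset ℕ,
    (∀ i j, S i j ⊆ H.verts ∧ (S i j).card = (F i).verts.card) ∧
    (∀ p q : Σ i : Fin k, Fin (ts i), p ≠ q → Disjoint (S p.1 p.2) (S q.1 q.2)) ∧
    ∀ i j, (F i).IsCopyIn (H.induce (S i j))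

/-- `ex(n, ⊔ᵢ tᵢ Fᵢ)`. -/
noncomputable def exMixedN (r k : ℕ) (F : Fin k → HGraph r) (ts : Fin k → ℕ)
    (n : ℕ) : ℕ :=
  sSup {m | ∃ H : HGraph r, H.verts.card = n ∧ ¬ HasMixedMatching r k F ts H ∧
    H.edges.card = m}

/-- `ex(n, {F₁,…,F_k})`. -/
noncomputable def exFamN (r k : ℕ) (F : Fin k → HGraph r) (n : ℕ) : ℕ :=
  sSup {m | ∃ H : HGraph r, H.verts.card = n ∧ (∀ i, ¬ (F i).IsCopyIn H) ∧
    H.edges.card = m}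


section PartOne
open Finset
open scoped Classical

/-- Colour class. -/
def cls (V : Finset ℕ) (c : ℕ → ℕ) (i : ℕ) : Finset ℕ := V.filter (fun v => c v = i)

theorem mem_cls {V : Finset ℕ} {c : ℕ → ℕ} {i v : ℕ} : v ∈ cls V c i ↔ v ∈ V ∧ c v = i := by
  simp [cls]

theorem map_val_eq_iff (c : ℕ → ℕ) (e f : Finset ℕ) :
    Multiset.map c e.val = f.val ↔ Set.InjOn c e ∧ e.image c = f := by
  constructor
  · intro h
    have hn : (Multiset.map c e.val).Nodup := h ▸ f.nodup
    have h1 : Set.InjOn c e := by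
      intro x hx y hy hxy
      exact Multiset.inj_on_of_nodup_map hn x hx y hy hxy
    refine ⟨h1, ?_⟩
    apply Finset.val_injective
    rw [← h, Finset.image_val, Multiset.dedup_eq_self.mpr hn]
  · rintro ⟨h1, h2⟩
    rw [← h2, Finset.image_val_of_injOn h1]

/-- The sets in `V` on which `c` is injective with image exactly `f` are counted by a product. -/
theorem card_fiber (V : Finset ℕ) (c : ℕ → ℕ) (f : Finset ℕ) :
    (V.powerset.filter (fun e : Finset ℕ => Set.InjOn c e ∧ e.image c = f)).card
      = ∏ i ∈ f, (cls V c i).card := by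
  induction f using Finset.induction_on with
  | empty =>
    simp only [prod_empty]
    rw [Finset.card_eq_one]
    refine ⟨∅, ?_⟩
    ext e
    simp only [mem_filter, mem_powerset, image_eq_empty, mem_singleton]
    constructor
    · rintro ⟨_, _, h⟩; exact h
    · rintro rfl; simp
  | insert a f ha ih =>
    rw [prod_insert ha, ← ih, ← Finset.card_product]
    symm
    apply Finset.card_bij (fun (q : ℕ × Finset ℕ) _ => insert q.1 q.2)
    · rintro ⟨v, e⟩ h
      simp only [mem_product, mem_filter, mem_powerset, mem_cls] at h
      obtain ⟨⟨hv, hva⟩, heV, hinj, him⟩ := h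
      have hve : ∀ w ∈ e, c w ≠ c v := by
        intro w hw h
        apply ha; rw [← hva, ← h, ← him]; exact mem_image_of_mem c hw
      simp only [mem_filter, mem_powerset]
      refine ⟨insert_subset hv heV, ?_, ?_⟩
      · rw [coe_insert]
        intro x hx y hy hxy
        rcases hx with rfl | hx <;> rcases hy with rfl | hy
        · rfl
        · exact absurd hxy.symm (hve y hy)
        · exact absurd hxy (hve x hx)
        · exact hinj hx hy hxy
      · rw [image_insert, him, hva]
    · rintro ⟨v, e⟩ h ⟨v', e'⟩ h' heq
      simp only [mem_product, mem_filter, mem_powerset, mem_cls] at h h'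
      obtain ⟨⟨hv, hva⟩, heV, hinj, him⟩ := h
      obtain ⟨⟨hv', hva'⟩, heV', hinj', him'⟩ := h'
      have key : ∀ w ∈ e, c w ≠ a := by
        intro w hw h
        apply ha; rw [← h, ← him]; exact mem_image_of_mem c hw
      have key' : ∀ w ∈ e', c w ≠ a := by
        intro w hw h
        apply ha; rw [← h, ← him']; exact mem_image_of_mem c hw
      simp only at heq
      have hvv : v = v' := by
        have : v ∈ insert v' e' := heq ▸ mem_insert_self v e
        rcases mem_insert.mp this with h | h
        · exact h
        · exact absurd hva (key' v h)
      subst hvv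
      have h1 : v ∉ e := fun h => key v h hva
      have h2 : v ∉ e' := fun h => key' v h hva
      have : e = e' := by
        rw [← erase_insert h1, heq, erase_insert h2]
      rw [this]
    · intro e he
      simp only [mem_filter, mem_powerset] at he
      obtain ⟨heV, hinj, him⟩ := he
      have : a ∈ e.image c := him ▸ mem_insert_self a f
      obtain ⟨v, hv, hva⟩ := mem_image.mp this
      refine ⟨(v, e.erase v), ?_, insert_erase hv⟩
      simp only [mem_product, mem_filter, mem_powerset, mem_cls]
      refine ⟨⟨heV hv, hva⟩, (erase_subset _ _).trans heV, ?_, ?_⟩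
      · exact hinj.mono (by simp)
      · ext x
        constructor
        · intro hx
          obtain ⟨w, hw, rfl⟩ := mem_image.mp hx
          have hw' := mem_erase.mp hw
          have : c w ∈ insert a f := him ▸ mem_image_of_mem c hw'.2
          rcases mem_insert.mp this with h | h
          · exact absurd (hinj hw'.2 hv (h.trans hva.symm)) hw'.1
          · exact h
        · intro hx
          have : x ∈ e.image c := him ▸ mem_insert_of_mem hx
          obtain ⟨w, hw, rfl⟩ := mem_image.mp this
          refine mem_image_of_mem c (mem_erase.mpr ⟨?_, hw⟩)
          rintro rfl
          exact ha (hva ▸ hx)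

theorem card_fiber_family (V : Finset ℕ) (c : ℕ → ℕ) (FF : Finset (Finset ℕ)) :
    (V.powerset.filter (fun e : Finset ℕ => Set.InjOn c e ∧ e.image c ∈ FF)).card
      = ∑ f ∈ FF, ∏ i ∈ f, (cls V c i).card := by
  classical
  rw [Finset.card_eq_sum_card_fiberwise (f := fun e : Finset ℕ => e.image c) (t := FF)]
  · apply sum_congr rfl
    intro f hf
    rw [← card_fiber, filter_filter]
    congr 1
    ext e
    simp only [mem_filter]
    constructor
    · rintro ⟨h1, ⟨h2, _⟩, h3⟩; exact ⟨h1, h2, h3⟩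
    · rintro ⟨h1, h2, h3⟩; exact ⟨h1, ⟨h2, h3 ▸ hf⟩, h3⟩
  · intro e he
    simp only [coe_filter, Set.mem_setOf_eq] at he
    exact he.2.2

/-- Rainbow `k`-subsets of `V`. -/
noncomputable def rb (c : ℕ → ℕ) (V : Finset ℕ) (k : ℕ) : Finset (Finset ℕ) :=
  (powersetCard k V).filter (fun e : Finset ℕ => Set.InjOn c e)

theorem mem_rb {c : ℕ → ℕ} {V : Finset ℕ} {k : ℕ} {e : Finset ℕ} :
    e ∈ rb c V k ↔ e ⊆ V ∧ e.card = k ∧ Set.InjOn c e := by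
  classical
  simp [rb, mem_powersetCard, and_assoc]

/-- Elementary symmetric polynomial over a finite index set. -/
def es (I : Finset ℕ) (k : ℕ) (x : ℕ → ℕ) : ℕ := ∑ S ∈ powersetCard k I, ∏ i ∈ S, x i

theorem card_rb (c : ℕ → ℕ) (V I : Finset ℕ) (k : ℕ) (hI : ∀ v ∈ V, c v ∈ I) :
    (rb c V k).card = es I k (fun i => (cls V c i).card) := by
  classical
  rw [es, ← card_fiber_family]
  congr 1
  ext e
  rw [mem_rb, mem_filter, mem_powerset, mem_powersetCard]
  constructor
  · rintro ⟨h1, h2, h3⟩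
    refine ⟨h1, h3, ?_, ?_⟩
    · intro x hx
      obtain ⟨w, hw, rfl⟩ := mem_image.mp hx
      exact hI w (h1 hw)
    · rw [card_image_of_injOn h3, h2]
  · rintro ⟨h1, h3, _, h4⟩
    rw [card_image_of_injOn h3] at h4
    exact ⟨h1, h4, h3⟩

theorem es_zero (I : Finset ℕ) (x : ℕ → ℕ) : es I 0 x = 1 := by
  simp [es]

theorem es_insert (I : Finset ℕ) (a : ℕ) (ha : a ∉ I) (k : ℕ) (x : ℕ → ℕ) :
    es (insert a I) (k+1) x = es I (k+1) x + x a * es I k x := by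
  classical
  unfold es
  rw [powersetCard_succ_insert ha, sum_union, sum_image, mul_sum]
  · congr 1
    apply sum_congr rfl
    intro S hS
    rw [prod_insert]
    intro h
    exact ha ((mem_powersetCard.mp hS).1 h)
  · intro S hS T hT h
    have h1 : a ∉ S := fun h => ha ((mem_powersetCard.mp hS).1 h)
    have h2 : a ∉ T := fun h => ha ((mem_powersetCard.mp hT).1 h)
    rw [← erase_insert h1, h, erase_insert h2]
  · rw [disjoint_left]
    intro S hS hS'
    obtain ⟨T, hT, rfl⟩ := mem_image.mp hS'
    exact ha ((mem_powersetCard.mp hS).1 (mem_insert_self a T))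

theorem es_congr (I : Finset ℕ) (k : ℕ) (x y : ℕ → ℕ) (h : ∀ i ∈ I, x i = y i) :
    es I k x = es I k y := by
  unfold es
  apply sum_congr rfl
  intro S hS
  apply prod_congr rfl
  intro i hi
  exact h i ((mem_powersetCard.mp hS).1 hi)

theorem es_const (I : Finset ℕ) (k q : ℕ) (x : ℕ → ℕ) (h : ∀ i ∈ I, x i = q) :
    es I k x = I.card.choose k * q ^ k := by
  rw [es_congr I k x (fun _ => q) h]
  unfold es
  rw [sum_congr rfl (g := fun _ => q ^ k)]
  · simp
  · intro S hS
    rw [prod_const, (mem_powersetCard.mp hS).2]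

theorem es_mono (I : Finset ℕ) (k : ℕ) (x y : ℕ → ℕ) (h : ∀ i ∈ I, x i ≤ y i) :
    es I k x ≤ es I k y := by
  unfold es
  apply sum_le_sum
  intro S hS
  apply prod_le_prod' 
  intro i hi
  exact h i ((mem_powersetCard.mp hS).1 hi)

theorem es_smul (I : Finset ℕ) (k q : ℕ) (x : ℕ → ℕ) :
    es I k (fun i => q * x i) = q ^ k * es I k x := by
  unfold es
  rw [mul_sum]
  apply sum_congr rfl
  intro S hS
  rw [prod_mul_distrib, prod_const, (mem_powersetCard.mp hS).2]

/-- If `es` of order `k+1` is positive then so is that of order `k`. -/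
theorem es_pos_of_succ (I : Finset ℕ) (k : ℕ) (x : ℕ → ℕ) (h : 0 < es I (k+1) x) :
    0 < es I k x := by
  unfold es at h ⊢
  rw [Finset.sum_pos_iff] at h
  obtain ⟨S, hS, hp⟩ := h
  have hS' := mem_powersetCard.mp hS
  have hne : S.Nonempty := by rw [← card_pos]; omega
  obtain ⟨a, ha⟩ := hne
  rw [Finset.sum_pos_iff]
  refine ⟨S.erase a, ?_, ?_⟩
  · rw [mem_powersetCard]
    exact ⟨(erase_subset _ _).trans hS'.1, by rw [card_erase_of_mem ha]; omega⟩
  · apply prod_pos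
    intro i hi
    have : ∀ i ∈ S, x i ≠ 0 := by
      intro i hi h0
      rw [prod_eq_zero hi h0] at hp
      exact lt_irrefl _ hp
    exact Nat.pos_of_ne_zero (this i (mem_of_mem_erase hi))

/-- Expansion of `es` with respect to two indices. -/
theorem es_two (I : Finset ℕ) (i j : ℕ) (hi : i ∈ I) (hj : j ∈ I) (hij : i ≠ j) (k : ℕ)
    (x : ℕ → ℕ) :
    es I (k+2) x = es ((I.erase i).erase j) (k+2) x
      + (x i + x j) * es ((I.erase i).erase j) (k+1) x
      + x i * x j * es ((I.erase i).erase j) k x := by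
  have hj' : j ∈ I.erase i := mem_erase.mpr ⟨hij.symm, hj⟩
  conv_lhs => rw [← insert_erase hi]
  rw [es_insert _ _ (notMem_erase _ _)]
  have e1 : ∀ m, es (I.erase i) (m+1) x = es ((I.erase i).erase j) (m+1) x
      + x j * es ((I.erase i).erase j) m x := by
    intro m
    conv_lhs => rw [← insert_erase hj']
    rw [es_insert _ _ (notMem_erase _ _)]
  rw [e1 (k+1), e1 k]
  ring

/-- Moving one unit from `i` to `j`. -/
def shift (x : ℕ → ℕ) (i j : ℕ) : ℕ → ℕ :=
  fun a => if a = i then x i - 1 else if a = j then x j + 1 else x a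

theorem es_shift (I : Finset ℕ) (i j : ℕ) (hi : i ∈ I) (hj : j ∈ I) (k : ℕ)
    (x : ℕ → ℕ) (h : x j + 2 ≤ x i) (hpos : 0 < es I (k+2) x) :
    es I (k+2) x < es I (k+2) (shift x i j) := by
  have hij : i ≠ j := by rintro rfl; omega
  have hc : ∀ m, es ((I.erase i).erase j) m (shift x i j) = es ((I.erase i).erase j) m x := by
    intro m
    apply es_congr
    intro a ha
    have h1 := mem_erase.mp ha
    have h2 := mem_erase.mp h1.2
    simp [shift, h1.1, h2.1]
  rw [es_two I i j hi hj hij] at hpos ⊢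
  rw [es_two I i j hi hj hij k (shift x i j), hc, hc, hc]
  have si : shift x i j i = x i - 1 := by simp [shift]
  have sj : shift x i j j = x j + 1 := by simp [shift, hij.symm]
  rw [si, sj]
  obtain ⟨d, hd⟩ := Nat.exists_eq_add_of_le h
  have hA : 0 < es ((I.erase i).erase j) k x := by
    by_contra h0
    have h0 : es ((I.erase i).erase j) k x = 0 := by omega
    have h1 : es ((I.erase i).erase j) (k+1) x = 0 := by
      by_contra h1
      have := es_pos_of_succ _ _ _ (Nat.pos_of_ne_zero h1)
      omega
    have h2 : es ((I.erase i).erase j) (k+2) x = 0 := by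
      by_contra h2
      have := es_pos_of_succ _ _ _ (Nat.pos_of_ne_zero h2)
      omega
    rw [h0, h1, h2] at hpos
    simp at hpos
  have e1 : x i - 1 + (x j + 1) = x i + x j := by omega
  rw [e1]
  apply Nat.add_lt_add_left
  apply Nat.mul_lt_mul_of_pos_right _ hA
  rw [hd]
  have : x j + 2 + d - 1 = x j + 1 + d := by omega
  rw [this]
  nlinarith

theorem sum_shift (I : Finset ℕ) (i j : ℕ) (hi : i ∈ I) (hj : j ∈ I) (x : ℕ → ℕ)
    (h : x j + 2 ≤ x i) : ∑ a ∈ I, shift x i j a = ∑ a ∈ I, x a := by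
  have hij : i ≠ j := by rintro rfl; omega
  have hj' : j ∈ I.erase i := mem_erase.mpr ⟨hij.symm, hj⟩
  rw [← add_sum_erase I _ hi, ← add_sum_erase (I.erase i) _ hj', ← add_sum_erase I x hi,
    ← add_sum_erase (I.erase i) x hj']
  have si : shift x i j i = x i - 1 := by simp [shift]
  have sj : shift x i j j = x j + 1 := by simp [shift, hij.symm]
  have : ∑ a ∈ (I.erase i).erase j, shift x i j a = ∑ a ∈ (I.erase i).erase j, x a := by
    apply sum_congr rfl
    intro a ha
    have h1 := mem_erase.mp ha
    have h2 := mem_erase.mp h1.2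
    simp [shift, h1.1, h2.1]
  rw [si, sj, this]
  omega

theorem sumsq_shift (I : Finset ℕ) (i j : ℕ) (hi : i ∈ I) (hj : j ∈ I) (x : ℕ → ℕ)
    (h : x j + 2 ≤ x i) : ∑ a ∈ I, (shift x i j a)^2 < ∑ a ∈ I, (x a)^2 := by
  have hij : i ≠ j := by rintro rfl; omega
  have hj' : j ∈ I.erase i := mem_erase.mpr ⟨hij.symm, hj⟩
  rw [← add_sum_erase I _ hi, ← add_sum_erase (I.erase i) _ hj', ← add_sum_erase I (fun a => x a ^2) hi,
    ← add_sum_erase (I.erase i) (fun a => x a ^2) hj']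
  have si : shift x i j i = x i - 1 := by simp [shift]
  have sj : shift x i j j = x j + 1 := by simp [shift, hij.symm]
  have : ∑ a ∈ (I.erase i).erase j, (shift x i j a)^2 = ∑ a ∈ (I.erase i).erase j, (x a)^2 := by
    apply sum_congr rfl
    intro a ha
    have h1 := mem_erase.mp ha
    have h2 := mem_erase.mp h1.2
    simp [shift, h1.1, h2.1]
  rw [si, sj, this]
  obtain ⟨d, hd⟩ := Nat.exists_eq_add_of_le h
  have : x i - 1 = x j + 1 + d := by omega
  rw [this, hd]
  nlinarith

/-- `x` is balanced on `I`. -/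
def Bal (I : Finset ℕ) (x : ℕ → ℕ) : Prop := ∀ i ∈ I, ∀ j ∈ I, x i ≤ x j + 1

/-- Every vector is dominated by a balanced one of the same sum; strictly if it is not
balanced and has positive `es`. -/
theorem exists_bal (I : Finset ℕ) (k : ℕ) : ∀ (m : ℕ) (x : ℕ → ℕ), ∑ a ∈ I, (x a)^2 ≤ m →
    ∃ y, Bal I y ∧ ∑ a ∈ I, y a = ∑ a ∈ I, x a ∧ es I (k+2) x ≤ es I (k+2) y ∧
      (0 < es I (k+2) x → ¬ Bal I x → es I (k+2) x < es I (k+2) y) := by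
  intro m
  induction m with
  | zero =>
    intro x hx
    refine ⟨x, ?_, rfl, le_rfl, ?_⟩
    · intro i hi j hj
      have : (x i)^2 ≤ ∑ a ∈ I, (x a)^2 := single_le_sum (f := fun a => (x a)^2) (fun _ _ => Nat.zero_le _) hi
      have h0 : x i ^ 2 = 0 := by omega
      have : x i = 0 := by simpa using h0
      omega
    · intro _ hb
      exfalso; apply hb
      intro i hi j hj
      have : (x i)^2 ≤ ∑ a ∈ I, (x a)^2 := single_le_sum (f := fun a => (x a)^2) (fun _ _ => Nat.zero_le _) hi
      have h0 : x i ^ 2 = 0 := by omega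
      have : x i = 0 := by simpa using h0
      omega
  | succ m ih =>
    intro x hx
    by_cases hb : Bal I x
    · exact ⟨x, hb, rfl, le_rfl, fun _ h => absurd hb h⟩
    · unfold Bal at hb
      push Not at hb
      obtain ⟨i, hi, j, hj, hij⟩ := hb
      have hs := sumsq_shift I i j hi hj x (by omega)
      obtain ⟨y, hy1, hy2, hy3, hy4⟩ := ih (shift x i j) (by omega)
      rw [sum_shift I i j hi hj x (by omega)] at hy2
      by_cases hp : 0 < es I (k+2) x
      · have := es_shift I i j hi hj k x (by omega) hp
        exact ⟨y, hy1, hy2, by omega, fun _ _ => by omega⟩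
      · exact ⟨y, hy1, hy2, by omega, fun h => absurd h hp⟩

theorem bal_bounds (I : Finset ℕ) (x : ℕ → ℕ) (hb : Bal I x) (i : ℕ) (hi : i ∈ I) :
    I.card * x i ≤ ∑ a ∈ I, x a + I.card ∧ ∑ a ∈ I, x a ≤ I.card * x i + I.card := by
  constructor
  · have : ∑ a ∈ I, x i ≤ ∑ a ∈ I, (x a + 1) := sum_le_sum fun a ha => hb i hi a ha
    simpa [sum_add_distrib] using this
  · have : ∑ a ∈ I, x a ≤ ∑ a ∈ I, (x i + 1) := sum_le_sum fun a ha => hb a ha i hi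
    simp at this
    linarith

/-- strict upper version: `|I| * (x i) < sum + |I|`. -/
theorem bal_lt (I : Finset ℕ) (x : ℕ → ℕ) (hb : Bal I x) (i : ℕ) (hi : i ∈ I) :
    I.card * x i < ∑ a ∈ I, x a + I.card ∧ ∑ a ∈ I, x a < I.card * x i + I.card := by
  constructor
  · have : ∑ a ∈ I, x i < ∑ a ∈ I, (x a + 1) :=
      sum_lt_sum (fun a ha => hb i hi a ha) ⟨i, hi, by omega⟩
    simpa [sum_add_distrib] using this
  · have : ∑ a ∈ I, x a < ∑ a ∈ I, (x i + 1) :=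
      sum_lt_sum (fun a ha => hb a ha i hi) ⟨i, hi, by omega⟩
    simp at this
    linarith

/-- Maclaurin-type bound. -/
theorem es_le (I : Finset ℕ) (k : ℕ) (x : ℕ → ℕ) :
    I.card ^ (k+2) * es I (k+2) x ≤ I.card.choose (k+2) * (∑ a ∈ I, x a) ^ (k+2) := by
  rw [← es_smul]
  obtain ⟨y, hy, hs, hle, _⟩ := exists_bal I k _ (fun i => I.card * x i) le_rfl
  refine hle.trans ?_
  rw [← mul_sum] at hs
  have : ∀ i ∈ I, y i = ∑ a ∈ I, x a := by
    intro i hi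
    have h := bal_lt I y hy i hi
    have hc : 0 < I.card := card_pos.mpr ⟨i, hi⟩
    rw [hs] at h
    have h1 : y i < ∑ a ∈ I, x a + 1 := by
      apply Nat.lt_of_mul_lt_mul_left (a := I.card)
      rw [mul_add, mul_one]; exact h.1
    have h2 : ∑ a ∈ I, x a < y i + 1 := by
      apply Nat.lt_of_mul_lt_mul_left (a := I.card)
      rw [mul_add, mul_one]; exact h.2
    omega
  rw [es_const I _ _ y this]

end PartOne

section PartTwo
open Finset
open scoped Classical

theorem bij_of_card (A B : Finset ℕ) (h : A.card = B.card) : ∃ f : ℕ → ℕ, Set.BijOn f A B := by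
  have e := Finset.equivOfCardEq h
  refine ⟨fun x => if hx : x ∈ A then (e ⟨x, hx⟩ : ℕ) else 0, ?_, ?_, ?_⟩
  · intro x hx
    have hx' : x ∈ A := hx
    simp only [hx', dif_pos]
    exact (e ⟨x, hx'⟩).2
  · intro x hx y hy hxy
    have hx' : x ∈ A := hx
    have hy' : y ∈ A := hy
    simp only [hx', hy', dif_pos] at hxy
    have := e.injective (Subtype.ext hxy)
    simpa using this
  · intro y hy
    have hy' : y ∈ B := hy
    refine ⟨(e.symm ⟨y, hy'⟩ : ℕ), (e.symm ⟨y, hy'⟩).2, ?_⟩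
    simp

theorem bij_union {f g : ℕ → ℕ} {A A' B B' : Finset ℕ} (hf : Set.BijOn f A B)
    (hg : Set.BijOn g A' B') (hA : Disjoint A A') (hB : Disjoint B B') :
    Set.BijOn (fun x => if x ∈ A then f x else g x) ↑(A ∪ A') ↑(B ∪ B') := by
  have hA' : ∀ x ∈ A', x ∉ A := fun x hx h => (disjoint_left.mp hA) h hx
  refine ⟨?_, ?_, ?_⟩
  · intro x hx
    rcases mem_union.mp (mem_coe.mp hx) with h | h
    · simp only [h, if_true]; exact mem_coe.mpr (mem_union_left _ (hf.mapsTo h))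
    · simp only [hA' x h, if_false]; exact mem_coe.mpr (mem_union_right _ (hg.mapsTo h))
  · intro x hx y hy hxy
    rcases mem_union.mp (mem_coe.mp hx) with h | h <;> rcases mem_union.mp (mem_coe.mp hy) with h' | h'
    · simp only [h, h', if_true] at hxy; exact hf.injOn h h' hxy
    · simp only [h, hA' y h', if_true, if_false] at hxy
      exact absurd (hg.mapsTo h') (disjoint_left.mp hB (hxy ▸ hf.mapsTo h))
    · simp only [h', hA' x h, if_true, if_false] at hxy
      exact absurd (hg.mapsTo h) (disjoint_left.mp hB (hxy ▸ hf.mapsTo h'))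
    · simp only [hA' x h, hA' y h', if_false] at hxy; exact hg.injOn h h' hxy
  · intro y hy
    rcases mem_union.mp (mem_coe.mp hy) with h | h
    · obtain ⟨x, hx, rfl⟩ := hf.surjOn h
      exact ⟨x, mem_coe.mpr (mem_union_left _ hx), by simp [mem_coe.mp hx]⟩
    · obtain ⟨x, hx, rfl⟩ := hg.surjOn h
      exact ⟨x, mem_coe.mpr (mem_union_right _ hx), by simp [hA' x hx]⟩

theorem bal_val (I : Finset ℕ) (x : ℕ → ℕ) (hx : Bal I x) (i : ℕ) (hi : i ∈ I) :
    x i = (∑ a ∈ I, x a) / I.card ∨ x i = (∑ a ∈ I, x a) / I.card + 1 := by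
  have h := bal_lt I x hx i hi
  have hc : 0 < I.card := card_pos.mpr ⟨i, hi⟩
  set s := ∑ a ∈ I, x a
  have h1 : s / I.card < x i + 1 := by
    rw [Nat.div_lt_iff_lt_mul hc]; linarith [mul_comm (x i + 1) I.card]
  have h2 : x i ≤ s / I.card + 1 := by
    rcases Nat.eq_zero_or_pos (x i) with h0 | h0
    · rw [h0]; exact Nat.zero_le _
    · have : x i - 1 ≤ s / I.card := by
        rw [Nat.le_div_iff_mul_le hc]
        obtain ⟨d, hd⟩ := Nat.exists_eq_add_of_le h0
        have e1 : x i - 1 = d := by omega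
        rw [e1]
        rw [hd] at h
        nlinarith [h.1]
      omega
  omega

theorem bal_perm (I : Finset ℕ) (x y : ℕ → ℕ) (hx : Bal I x) (hy : Bal I y)
    (hs : ∑ a ∈ I, x a = ∑ a ∈ I, y a) :
    ∃ σ : ℕ → ℕ, Set.BijOn σ I I ∧ ∀ i ∈ I, y (σ i) = x i := by
  set q := (∑ a ∈ I, x a) / I.card with hq
  have vx : ∀ i ∈ I, x i = q ∨ x i = q + 1 := fun i hi => bal_val I x hx i hi
  have vy : ∀ i ∈ I, y i = q ∨ y i = q + 1 := fun i hi => by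
    have := bal_val I y hy i hi; rw [← hs] at this; exact this
  set A := I.filter (fun i => x i = q + 1)
  set B := I.filter (fun i => y i = q + 1)
  have cnt : ∀ z : ℕ → ℕ, (∀ i ∈ I, z i = q ∨ z i = q + 1) →
      ∑ a ∈ I, z a = I.card * q + (I.filter (fun i => z i = q + 1)).card := by
    intro z hz
    rw [card_filter, ← smul_eq_mul, ← sum_const, ← sum_add_distrib]
    apply sum_congr rfl
    intro i hi
    rcases hz i hi with h | h <;> simp [h]
  have hAB : A.card = B.card := by
    have h1 := cnt x vx
    have h2 := cnt y vy
    show (I.filter (fun i => x i = q + 1)).card = (I.filter (fun i => y i = q + 1)).card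
    omega
  obtain ⟨f, hf⟩ := bij_of_card A B hAB
  have hAI : A ⊆ I := filter_subset _ _
  have hBI : B ⊆ I := filter_subset _ _
  obtain ⟨g, hg⟩ := bij_of_card (I \ A) (I \ B) (by
    rw [card_sdiff_of_subset hAI, card_sdiff_of_subset hBI, hAB])
  have hu := bij_union hf hg disjoint_sdiff disjoint_sdiff
  rw [union_sdiff_of_subset hAI, union_sdiff_of_subset hBI] at hu
  refine ⟨_, hu, ?_⟩
  intro i hi
  by_cases h : i ∈ A
  · simp only [h, if_true]
    have h1 : f i ∈ B := hf.mapsTo h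
    rw [(mem_filter.mp h1).2, (mem_filter.mp h).2]
  · simp only [h, if_false]
    have h1 : g i ∈ I \ B := hg.mapsTo (mem_coe.mpr (mem_sdiff.mpr ⟨hi, h⟩))
    have h2 := mem_sdiff.mp h1
    have h3 : x i = q := by
      rcases vx i hi with h' | h'
      · exact h'
      · exact absurd (mem_filter.mpr ⟨hi, h'⟩) h
    have h4 : y (g i) = q := by
      rcases vy _ h2.1 with h' | h'
      · exact h'
      · exact absurd (mem_filter.mpr ⟨h2.1, h'⟩) h2.2
    rw [h3, h4]

theorem es_perm (I : Finset ℕ) (k : ℕ) (x y : ℕ → ℕ) (σ : ℕ → ℕ) (hσ : Set.BijOn σ I I)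
    (h : ∀ i ∈ I, y (σ i) = x i) : es I k x = es I k y := by
  have e1 : ∀ z : ℕ → ℕ, es I k z = (I.val.map z).esymm k := by
    intro z; rw [Finset.esymm_map_val]; rfl
  have h2 : Multiset.map σ I.val = I.val := by
    rw [map_val_eq_iff]
    refine ⟨hσ.injOn, ?_⟩
    apply Finset.coe_injective
    rw [coe_image, hσ.image_eq]
  rw [e1, e1]
  congr 1
  conv_rhs => rw [← h2]
  rw [Multiset.map_map]
  apply Multiset.map_congr rfl
  intro i hi
  exact (h i hi).symm

theorem es_bal_eq (I : Finset ℕ) (k : ℕ) (x y : ℕ → ℕ) (hx : Bal I x) (hy : Bal I y)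
    (hs : ∑ a ∈ I, x a = ∑ a ∈ I, y a) : es I k x = es I k y := by
  obtain ⟨σ, h1, h2⟩ := bal_perm I x y hx hy hs
  exact es_perm I k x y σ h1 h2

theorem card_mod_Ico (ℓ : ℕ) (hℓ : 0 < ℓ) (a b : ℕ) (hab : a ≤ b) (i : ℕ) (hi : i < ℓ) :
    (cls (Ico a b) (fun v => v % ℓ) i).card + (a / ℓ + if i < a % ℓ then 1 else 0)
      = b / ℓ + if i < b % ℓ then 1 else 0 := by
  have h : ∀ m, (cls (range m) (fun v => v % ℓ) i).card = m / ℓ + if i < m % ℓ then 1 else 0 := by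
    intro m
    have := Nat.count_modEq_card m hℓ i
    rw [Nat.mod_eq_of_lt hi] at this
    rw [← this, Nat.count_eq_card_filter_range]
    congr 1
    ext v
    simp [mem_cls, Nat.ModEq, Nat.mod_eq_of_lt hi]
  rw [← h a, ← h b]
  have hd : Disjoint (cls (Ico a b) (fun v => v % ℓ) i) (cls (range a) (fun v => v % ℓ) i) := by
    rw [disjoint_left]
    intro v hv hv'
    rw [mem_cls, mem_Ico] at hv
    rw [mem_cls, mem_range] at hv'
    omega
  rw [← card_union_of_disjoint hd]
  congr 1
  ext v
  simp only [mem_union, mem_cls, mem_Ico, mem_range]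
  constructor
  · rintro (h | h)
    · exact ⟨by omega, h.2⟩
    · exact ⟨by omega, h.2⟩
  · rintro ⟨h1, h2⟩
    rcases lt_or_ge v a with h | h
    · right; exact ⟨h, h2⟩
    · left; exact ⟨⟨h, h1⟩, h2⟩

theorem bal_Ico (ℓ : ℕ) (hℓ : 0 < ℓ) (a b : ℕ) (hab : a ≤ b) :
    Bal (range ℓ) (fun i => (cls (Ico a b) (fun v => v % ℓ) i).card) := by
  intro i hi j hj
  have h1 := card_mod_Ico ℓ hℓ a b hab i (mem_range.mp hi)
  have h2 := card_mod_Ico ℓ hℓ a b hab j (mem_range.mp hj)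
  show (cls (Ico a b) (fun v => v % ℓ) i).card ≤ (cls (Ico a b) (fun v => v % ℓ) j).card + 1
  have h3 : a / ℓ ≤ b / ℓ := Nat.div_le_div_right hab
  split_ifs at h1 h2 <;> omega

theorem sum_cls (V : Finset ℕ) (c : ℕ → ℕ) (I : Finset ℕ) (h : ∀ v ∈ V, c v ∈ I) :
    ∑ i ∈ I, (cls V c i).card = V.card :=
  (Finset.card_eq_sum_card_fiberwise (f := c) (t := I) (by intro v hv; exact h v hv)).symm

/-- The Turán number. -/
def tau (r ℓ n : ℕ) : ℕ := es (range ℓ) r (fun i => (cls (range n) (fun v => v % ℓ) i).card)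

theorem tau_eq (r ℓ : ℕ) (hℓ : 0 < ℓ) (x : ℕ → ℕ) (hx : Bal (range ℓ) x) :
    es (range ℓ) r x = tau r ℓ (∑ i ∈ range ℓ, x i) := by
  unfold tau
  apply es_bal_eq _ _ _ _ hx
  · have := bal_Ico ℓ hℓ 0 (∑ i ∈ range ℓ, x i) (Nat.zero_le _)
    rwa [← range_eq_Ico] at this
  · rw [sum_cls _ _ _ (fun v _ => mem_range.mpr (Nat.mod_lt _ hℓ)), card_range]

theorem es_le_tau (r ℓ : ℕ) (hr : 2 ≤ r) (hℓ : 0 < ℓ) (x : ℕ → ℕ) :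
    es (range ℓ) r x ≤ tau r ℓ (∑ i ∈ range ℓ, x i) := by
  obtain ⟨k, rfl⟩ := Nat.exists_eq_add_of_le hr
  obtain ⟨y, hy, hs, hle, _⟩ := exists_bal (range ℓ) k _ x le_rfl
  rw [add_comm 2 k, ← hs, ← tau_eq _ _ hℓ y hy]
  exact hle

theorem bal_of_es_eq (r ℓ : ℕ) (hr : 2 ≤ r) (hℓ : 0 < ℓ) (x : ℕ → ℕ)
    (h : es (range ℓ) r x = tau r ℓ (∑ i ∈ range ℓ, x i))
    (hpos : 0 < tau r ℓ (∑ i ∈ range ℓ, x i)) : Bal (range ℓ) x := by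
  obtain ⟨k, rfl⟩ := Nat.exists_eq_add_of_le hr
  obtain ⟨y, hy, hs, hle, hlt⟩ := exists_bal (range ℓ) k _ x le_rfl
  by_contra hb
  rw [add_comm 2 k] at h hpos
  have := hlt (by omega) hb
  rw [tau_eq _ _ hℓ y hy, hs] at this
  omega

/-- Turán density normalised by `n^r`. -/
noncomputable def pc (r ℓ : ℕ) : ℝ := (ℓ.choose r : ℝ) / (ℓ : ℝ) ^ r

theorem es_le_pc (r ℓ : ℕ) (hr : 2 ≤ r) (hℓ : 0 < ℓ) (I : Finset ℕ) (hI : I.card = ℓ) (x : ℕ → ℕ) :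
    (es I r x : ℝ) ≤ pc r ℓ * ((∑ i ∈ I, x i : ℕ) : ℝ) ^ r := by
  obtain ⟨k, rfl⟩ := Nat.exists_eq_add_of_le hr
  have := es_le I k x
  rw [add_comm 2 k, pc, div_mul_eq_mul_div, le_div_iff₀ (by positivity)]
  rw [hI] at this
  have h2 : ((ℓ ^ (k+2) * es I (k+2) x : ℕ) : ℝ) ≤ ((ℓ.choose (k+2) * (∑ a ∈ I, x a) ^ (k+2) : ℕ) : ℝ) :=
    by exact_mod_cast this
  push_cast at h2 ⊢
  linarith

theorem rb_card_le (r ℓ : ℕ) (hr : 2 ≤ r) (hℓ : 0 < ℓ) (c : ℕ → ℕ) (V I : Finset ℕ)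
    (hI : I.card = ℓ) (hc : ∀ v ∈ V, c v ∈ I) :
    ((rb c V r).card : ℝ) ≤ pc r ℓ * (V.card : ℝ) ^ r := by
  rw [card_rb c V I r hc]
  have := es_le_pc r ℓ hr hℓ I hI (fun i => (cls V c i).card)
  rwa [sum_cls V c I hc] at this

theorem tau_le_pc (r ℓ : ℕ) (hr : 2 ≤ r) (hℓ : 0 < ℓ) (n : ℕ) :
    (tau r ℓ n : ℝ) ≤ pc r ℓ * (n : ℝ) ^ r := by
  have := es_le_pc r ℓ hr hℓ (range ℓ) (card_range ℓ)
    (fun i => (cls (range n) (fun v => v % ℓ) i).card)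
  rwa [sum_cls _ _ _ (fun v _ => mem_range.mpr (Nat.mod_lt _ hℓ)), card_range] at this

theorem r_pc (r ℓ : ℕ) (hr : 1 ≤ r) (hℓ : 0 < ℓ) :
    (r : ℝ) * pc r ℓ = ((ℓ-1).choose (r-1) : ℝ) / (ℓ : ℝ) ^ (r-1) := by
  obtain ⟨k, rfl⟩ := Nat.exists_eq_add_of_le hr
  obtain ⟨m, rfl⟩ := Nat.exists_eq_add_of_le (Nat.succ_le_of_lt hℓ)
  rw [pc]
  have h := Nat.add_one_mul_choose_eq m k
  have h' : ((m : ℝ) + 1) * (m.choose k : ℝ) = ((m+1).choose (k+1) : ℝ) * ((k : ℝ)+1) := by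
    exact_mod_cast h
  simp only [Nat.add_sub_cancel_left, Nat.succ_eq_add_one, zero_add, add_comm 1]
  push_cast
  have hm : ((m : ℝ) + 1) ≠ 0 := by positivity
  rw [mul_div_assoc', div_eq_div_iff (by positivity) (by positivity), pow_succ]
  linear_combination -((m : ℝ) + 1)^k * h'

theorem es_add_one (I : Finset ℕ) (i : ℕ) (hi : i ∈ I) (k : ℕ) (x y : ℕ → ℕ)
    (hy : y i = x i + 1) (hy' : ∀ j ∈ I, j ≠ i → y j = x j) :
    es I (k+1) y = es I (k+1) x + es (I.erase i) k x := by
  have hc : ∀ m, es (I.erase i) m y = es (I.erase i) m x := fun m =>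
    es_congr _ _ _ _ (fun j hj => hy' j (mem_of_mem_erase hj) (ne_of_mem_erase hj))
  have e : ∀ z, es I (k+1) z = es (I.erase i) (k+1) z + z i * es (I.erase i) k z := by
    intro z
    conv_lhs => rw [← insert_erase hi]
    rw [es_insert _ _ (notMem_erase _ _)]
  rw [e y, e x, hc, hc, hy]
  ring

theorem tau_succ (r ℓ : ℕ) (hℓ : 0 < ℓ) (m : ℕ) :
    tau (r+1) ℓ (m+1) = tau (r+1) ℓ m +
      es ((range ℓ).erase (m % ℓ)) r (fun i => (cls (range m) (fun v => v % ℓ) i).card) := by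
  unfold tau
  apply es_add_one _ _ (mem_range.mpr (Nat.mod_lt _ hℓ))
  · have : cls (range (m+1)) (fun v => v % ℓ) (m % ℓ) = insert m (cls (range m) (fun v => v % ℓ) (m % ℓ)) := by
      ext v
      simp only [mem_cls, mem_range, mem_insert]
      constructor
      · rintro ⟨h1, h2⟩
        rcases Nat.lt_succ_iff_lt_or_eq.mp h1 with h | h
        · right; exact ⟨h, h2⟩
        · left; exact h
      · rintro (rfl | h)
        · exact ⟨by omega, rfl⟩
        · exact ⟨by omega, h.2⟩
    rw [this, card_insert_of_notMem]
    simp [mem_cls]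
  · intro j hj hne
    congr 1
    ext v
    simp only [mem_cls, mem_range]
    constructor
    · rintro ⟨h1, h2⟩
      refine ⟨?_, h2⟩
      rcases Nat.lt_succ_iff_lt_or_eq.mp h1 with h | h
      · exact h
      · subst h; exact absurd h2.symm hne
    · rintro ⟨h1, h2⟩; exact ⟨by omega, h2⟩

theorem tau_diff_bounds (r ℓ : ℕ) (hr : 1 ≤ r) (hℓ : 0 < ℓ) (m : ℕ) (hm : ℓ ≤ m) :
    (tau r ℓ m : ℝ) + r * pc r ℓ * ((m : ℝ) - ℓ) ^ (r-1) ≤ tau r ℓ (m+1) ∧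
    (tau r ℓ (m+1) : ℝ) ≤ tau r ℓ m + r * pc r ℓ * ((m : ℝ) + ℓ) ^ (r-1) := by
  rw [r_pc r ℓ hr hℓ]
  obtain ⟨k, rfl⟩ := Nat.exists_eq_add_of_le hr
  rw [add_comm 1 k, tau_succ k ℓ hℓ m]
  simp only [Nat.add_sub_cancel]
  have hb : Bal (range ℓ) (fun i => (cls (range m) (fun v => v % ℓ) i).card) := by
    have := bal_Ico ℓ hℓ 0 m (Nat.zero_le _)
    rwa [← range_eq_Ico] at this
  have hs : ∑ i ∈ range ℓ, (cls (range m) (fun v => v % ℓ) i).card = m := by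
    rw [sum_cls _ _ _ (fun v _ => mem_range.mpr (Nat.mod_lt _ hℓ)), card_range]
  have hcard : ((range ℓ).erase (m % ℓ)).card = ℓ - 1 := by
    rw [card_erase_of_mem (mem_range.mpr (Nat.mod_lt _ hℓ)), card_range]
  set x : ℕ → ℕ := fun i => (cls (range m) (fun v => v % ℓ) i).card with hx
  have hbd : ∀ i ∈ range ℓ, x i = m / ℓ ∨ x i = m / ℓ + 1 := by
    intro i hi
    have := bal_val _ _ hb i hi
    rw [hs, card_range] at this
    exact this
  have hℓ' : (0:ℝ) < ℓ := by exact_mod_cast hℓ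
  have hdm : (m : ℝ) = ℓ * (m / ℓ : ℕ) + (m % ℓ : ℕ) := by exact_mod_cast (Nat.div_add_mod m ℓ).symm
  have hmod : ((m % ℓ : ℕ) : ℝ) ≤ ℓ := by exact_mod_cast (Nat.mod_lt _ hℓ).le
  have hmod0 : (0:ℝ) ≤ ((m % ℓ : ℕ) : ℝ) := by positivity
  have hlow : es ((range ℓ).erase (m % ℓ)) k (fun _ => m / ℓ) ≤ es ((range ℓ).erase (m % ℓ)) k x :=
    es_mono _ _ _ _ (fun i hi => by
      rcases hbd i (mem_of_mem_erase hi) with h | h <;> omega)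
  have hup : es ((range ℓ).erase (m % ℓ)) k x ≤ es ((range ℓ).erase (m % ℓ)) k (fun _ => m / ℓ + 1) :=
    es_mono _ _ _ _ (fun i hi => by
      rcases hbd i (mem_of_mem_erase hi) with h | h <;> omega)
  rw [es_const _ _ _ _ (fun _ _ => rfl), hcard] at hlow hup
  have hlow' : (((ℓ-1).choose k : ℕ) : ℝ) * ((m / ℓ : ℕ) : ℝ) ^ k ≤ es ((range ℓ).erase (m % ℓ)) k x := by
    exact_mod_cast hlow
  have hup' : (es ((range ℓ).erase (m % ℓ)) k x : ℝ) ≤ (((ℓ-1).choose k : ℕ) : ℝ) * (((m / ℓ : ℕ) : ℝ) + 1) ^ k := by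
    exact_mod_cast hup
  have hml : (0:ℝ) ≤ (m : ℝ) - ℓ := by
    have : (ℓ : ℝ) ≤ m := by exact_mod_cast hm
    linarith
  push_cast
  constructor
  · have : ((m : ℝ) - ℓ) ^ k / (ℓ:ℝ)^k ≤ ((m / ℓ : ℕ) : ℝ) ^ k := by
      rw [← div_pow]
      apply pow_le_pow_left₀ (by positivity)
      rw [div_le_iff₀ hℓ']
      linarith
    have h3 := mul_le_mul_of_nonneg_left this (Nat.cast_nonneg (α := ℝ) ((ℓ-1).choose k))
    have e : (((ℓ-1).choose k : ℕ) : ℝ) / (ℓ:ℝ)^k * ((m:ℝ) - ℓ)^k = ((ℓ-1).choose k : ℕ) * (((m : ℝ) - ℓ) ^ k / (ℓ:ℝ)^k) := by ring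
    rw [e]
    linarith
  · have : (((m / ℓ : ℕ) : ℝ) + 1) ^ k ≤ ((m : ℝ) + ℓ) ^ k / (ℓ:ℝ)^k := by
      rw [← div_pow]
      apply pow_le_pow_left₀ (by positivity)
      rw [le_div_iff₀ hℓ']
      linarith
    have h3 := mul_le_mul_of_nonneg_left this (Nat.cast_nonneg (α := ℝ) ((ℓ-1).choose k))
    have e : (((ℓ-1).choose k : ℕ) : ℝ) / (ℓ:ℝ)^k * ((m:ℝ) + ℓ)^k = ((ℓ-1).choose k : ℕ) * (((m : ℝ) + ℓ) ^ k / (ℓ:ℝ)^k) := by ring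
    rw [e]
    linarith

theorem tau_pos (r ℓ : ℕ) (hℓ : 0 < ℓ) (hrl : r ≤ ℓ) (n : ℕ) (hn : ℓ ≤ n) : 0 < tau r ℓ n := by
  have h : es (range ℓ) r (fun _ => 1) ≤ tau r ℓ n := by
    apply es_mono
    intro i hi
    have := card_mod_Ico ℓ hℓ 0 n (Nat.zero_le _) i (mem_range.mp hi)
    rw [← range_eq_Ico] at this
    have h1 : 1 ≤ n / ℓ := (Nat.one_le_div_iff hℓ).mpr hn
    simp at this
    omega
  rw [es_const _ _ 1 _ (fun _ _ => rfl), card_range] at h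
  have := Nat.choose_pos hrl
  simp at h
  omega

theorem pc_pos (r ℓ : ℕ) (hℓ : 0 < ℓ) (hrl : r ≤ ℓ) : 0 < pc r ℓ := by
  unfold pc
  have : 0 < ℓ.choose r := Nat.choose_pos hrl
  positivity

/-- `pc r ℓ` in product form. -/
theorem pc_eq_prod (r ℓ : ℕ) (hrl : r ≤ ℓ) :
    (r.factorial : ℝ) * pc r ℓ = (∏ i ∈ range r, ((ℓ : ℝ) - i)) / (ℓ : ℝ) ^ r := by
  unfold pc
  rw [mul_div_assoc']
  congr 1
  have h := Nat.descFactorial_eq_factorial_mul_choose ℓ r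
  rw [Nat.descFactorial_eq_prod_range] at h
  have h2 : ((∏ i ∈ range r, (ℓ - i) : ℕ) : ℝ) = ∏ i ∈ range r, ((ℓ : ℝ) - i) := by
    rw [Nat.cast_prod]
    apply prod_congr rfl
    intro i hi
    rw [Nat.cast_sub]
    have := mem_range.mp hi
    omega
  rw [← h2, h]
  push_cast
  ring

theorem pc_prod' (r ℓ : ℕ) (hℓ : 0 < ℓ) (hrl : r ≤ ℓ) :
    (r.factorial : ℝ) * pc r ℓ = ∏ i ∈ range r, (1 - (i : ℝ) / ℓ) := by
  rw [pc_eq_prod r ℓ hrl]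
  have : (ℓ : ℝ) ^ r = ∏ i ∈ range r, (ℓ : ℝ) := by simp
  rw [this, ← prod_div_distrib]
  apply prod_congr rfl
  intro i hi
  have : (ℓ : ℝ) ≠ 0 := by positivity
  field_simp

theorem fac_pc_lt_one (r ℓ : ℕ) (hr : 2 ≤ r) (hrl : r ≤ ℓ) : (r.factorial : ℝ) * pc r ℓ < 1 := by
  have hℓ : 0 < ℓ := by omega
  rw [pc_prod' r ℓ hℓ hrl]
  have hl : (0:ℝ) < ℓ := by exact_mod_cast hℓ
  have h0 : ∀ i ∈ range r, (0:ℝ) ≤ 1 - (i : ℝ) / ℓ := by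
    intro i hi
    have : (i : ℝ) ≤ ℓ := by
      have := mem_range.mp hi
      exact_mod_cast (by omega : i ≤ ℓ)
    have : (i : ℝ) / ℓ ≤ 1 := by rw [div_le_one hl]; exact this
    linarith
  have h1 : ∏ i ∈ range r, (1 - (i : ℝ) / ℓ) ≤ ∏ i ∈ range 2, (1 - (i : ℝ) / ℓ) := by
    rw [← prod_sdiff (range_subset_range.mpr hr)]
    have : ∏ i ∈ range r \ range 2, (1 - (i : ℝ) / ℓ) ≤ 1 := by
      apply prod_le_one
      · intro i hi; exact h0 i (mem_sdiff.mp hi).1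
      · intro i hi
        have : (0:ℝ) ≤ (i : ℝ) / ℓ := by positivity
        linarith
    have h2 : (0:ℝ) ≤ ∏ i ∈ range 2, (1 - (i : ℝ) / ℓ) :=
      prod_nonneg fun i hi => h0 i (range_subset_range.mpr hr hi)
    nlinarith
  have h2 : ∏ i ∈ range 2, (1 - (i : ℝ) / ℓ) = 1 - 1/ℓ := by
    simp [prod_range_succ]
  have : (0:ℝ) < 1/ℓ := by positivity
  linarith

theorem pc_lt (r ℓ : ℕ) (hr : 2 ≤ r) (hrl : r ≤ ℓ) : pc r (ℓ-1) < pc r ℓ := by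
  have hℓ : 0 < ℓ := by omega
  rcases Nat.lt_or_ge (ℓ - 1) r with h | h
  · have : pc r (ℓ-1) = 0 := by
      unfold pc
      rw [Nat.choose_eq_zero_of_lt h]; simp
    rw [this]
    exact pc_pos r ℓ hℓ hrl
  · have hf : (0:ℝ) < r.factorial := by exact_mod_cast Nat.factorial_pos r
    have h1 := pc_prod' r ℓ hℓ hrl
    have h2 := pc_prod' r (ℓ-1) (by omega) h
    have hlt : ∏ i ∈ range r, (1 - (i : ℝ) / ((ℓ-1 : ℕ):ℝ)) < ∏ i ∈ range r, (1 - (i : ℝ) / ℓ) := by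
      have hl1 : (0:ℝ) < ((ℓ-1 : ℕ):ℝ) := by exact_mod_cast (by omega : 0 < ℓ - 1)
      have hl : ((ℓ-1 : ℕ):ℝ) < ℓ := by exact_mod_cast (by omega : ℓ - 1 < ℓ)
      apply prod_lt_prod
      · intro i hi
        have : (i : ℝ) < ((ℓ-1 : ℕ):ℝ) := by
          have := mem_range.mp hi
          exact_mod_cast (by omega : i < ℓ - 1)
        have : (i : ℝ) / ((ℓ-1 : ℕ):ℝ) < 1 := by rw [div_lt_one hl1]; exact this
        linarith
      · intro i hi
        have : (i : ℝ) / ℓ ≤ (i : ℝ) / ((ℓ-1 : ℕ):ℝ) :=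
          div_le_div_of_nonneg_left (by positivity) hl1 hl.le
        linarith
      · refine ⟨1, mem_range.mpr (by omega), ?_⟩
        have : ((1:ℕ) : ℝ) / ℓ < ((1:ℕ) : ℝ) / ((ℓ-1 : ℕ):ℝ) :=
          div_lt_div_of_pos_left (by norm_num) hl1 hl
        linarith
    rw [← h1, ← h2] at hlt
    exact lt_of_mul_lt_mul_left hlt hf.le

end PartTwo

section PartC
open Finset
open scoped Classical

variable {r : ℕ}

/-- uncovered pairs of `F` -/
def upairs (F : HGraph r) : Finset (ℕ × ℕ) :=
  (F.verts ×ˢ F.verts).filter fun p =>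
        p.1 < p.2 ∧ ∀ e ∈ F.edges, ¬ (p.1 ∈ e ∧ p.2 ∈ e)

/-- the new vertices attached to a pair -/
def newv (F : HGraph r) (p : ℕ × ℕ) : Finset ℕ :=
  (Finset.range (r-2)).image fun s =>
        (F.verts.sup id + 1) + (p.1 * (F.verts.sup id + 1) + p.2) * r + s

theorem newv_card (F : HGraph r) (p : ℕ × ℕ) : (newv F p).card = r - 2 := by
  rw [newv, card_image_of_injective _ (fun a b h => by simpa using h), card_range]

theorem newv_notMem (F : HGraph r) (p : ℕ × ℕ) (v : ℕ) (hv : v ∈ newv F p) : v ∉ F.verts := by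
  intro h
  have h1 : id v ≤ F.verts.sup id := le_sup h
  obtain ⟨s, _, rfl⟩ := mem_image.mp hv
  simp only [id] at h1
  have := Nat.zero_le ((p.1 * (F.verts.sup id + 1) + p.2) * r)
  omega

theorem newv_unique (F : HGraph r) (p q : ℕ × ℕ) (hp : p ∈ upairs F) (hq : q ∈ upairs F) (v : ℕ)
    (hv : v ∈ newv F p) (hv' : v ∈ newv F q) : p = q := by
  obtain ⟨s, hs, rfl⟩ := mem_image.mp hv
  obtain ⟨s', hs', h⟩ := mem_image.mp hv'
  rw [mem_range] at hs hs'
  simp only [upairs, mem_filter, mem_product] at hp hq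
  have b1 : id p.2 ≤ F.verts.sup id := le_sup hp.1.2
  have b2 : id q.2 ≤ F.verts.sup id := le_sup hq.1.2
  simp only [id] at b1 b2
  set M := F.verts.sup id + 1
  have e1 : (q.1 * M + q.2) * r + s' = (p.1 * M + p.2) * r + s := by omega
  have e2 : q.1 * M + q.2 = p.1 * M + p.2 := by
    have := congrArg (· / r) e1
    beta_reduce at this
    rw [Nat.add_comm, Nat.add_mul_div_right _ _ (by omega : 0 < r), Nat.add_comm ((p.1 * M + p.2) * r),
      Nat.add_mul_div_right _ _ (by omega : 0 < r), Nat.div_eq_of_lt (by omega), Nat.div_eq_of_lt (by omega)] at this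
    omega
  have e3 : q.1 = p.1 := by
    have := congrArg (· / M) e2
    beta_reduce at this
    rw [Nat.add_comm, Nat.add_mul_div_right _ _ (by omega : 0 < M), Nat.add_comm (p.1 * M),
      Nat.add_mul_div_right _ _ (by omega : 0 < M), Nat.div_eq_of_lt (by omega), Nat.div_eq_of_lt (by omega)] at this
    omega
  have e4 : q.2 = p.2 := by rw [e3] at e2; omega
  exact Prod.ext e3.symm e4.symm

theorem mem_exp_verts (F : HGraph r) (v : ℕ) :
    v ∈ F.expansion.verts ↔ v ∈ F.verts ∨ ∃ p ∈ upairs F, v ∈ newv F p := by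
  simp only [HGraph.expansion, HGraph.ofEdges, mem_union, mem_biUnion]
  rfl

theorem exp_edge_cases (F : HGraph r) (e : Finset ℕ) (he : e ∈ F.expansion.edges) :
    e ∈ F.edges ∨ ∃ p ∈ upairs F, e = insert p.1 (insert p.2 (newv F p)) := by
  simp only [HGraph.expansion, HGraph.ofEdges, mem_filter, mem_union, mem_image] at he
  rcases he.1 with h | ⟨p, hp, h⟩
  · exact Or.inl h
  · refine Or.inr ⟨p, ?_, h.symm⟩
    simp only [upairs, mem_filter]; exact hp

theorem exp_edge_F (F : HGraph r) (e : Finset ℕ) (he : e ∈ F.edges) : e ∈ F.expansion.edges := by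
  simp only [HGraph.expansion, HGraph.ofEdges, mem_filter, mem_union]
  exact ⟨Or.inl he, fun v hv => mem_union_left _ (F.edges_sub e he hv), F.edges_card e he⟩

theorem exp_edge_new (F : HGraph r) (hr : 2 ≤ r) (p : ℕ × ℕ) (hp : p ∈ upairs F) :
    insert p.1 (insert p.2 (newv F p)) ∈ F.expansion.edges := by
  have hp' := hp
  simp only [upairs, mem_filter, mem_product] at hp'
  have hsub : insert p.1 (insert p.2 (newv F p)) ⊆ F.expansion.verts := by
    intro v hv
    rw [mem_exp_verts]
    simp only [mem_insert] at hv
    rcases hv with rfl | rfl | h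
    · exact Or.inl hp'.1.1
    · exact Or.inl hp'.1.2
    · exact Or.inr ⟨p, hp, h⟩
  have n2 : p.2 ∉ newv F p := fun h => newv_notMem F p _ h hp'.1.2
  have n1 : p.1 ∉ insert p.2 (newv F p) := by
    simp only [mem_insert, not_or]
    exact ⟨hp'.2.1.ne, fun h => newv_notMem F p _ h hp'.1.1⟩
  have hc : (insert p.1 (insert p.2 (newv F p))).card = r := by
    rw [card_insert_of_notMem n1, card_insert_of_notMem n2, newv_card]; omega
  simp only [HGraph.expansion, HGraph.ofEdges, mem_filter]
  exact ⟨mem_union_right _ (mem_image.mpr ⟨p, hp, rfl⟩), hsub, hc⟩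

/-- `g` embeds `F` in `H` -/
def Core (F H : HGraph r) (g : ℕ → ℕ) : Prop :=
  Set.InjOn g ↑F.verts ∧ (∀ v ∈ F.verts, g v ∈ H.verts) ∧ ∀ e ∈ F.edges, e.image g ∈ H.edges

/-- robustly covered pair -/
def Rob (H : HGraph r) (K x y : ℕ) : Prop :=
  ∀ X : Finset ℕ, X.card ≤ K → x ∉ X → y ∉ X → ∃ e ∈ H.edges, x ∈ e ∧ y ∈ e ∧ Disjoint e X

theorem exp_of_sets (F H : HGraph r) (g : ℕ → ℕ) (hg : Core F H g) (A : ℕ × ℕ → Finset ℕ)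
    (hA : ∀ p ∈ upairs F, (A p).card = r - 2)
    (hA1 : ∀ p ∈ upairs F, ∀ v ∈ F.verts, g v ∉ A p)
    (hA2 : ∀ p ∈ upairs F, ∀ q ∈ upairs F, p ≠ q → Disjoint (A p) (A q))
    (hA3 : ∀ p ∈ upairs F, insert (g p.1) (insert (g p.2) (A p)) ∈ H.edges) :
    F.expansion.IsCopyIn H := by
  have hb : ∀ p, ∃ φ : ℕ → ℕ, p ∈ upairs F → Set.BijOn φ ↑(newv F p) ↑(A p) := by
    intro p
    by_cases hp : p ∈ upairs F
    · obtain ⟨φ, hφ⟩ := bij_of_card (newv F p) (A p) (by rw [newv_card, hA p hp])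
      exact ⟨φ, fun _ => hφ⟩
    · exact ⟨id, fun h => absurd h hp⟩
  choose φ hφ using hb
  let f : ℕ → ℕ := fun v => if v ∈ F.verts then g v else
    if h : ∃ p ∈ upairs F, v ∈ newv F p then φ h.choose v else v
  have f1 : ∀ v ∈ F.verts, f v = g v := fun v hv => by simp [f, hv]
  have f2 : ∀ p ∈ upairs F, ∀ v ∈ newv F p, f v = φ p v := by
    intro p hp v hv
    have hn := newv_notMem F p v hv
    have hex : ∃ p ∈ upairs F, v ∈ newv F p := ⟨p, hp, hv⟩
    have : hex.choose = p := newv_unique F _ _ hex.choose_spec.1 hp v hex.choose_spec.2 hv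
    simp only [f, hn, if_false, dif_pos hex, this]
  have f3 : ∀ p ∈ upairs F, ∀ v ∈ newv F p, f v ∈ A p := fun p hp v hv => by
    rw [f2 p hp v hv]; exact (hφ p hp).mapsTo hv
  refine ⟨f, ?_, ?_, ?_⟩
  · intro u hu v hv huv
    rw [mem_coe, mem_exp_verts] at hu hv
    rcases hu with hu | ⟨p, hp, hu⟩ <;> rcases hv with hv | ⟨q, hq, hv⟩
    · rw [f1 u hu, f1 v hv] at huv; exact hg.1 hu hv huv
    · exfalso; rw [f1 u hu] at huv
      exact hA1 q hq u hu (huv ▸ f3 q hq v hv)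
    · exfalso; rw [f1 v hv] at huv
      exact hA1 p hp v hv (huv ▸ f3 p hp u hu)
    · by_cases hpq : p = q
      · subst hpq
        rw [f2 p hp u hu, f2 p hp v hv] at huv
        exact (hφ p hp).injOn hu hv huv
      · exfalso
        exact disjoint_left.mp (hA2 p hp q hq hpq) (f3 p hp u hu) (huv ▸ f3 q hq v hv)
  · intro v hv
    rw [mem_exp_verts] at hv
    rcases hv with hv | ⟨p, hp, hv⟩
    · rw [f1 v hv]; exact hg.2.1 v hv
    · refine H.edges_sub _ (hA3 p hp) ?_
      exact mem_insert_of_mem (mem_insert_of_mem (f3 p hp v hv))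
  · intro e he
    rcases exp_edge_cases F e he with h | ⟨p, hp, rfl⟩
    · rw [image_congr (g := g) (fun v hv => f1 v (F.edges_sub e h hv))]
      exact hg.2.2 e h
    · have hp' := hp
      simp only [upairs, mem_filter, mem_product] at hp'
      rw [image_insert, image_insert, f1 _ hp'.1.1, f1 _ hp'.1.2]
      have : (newv F p).image f = A p := by
        rw [image_congr (g := φ p) (fun v hv => f2 p hp v hv)]
        apply coe_injective
        rw [coe_image]; exact (hφ p hp).image_eq
      rw [this]; exact hA3 p hp

/-- robustness constant -/
def Kn (F : HGraph r) : ℕ := F.verts.card + (upairs F).card * r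

theorem exp_greedy (F H : HGraph r) (hr : 2 ≤ r) (g : ℕ → ℕ) (hg : Core F H g)
    (T0 : Finset (ℕ × ℕ)) (hT0 : T0 ⊆ upairs F) (A0 : ℕ × ℕ → Finset ℕ)
    (hA : ∀ p ∈ T0, (A0 p).card = r - 2)
    (hA1 : ∀ p ∈ T0, ∀ v ∈ F.verts, g v ∉ A0 p)
    (hA2 : ∀ p ∈ T0, ∀ q ∈ T0, p ≠ q → Disjoint (A0 p) (A0 q))
    (hA3 : ∀ p ∈ T0, insert (g p.1) (insert (g p.2) (A0 p)) ∈ H.edges)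
    (hrob : ∀ p ∈ upairs F, p ∉ T0 → Rob H (Kn F) (g p.1) (g p.2)) :
    F.expansion.IsCopyIn H := by
  have key : ∀ S : Finset (ℕ × ℕ), T0 ∪ S ⊆ upairs F → ∃ A : ℕ × ℕ → Finset ℕ,
      (∀ p ∈ T0 ∪ S, (A p).card = r - 2) ∧
      (∀ p ∈ T0 ∪ S, ∀ v ∈ F.verts, g v ∉ A p) ∧
      (∀ p ∈ T0 ∪ S, ∀ q ∈ T0 ∪ S, p ≠ q → Disjoint (A p) (A q)) ∧
      (∀ p ∈ T0 ∪ S, insert (g p.1) (insert (g p.2) (A p)) ∈ H.edges) := by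
    intro S
    induction S using Finset.induction_on with
    | empty =>
      intro _
      exact ⟨A0, by simpa using hA, by simpa using hA1, by simpa using hA2, by simpa using hA3⟩
    | insert q S hq ih =>
      intro hsub
      rw [union_insert] at hsub ⊢
      obtain ⟨A, a1, a2, a3, a4⟩ := ih (fun p hp => hsub (mem_insert_of_mem hp))
      by_cases hqT : q ∈ T0 ∪ S
      · rw [insert_eq_of_mem hqT]; exact ⟨A, a1, a2, a3, a4⟩
      have hqu : q ∈ upairs F := hsub (mem_insert_self _ _)
      have hqu' := hqu
      simp only [upairs, mem_filter, mem_product] at hqu'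
      have hr' := hrob q hqu (fun h => hqT (mem_union_left _ h))
      set X := ((F.verts.image g) ∪ (T0 ∪ S).biUnion A) \ {g q.1, g q.2} with hX
      have hXc : X.card ≤ Kn F := by
        calc X.card ≤ _ := card_le_card sdiff_subset
          _ ≤ (F.verts.image g).card + ((T0 ∪ S).biUnion A).card := card_union_le _ _
          _ ≤ F.verts.card + (T0 ∪ S).card * r := by
            apply Nat.add_le_add card_image_le
            apply card_biUnion_le_card_mul
            intro p hp; rw [a1 p hp]; omega
          _ ≤ Kn F := by
            rw [Kn]; gcongr
            exact fun p hp => hsub (mem_insert_of_mem hp)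
      obtain ⟨e, he, h1, h2, hd⟩ := hr' X hXc (by simp [hX]) (by simp [hX])
      have hne : g q.1 ≠ g q.2 := fun h => hqu'.2.1.ne (hg.1 hqu'.1.1 hqu'.1.2 h)
      have hBc : (e \ {g q.1, g q.2}).card = r - 2 := by
        rw [card_sdiff_of_subset (by intro x hx; simp at hx; rcases hx with rfl | rfl <;> assumption),
          card_pair hne, H.edges_card e he]
      have hBX : ∀ x ∈ e \ {g q.1, g q.2}, x ∉ (F.verts.image g) ∪ (T0 ∪ S).biUnion A := by
        intro x hx hx'
        rw [Finset.mem_sdiff] at hx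
        exact disjoint_left.mp hd hx.1 (Finset.mem_sdiff.mpr ⟨hx', hx.2⟩)
      have hBA : ∀ p ∈ T0 ∪ S, Disjoint (A p) (e \ {g q.1, g q.2}) := by
        intro p hp
        rw [disjoint_left]
        intro x hx hx'
        exact hBX x hx' (mem_union_right _ (mem_biUnion.mpr ⟨p, hp, hx⟩))
      have hneq : ∀ p ∈ T0 ∪ S, p ≠ q := fun p hp h => hqT (h ▸ hp)
      refine ⟨fun p => if p = q then e \ {g q.1, g q.2} else A p, ?_, ?_, ?_, ?_⟩
      · intro p hp
        rcases mem_insert.mp hp with rfl | hp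
        · simpa using hBc
        · simp only [hneq p hp, if_false]; exact a1 p hp
      · intro p hp v hv
        rcases mem_insert.mp hp with rfl | hp
        · intro h
          simp only [if_true] at h
          exact hBX _ h (mem_union_left _ (mem_image_of_mem _ hv))
        · simp only [hneq p hp, if_false]; exact a2 p hp v hv
      · intro p hp p' hp' hpp
        rcases mem_insert.mp hp with h1 | hp1 <;> rcases mem_insert.mp hp' with h2 | hp2
        · exact absurd (h1.trans h2.symm) hpp
        · simp only [hneq p' hp2, h1, if_false, if_true]; exact (hBA p' hp2).symm
        · simp only [hneq p hp1, h2, if_false, if_true]; exact (hBA p hp1)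
        · simp only [hneq p hp1, hneq p' hp2, if_false]; exact a3 p hp1 p' hp2 hpp
      · intro p hp
        rcases mem_insert.mp hp with rfl | hp
        · simp only [if_true]
          have : insert (g p.1) (insert (g p.2) (e \ {g p.1, g p.2})) = e := by
            ext x; simp only [mem_insert, Finset.mem_sdiff, mem_singleton]
            constructor
            · rintro (rfl | rfl | h)
              · exact h1
              · exact h2
              · exact h.1
            · tauto
          rw [this]; exact he
        · simp only [hneq p hp, if_false]; exact a4 p hp
  obtain ⟨A, a1, a2, a3, a4⟩ := key (upairs F) (union_subset hT0 (Subset.refl _))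
  rw [union_eq_right.mpr hT0] at a1 a2 a3 a4
  exact exp_of_sets F H g hg A a1 a2 a3 a4

/-- all uncovered pairs robust, except possibly a special one -/
theorem exp_of_rob (F H : HGraph r) (hr : 2 ≤ r) (g : ℕ → ℕ) (hg : Core F H g)
    (hrob : ∀ p ∈ upairs F, Rob H (Kn F) (g p.1) (g p.2)) :
    F.expansion.IsCopyIn H :=
  exp_greedy F H hr g hg ∅ (by simp) (fun _ => ∅) (by simp) (by simp) (by simp) (by simp)
    (fun p hp _ => hrob p hp)

theorem exp_of_rob_special (F H : HGraph r) (hr : 2 ≤ r) (g : ℕ → ℕ) (hg : Core F H g)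
    (a b : ℕ) (hab : (a, b) ∈ upairs F) (e0 : Finset ℕ) (he0 : e0 ∈ H.edges) (ha : g a ∈ e0)
    (hb : g b ∈ e0) (hd : ∀ v ∈ F.verts, v ≠ a → v ≠ b → g v ∉ e0)
    (hrob : ∀ p ∈ upairs F, p ≠ (a, b) → Rob H (Kn F) (g p.1) (g p.2)) :
    F.expansion.IsCopyIn H := by
  have hab' := hab
  simp only [upairs, mem_filter, mem_product] at hab'
  have hne : g a ≠ g b := fun h => hab'.2.1.ne (hg.1 hab'.1.1 hab'.1.2 h)
  refine exp_greedy F H hr g hg {(a,b)} (by simpa using hab) (fun _ => e0 \ {g a, g b}) ?_ ?_ ?_ ?_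
    (fun p hp hp' => hrob p hp (by simpa using hp'))
  · intro p _
    rw [card_sdiff_of_subset (by intro x hx; simp at hx; rcases hx with rfl | rfl <;> assumption),
          card_pair hne, H.edges_card e0 he0]
  · intro p _ v hv h
    simp only [Finset.mem_sdiff, mem_insert, mem_singleton, not_or] at h
    exact hd v hv (fun hh => h.2.1 (by rw [hh])) (fun hh => h.2.2 (by rw [hh])) h.1
  · intro p hp q hq hpq
    rw [mem_singleton] at hp hq
    exact absurd (hp.trans hq.symm) hpq
  · intro p hp
    rw [mem_singleton] at hp
    subst hp
    have : insert (g a) (insert (g b) (e0 \ {g a, g b})) = e0 := by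
      ext x; simp only [mem_insert, Finset.mem_sdiff, mem_singleton]
      constructor
      · rintro (rfl | rfl | h)
        · exact ha
        · exact hb
        · exact h.1
      · tauto
    simp only [this]; exact he0

/-- no core all of whose pairs are covered -/
def KFree (F H : HGraph r) : Prop :=
  ¬ ∃ g, Core F H g ∧ ∀ x ∈ F.verts, ∀ y ∈ F.verts, x ≠ y → ∃ e ∈ H.edges, g x ∈ e ∧ g y ∈ e

theorem core_of_exp (F H : HGraph r) (hr : 2 ≤ r) (h : F.expansion.IsCopyIn H) :
    ∃ g, Core F H g ∧ ∀ x ∈ F.verts, ∀ y ∈ F.verts, x ≠ y → ∃ e ∈ H.edges, g x ∈ e ∧ g y ∈ e := by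
  obtain ⟨f, f1, f2, f3⟩ := h
  have hsub : ∀ v ∈ F.verts, v ∈ F.expansion.verts := fun v hv => (mem_exp_verts F v).mpr (Or.inl hv)
  refine ⟨f, ⟨fun u hu v hv h => f1 (hsub u hu) (hsub v hv) h, fun v hv => f2 v (hsub v hv),
    fun e he => f3 e (exp_edge_F F e he)⟩, ?_⟩
  have main : ∀ x ∈ F.verts, ∀ y ∈ F.verts, x < y → ∃ e ∈ H.edges, f x ∈ e ∧ f y ∈ e := by
    intro x hx y hy hxy
    by_cases hc : ∃ e ∈ F.edges, x ∈ e ∧ y ∈ e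
    · obtain ⟨e, he, h1, h2⟩ := hc
      exact ⟨e.image f, f3 e (exp_edge_F F e he), mem_image_of_mem _ h1, mem_image_of_mem _ h2⟩
    · push Not at hc
      have hp : (x, y) ∈ upairs F := by
        simp only [upairs, mem_filter, mem_product]
        exact ⟨⟨hx, hy⟩, hxy, fun e he h => hc e he h.1 h.2⟩
      refine ⟨_, f3 _ (exp_edge_new F hr _ hp), mem_image_of_mem _ (by simp), mem_image_of_mem _ (by simp)⟩
  intro x hx y hy hxy
  rcases lt_or_gt_of_ne hxy with h | h
  · exact main x hx y hy h
  · obtain ⟨e, he, h1, h2⟩ := main y hy x hx h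
    exact ⟨e, he, h2, h1⟩

theorem exp_free_of_KFree (F H : HGraph r) (hr : 2 ≤ r) (h : KFree F H) : ¬ F.expansion.IsCopyIn H :=
  fun h' => h (core_of_exp F H hr h')

theorem KFree_of_KlSub (ℓ : ℕ) (F H : HGraph r) (hF : F.verts.card = ℓ + 1) (h : IsKlSub r ℓ H) :
    KFree F H := by
  rintro ⟨g, hg, hc⟩
  obtain ⟨f, f1, f2⟩ := h
  have : (F.verts.image (fun v => f (g v))).card ≤ (range ℓ).card := by
    apply card_le_card
    intro x hx
    obtain ⟨v, hv, rfl⟩ := mem_image.mp hx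
    exact mem_range.mpr (f1 _ (hg.2.1 v hv))
  rw [card_image_of_injOn, hF, card_range] at this
  · omega
  · intro u hu v hv huv
    by_contra hne
    obtain ⟨e, he, h1, h2⟩ := hc u hu v hv hne
    exact hne (hg.1 hu hv (f2 e he _ h1 _ h2 huv))

end PartC

section PartD
open Finset
open scoped Classical

variable {r : ℕ}

theorem kl_sub_rb (ℓ : ℕ) (H : HGraph r) (f : ℕ → ℕ)
    (h : ∀ e ∈ H.edges, ∀ u ∈ e, ∀ v ∈ e, f u = f v → u = v) : H.edges ⊆ rb f H.verts r := by
  intro e he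
  rw [mem_rb]
  exact ⟨H.edges_sub e he, H.edges_card e he, fun u hu v hv => h e he u hu v hv⟩

theorem card_rb_le_tau (ℓ : ℕ) (hr : 2 ≤ r) (hℓ : 0 < ℓ) (V : Finset ℕ) (f : ℕ → ℕ)
    (hf : ∀ v ∈ V, f v < ℓ) : (rb f V r).card ≤ tau r ℓ V.card := by
  rw [card_rb f V (range ℓ) r (fun v hv => mem_range.mpr (hf v hv))]
  refine (es_le_tau r ℓ hr hℓ _).trans ?_
  rw [sum_cls V f (range ℓ) (fun v hv => mem_range.mpr (hf v hv))]

theorem kl_le_tau (ℓ : ℕ) (hr : 2 ≤ r) (hℓ : 0 < ℓ) (H : HGraph r) (h : IsKlSub r ℓ H) :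
    H.edges.card ≤ tau r ℓ H.verts.card := by
  obtain ⟨f, hf, h⟩ := h
  exact (card_le_card (kl_sub_rb ℓ H f h)).trans (card_rb_le_tau ℓ hr hℓ _ f hf)

theorem kl_eq (ℓ : ℕ) (hr : 2 ≤ r) (hrl : r ≤ ℓ) (H : HGraph r) (h : IsKlSub r ℓ H)
    (hn : ℓ ≤ H.verts.card) (he : H.edges.card = tau r ℓ H.verts.card) :
    ∃ c : ℕ → ℕ, (∀ v ∈ H.verts, c v < ℓ) ∧ H.edges = rb c H.verts r ∧
      Bal (range ℓ) (fun i => (cls H.verts c i).card) := by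
  have hℓ : 0 < ℓ := by omega
  obtain ⟨f, hf, h⟩ := h
  have h1 := kl_sub_rb ℓ H f h
  have h2 := card_rb_le_tau ℓ hr hℓ H.verts f hf
  have h3 := card_le_card h1
  have hI : ∀ v ∈ H.verts, f v ∈ range ℓ := fun v hv => mem_range.mpr (hf v hv)
  refine ⟨f, hf, eq_of_subset_of_card_le h1 (by omega), ?_⟩
  have hs := sum_cls H.verts f (range ℓ) hI
  refine bal_of_es_eq r ℓ hr hℓ _ ?_ ?_
  · rw [hs, ← card_rb f H.verts (range ℓ) r hI]; omega
  · rw [hs]; exact tau_pos r ℓ hℓ hrl _ hn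

theorem turan_edges (ℓ : ℕ) (V : Finset ℕ) : (turanOn r ℓ V).edges = rb (fun v => v % ℓ) V r := by
  ext e
  simp only [turanOn, HGraph.ofEdges, mem_filter, mem_powersetCard, mem_rb]
  constructor
  · rintro ⟨⟨h1, h2⟩, _⟩
    exact ⟨h1.1, h1.2, fun u hu v hv => h2 u hu v hv⟩
  · rintro ⟨h1, h2, h3⟩
    exact ⟨⟨⟨h1, h2⟩, fun u hu v hv h => h3 hu hv h⟩, h1, h2⟩

theorem turan_kl (ℓ : ℕ) (hℓ : 0 < ℓ) (V : Finset ℕ) : IsKlSub r ℓ (turanOn r ℓ V) := by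
  refine ⟨fun v => v % ℓ, fun v _ => Nat.mod_lt _ hℓ, ?_⟩
  intro e he u hu v hv h
  rw [turan_edges, mem_rb] at he
  exact he.2.2 hu hv h

theorem card_turan (ℓ : ℕ) (hℓ : 0 < ℓ) (a b : ℕ) (hab : a ≤ b) :
    (turanOn r ℓ (Ico a b)).edges.card = tau r ℓ (b - a) := by
  have hI : ∀ v ∈ Ico a b, v % ℓ ∈ range ℓ := fun v _ => mem_range.mpr (Nat.mod_lt _ hℓ)
  rw [turan_edges, card_rb _ _ (range ℓ) r hI, tau_eq r ℓ hℓ _ (bal_Ico ℓ hℓ a b hab),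
    sum_cls _ _ _ hI, Nat.card_Ico]

theorem exists_colour_bij (ℓ : ℕ) (hℓ : 0 < ℓ) (V : Finset ℕ) (c : ℕ → ℕ) (hc : ∀ v ∈ V, c v < ℓ)
    (hb : Bal (range ℓ) (fun i => (cls V c i).card)) (a b : ℕ) (hab : a ≤ b) (hV : V.card = b - a) :
    ∃ f : ℕ → ℕ, Set.BijOn f ↑V ↑(Ico a b) ∧
      ∀ u ∈ V, ∀ v ∈ V, (c u = c v ↔ f u % ℓ = f v % ℓ) := by
  have hI : ∀ v ∈ Ico a b, v % ℓ ∈ range ℓ := fun v _ => mem_range.mpr (Nat.mod_lt _ hℓ)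
  have hIc : ∀ v ∈ V, c v ∈ range ℓ := fun v hv => mem_range.mpr (hc v hv)
  obtain ⟨σ, hσ, hσ2⟩ := bal_perm (range ℓ) _ _ hb (bal_Ico ℓ hℓ a b hab) (by
    rw [sum_cls _ _ _ hI, sum_cls _ _ _ hIc, Nat.card_Ico, hV])
  have hex : ∀ i, ∃ φ : ℕ → ℕ, i ∈ range ℓ →
      Set.BijOn φ ↑(cls V c i) ↑(cls (Ico a b) (fun v => v % ℓ) (σ i)) := by
    intro i
    by_cases hi : i ∈ range ℓ
    · obtain ⟨φ, h⟩ := bij_of_card _ _ (hσ2 i hi).symm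
      exact ⟨φ, fun _ => h⟩
    · exact ⟨id, fun h => absurd h hi⟩
  choose φ hφ using hex
  have hmap : ∀ v ∈ V, φ (c v) v ∈ cls (Ico a b) (fun v => v % ℓ) (σ (c v)) := fun v hv =>
    (hφ (c v) (hIc v hv)).mapsTo (mem_coe.mpr (mem_cls.mpr ⟨hv, rfl⟩))
  have hcol : ∀ u ∈ V, ∀ v ∈ V, (c u = c v ↔ φ (c u) u % ℓ = φ (c v) v % ℓ) := by
    intro u hu v hv
    have h1 := (mem_cls.mp (hmap u hu)).2
    have h2 := (mem_cls.mp (hmap v hv)).2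
    rw [h1, h2]
    exact ⟨fun h => by rw [h], fun h => hσ.injOn (hIc u hu) (hIc v hv) h⟩
  have hmaps : Set.MapsTo (fun v => φ (c v) v) ↑V ↑(Ico a b) := fun v hv =>
    mem_coe.mpr (mem_cls.mp (hmap v hv)).1
  have hinj : Set.InjOn (fun v => φ (c v) v) (V : Set ℕ) := by
    intro u hu v hv h
    simp only at h
    have hcc : c u = c v := (hcol u hu v hv).mpr (by rw [h])
    have hb := hφ (c u) (hIc u hu)
    rw [← hcc] at h
    exact hb.injOn (mem_coe.mpr (mem_cls.mpr ⟨hu, rfl⟩)) (mem_coe.mpr (mem_cls.mpr ⟨hv, hcc.symm⟩)) h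
  refine ⟨fun v => φ (c v) v, ⟨hmaps, hinj, ?_⟩, hcol⟩
  exact Finset.surjOn_of_injOn_of_card_le _ hmaps hinj (by rw [hV, Nat.card_Ico])

/-! counting -/

theorem card_supersets (V T : Finset ℕ) (k : ℕ) :
    ((powersetCard k V).filter (fun e => T ⊆ e)).card ≤ V.card ^ (k - T.card) := by
  have : ((powersetCard k V).filter (fun e => T ⊆ e)).card ≤ (powersetCard (k - T.card) V).card := by
    apply card_le_card_of_injOn (fun e => e \ T)
    · intro e he
      simp only [coe_filter, mem_powersetCard, Set.mem_setOf_eq, mem_coe] at he ⊢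
      exact ⟨sdiff_subset.trans he.1.1, by rw [card_sdiff_of_subset he.2, he.1.2]⟩
    · intro e he f hf h
      simp only [coe_filter, mem_powersetCard, Set.mem_setOf_eq] at he hf
      simp only at h
      rw [← sdiff_union_of_subset he.2, h, sdiff_union_of_subset hf.2]
  rw [card_powersetCard] at this
  exact this.trans (Nat.choose_le_pow _ _)

theorem edges_sub_powerset (H : HGraph r) : H.edges ⊆ powersetCard r H.verts := fun e he =>
  mem_powersetCard.mpr ⟨H.edges_sub e he, H.edges_card e he⟩

theorem card_edges_sup (H : HGraph r) (T : Finset ℕ) :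
    (H.edges.filter (fun e => T ⊆ e)).card ≤ H.verts.card ^ (r - T.card) :=
  (card_le_card (filter_subset_filter _ (edges_sub_powerset H))).trans (card_supersets _ _ _)

theorem deg_le (H : HGraph r) (v : ℕ) : H.deg v ≤ H.verts.card ^ (r - 1) := by
  have := card_edges_sup H {v}
  simpa [HGraph.deg] using this

theorem card_edges_pair (H : HGraph r) (u v : ℕ) (huv : u ≠ v) :
    (H.edges.filter (fun e => u ∈ e ∧ v ∈ e)).card ≤ H.verts.card ^ (r - 2) := by
  have := card_edges_sup H {u, v}
  simpa [card_pair huv, insert_subset_iff] using this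

theorem card_edges_le (H : HGraph r) : H.edges.card ≤ H.verts.card ^ r := by
  have := card_edges_sup H ∅
  simpa using this

theorem handshake (H : HGraph r) : ∑ v ∈ H.verts, H.deg v = r * H.edges.card := by
  simp only [HGraph.deg, card_filter]
  rw [sum_comm]
  rw [mul_comm, ← smul_eq_mul, ← sum_const]
  apply sum_congr rfl
  intro e he
  rw [← card_filter]
  refine Eq.trans ?_ (H.edges_card e he)
  congr 1
  ext v
  simp only [mem_filter]
  exact ⟨fun h => h.2, fun h => ⟨H.edges_sub e he h, h⟩⟩

theorem mem_induce (H : HGraph r) (S : Finset ℕ) (e : Finset ℕ) :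
    e ∈ (H.induce S).edges ↔ e ∈ H.edges ∧ e ⊆ S := by
  simp only [HGraph.induce, HGraph.ofEdges, mem_filter]
  constructor
  · rintro ⟨h, _⟩; exact h
  · rintro ⟨h1, h2⟩
    exact ⟨⟨h1, h2⟩, subset_inter (H.edges_sub e h1) h2, H.edges_card e h1⟩

theorem induce_verts (H : HGraph r) (S : Finset ℕ) : (H.induce S).verts = H.verts ∩ S := rfl

theorem copy_mono (F G H : HGraph r) (hv : G.verts ⊆ H.verts) (he : G.edges ⊆ H.edges)
    (h : F.IsCopyIn G) : F.IsCopyIn H := by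
  obtain ⟨f, h1, h2, h3⟩ := h
  exact ⟨f, h1, fun v hv' => hv (h2 v hv'), fun e he' => he (h3 e he')⟩

theorem induce_copy (F H : HGraph r) (S : Finset ℕ) (h : F.IsCopyIn (H.induce S)) : F.IsCopyIn H :=
  copy_mono F _ H (by rw [induce_verts]; exact inter_subset_left)
    (fun e he => ((mem_induce H S e).mp he).1) h

/-- removing a set of vertices -/
theorem card_remove (H : HGraph r) (X : Finset ℕ) :
    H.edges.card ≤ (H.induce (H.verts \ X)).edges.card + ∑ x ∈ X, H.deg x := by
  have : H.edges ⊆ (H.induce (H.verts \ X)).edges ∪ X.biUnion (fun x => H.edges.filter (fun e => x ∈ e)) := by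
    intro e he
    by_cases h : ∃ x ∈ X, x ∈ e
    · obtain ⟨x, hx, hxe⟩ := h
      exact mem_union_right _ (mem_biUnion.mpr ⟨x, hx, mem_filter.mpr ⟨he, hxe⟩⟩)
    · push Not at h
      refine mem_union_left _ ((mem_induce _ _ _).mpr ⟨he, fun v hv => ?_⟩)
      exact Finset.mem_sdiff.mpr ⟨H.edges_sub e he hv, fun hx => h v hx hv⟩
  calc H.edges.card ≤ _ := card_le_card this
    _ ≤ _ := card_union_le _ _
    _ ≤ _ := Nat.add_le_add_left card_biUnion_le _

theorem induce_deg_le (H : HGraph r) (S : Finset ℕ) (v : ℕ) : (H.induce S).deg v ≤ H.deg v := by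
  apply card_le_card
  intro e he
  rw [mem_filter, mem_induce] at he
  exact mem_filter.mpr ⟨he.1.1, he.2⟩

theorem verts_remove (H : HGraph r) (X : Finset ℕ) :
    (H.induce (H.verts \ X)).verts = H.verts \ X := by
  rw [induce_verts]; exact inter_eq_right.mpr sdiff_subset

/-- the spanning subgraph of edges satisfying a predicate -/
noncomputable def resE (H : HGraph r) (P : Finset ℕ → Prop) : HGraph r where
  verts := H.verts
  edges := H.edges.filter P
  edges_sub := fun e he => H.edges_sub e (mem_filter.mp he).1
  edges_card := fun e he => H.edges_card e (mem_filter.mp he).1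

end PartD

section PartE
open Finset
open scoped Classical

variable {r : ℕ}

/-- the full blowup of `W` given by a partition function -/
noncomputable def blow (W : HGraph r) (V : Finset ℕ) (c : ℕ → ℕ) : HGraph r where
  verts := V
  edges := V.powerset.filter (fun e : Finset ℕ => Set.InjOn c e ∧ e.image c ∈ W.edges)
  edges_sub := fun e he => mem_powerset.mp (mem_filter.mp he).1
  edges_card := fun e he => by
    have h := (mem_filter.mp he).2
    rw [← card_image_of_injOn h.1, W.edges_card _ h.2]

theorem blow_isBlowup (W : HGraph r) (V : Finset ℕ) (c : ℕ → ℕ) (hc : ∀ v ∈ V, c v ∈ W.verts) :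
    IsBlowupOf W (blow W V c) := by
  refine ⟨c, hc, fun e => ?_⟩
  simp only [blow, mem_filter, mem_powerset, map_val_eq_iff]
  constructor
  · rintro ⟨h1, h2, h3⟩
    exact ⟨h1, by rw [← card_image_of_injOn h2, W.edges_card _ h3], _, h3, h2, rfl⟩
  · rintro ⟨h1, h2, f, hf, h3, rfl⟩
    exact ⟨h1, h3, hf⟩

theorem blow_card (W : HGraph r) (V : Finset ℕ) (c : ℕ → ℕ) :
    (blow W V c).edges.card = ∑ f ∈ W.edges, ∏ i ∈ f, (cls V c i).card := by
  rw [← card_fiber_family]; rfl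

theorem blowup_edges (W G : HGraph r) (c : ℕ → ℕ)
    (h : ∀ e : Finset ℕ, e ∈ G.edges ↔
      (e ⊆ G.verts ∧ e.card = r ∧ ∃ f ∈ W.edges, Multiset.map c e.val = f.val)) :
    G.edges = (blow W G.verts c).edges := by
  ext e
  rw [h e]
  simp only [blow, mem_filter, mem_powerset, map_val_eq_iff]
  constructor
  · rintro ⟨h1, h2, f, hf, h3, rfl⟩
    exact ⟨h1, h3, hf⟩
  · rintro ⟨h1, h2, h3⟩
    exact ⟨h1, by rw [← card_image_of_injOn h2, W.edges_card _ h3], _, h3, h2, rfl⟩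

/-- maximum number of edges in a blowup -/
noncomputable def Lam (W : HGraph r) (n : ℕ) : ℕ :=
  sSup {m | ∃ G : HGraph r, IsBlowupOf W G ∧ G.verts.card = n ∧ G.edges.card = m}

theorem Lam_bdd (W : HGraph r) (n : ℕ) :
    BddAbove {m | ∃ G : HGraph r, IsBlowupOf W G ∧ G.verts.card = n ∧ G.edges.card = m} := by
  refine ⟨n ^ r, ?_⟩
  rintro m ⟨G, _, rfl, rfl⟩
  exact card_edges_le G

theorem le_Lam (W G : HGraph r) (h : IsBlowupOf W G) : G.edges.card ≤ Lam W G.verts.card :=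
  le_csSup (Lam_bdd W _) ⟨G, h, rfl, rfl⟩

theorem blowup_induce (W G : HGraph r) (h : IsBlowupOf W G) (S : Finset ℕ) :
    IsBlowupOf W (G.induce S) := by
  obtain ⟨c, h1, h2⟩ := h
  refine ⟨c, fun v hv => h1 v (mem_of_mem_inter_left hv), fun e => ?_⟩
  rw [mem_induce, h2, induce_verts, subset_inter_iff]
  tauto

theorem Lam_step (W : HGraph r) (m : ℕ) (hm : r ≤ m) :
    (m + 1 - r) * Lam W (m+1) ≤ (m + 1) * Lam W m := by
  rcases Set.eq_empty_or_nonempty {k | ∃ G : HGraph r, IsBlowupOf W G ∧ G.verts.card = m+1 ∧ G.edges.card = k} with h | h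
  · have : Lam W (m+1) = 0 := by rw [Lam, h]; simp
    rw [this]; simp
  · obtain ⟨G, hG, hn, he⟩ := Nat.sSup_mem h (Lam_bdd W (m+1))
    change G.edges.card = Lam W (m+1) at he
    rw [← he]
    have h1 : ∀ v ∈ G.verts, G.edges.card - G.deg v ≤ Lam W m := by
      intro v hv
      have hb := le_Lam W _ (blowup_induce W G hG (G.verts \ {v}))
      have hc := card_remove G {v}
      rw [sum_singleton] at hc
      rw [verts_remove, card_sdiff_of_subset (by simpa using hv), hn, card_singleton,
        Nat.add_sub_cancel] at hb
      omega
    have h2 : ∀ v ∈ G.verts, G.deg v + (G.edges.card - G.deg v) = G.edges.card := by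
      intro v hv
      have : G.deg v ≤ G.edges.card := card_le_card (filter_subset _ _)
      omega
    have h3 := sum_congr (rfl : G.verts = G.verts) h2
    rw [sum_add_distrib, handshake, sum_const, smul_eq_mul, hn] at h3
    have h4 : ∑ v ∈ G.verts, (G.edges.card - G.deg v) ≤ (m+1) * Lam W m := by
      calc _ ≤ ∑ v ∈ G.verts, Lam W m := sum_le_sum h1
        _ = _ := by rw [sum_const, smul_eq_mul, hn]
    have h5 : (m + 1 - r) * G.edges.card + r * G.edges.card = (m+1) * G.edges.card := by
      rw [← add_mul]; congr 1; omega
    omega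

theorem Lam_ratio (W : HGraph r) (m : ℕ) (hm : r ≤ m) :
    (Lam W (m+1) : ℝ) / ((m+1).choose r : ℝ) ≤ (Lam W m : ℝ) / (m.choose r : ℝ) := by
  have h := Lam_step W m hm
  have hc : (m+1).choose r * (m + 1 - r) = (m+1) * m.choose r := by
    have := Nat.choose_mul_succ_eq m r
    linarith
  have p1 : 0 < (m+1).choose r := Nat.choose_pos (by omega)
  have p2 : 0 < m.choose r := Nat.choose_pos hm
  rw [div_le_div_iff₀ (by exact_mod_cast p1) (by exact_mod_cast p2)]
  norm_cast
  have p3 : 0 < m + 1 - r := by omega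
  apply Nat.le_of_mul_le_mul_left _ p3
  calc (m+1-r) * (Lam W (m+1) * m.choose r) = ((m+1-r) * Lam W (m+1)) * m.choose r := by ring
    _ ≤ ((m+1) * Lam W m) * m.choose r := Nat.mul_le_mul_right _ h
    _ = Lam W m * ((m+1) * m.choose r) := by ring
    _ = Lam W m * ((m+1).choose r * (m + 1 - r)) := by rw [hc]
    _ = _ := by ring

theorem Lam_tendsto (W : HGraph r) :
    Tendsto (fun n => (Lam W n : ℝ) / (n.choose r : ℝ)) atTop (nhds (hgLagrangian r W)) := by
  have hanti : Antitone (fun n => (Lam W (n+r) : ℝ) / ((n+r).choose r : ℝ)) :=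
    antitone_nat_of_succ_le (fun n => by
      have := Lam_ratio W (n+r) (by omega)
      rw [show n + 1 + r = n + r + 1 by ring]; exact this)
  have hb : BddBelow (Set.range (fun n => (Lam W (n+r) : ℝ) / ((n+r).choose r : ℝ))) := by
    refine ⟨0, ?_⟩
    rintro _ ⟨n, rfl⟩
    positivity
  have ht := tendsto_atTop_ciInf hanti hb
  have ht' := (tendsto_add_atTop_iff_nat (f := fun n => (Lam W n : ℝ) / (n.choose r : ℝ)) r).mp ht
  have := ht'.limUnder_eq
  have h2 : hgLagrangian r W = _ := this
  rw [h2]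
  exact ht'

theorem lag_bound (W G : HGraph r) (hr : 2 ≤ r) (hG : IsBlowupOf W G) :
    (r.factorial : ℝ) * G.edges.card ≤ hgLagrangian r W * (G.verts.card : ℝ) ^ r := by
  set k := G.verts.card with hk
  rcases Nat.eq_zero_or_pos k with h0 | hkpos
  · rcases Nat.eq_zero_or_pos G.edges.card with h1 | h1
    · rw [h1]
      have : 0 ≤ hgLagrangian r W := ge_of_tendsto' (Lam_tendsto W) (fun n => by positivity)
      simp only [Nat.cast_zero, mul_zero]; positivity
    · -- the empty graph has an edge only if r = 0
      obtain ⟨e, he⟩ := card_pos.mp h1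
      have h2 : e = ∅ := by
        have := G.edges_sub e he
        have hv : G.verts = ∅ := card_eq_zero.mp (hk.symm.trans h0)
        rw [hv] at this
        exact subset_empty.mp this
      have h3 : r = 0 := by rw [← G.edges_card e he, h2, card_empty]
      omega
  obtain ⟨c, hc, hE⟩ := hG
  have hEc : G.edges.card = ∑ f ∈ W.edges, ∏ i ∈ f, (cls G.verts c i).card := by
    rw [blowup_edges W G c hE, blow_card]
  have hq : ∀ q : ℕ, q ^ r * G.edges.card ≤ Lam W (k * q) := by
    intro q
    set V' := (G.verts ×ˢ range q).image (fun p => Nat.pair p.1 p.2) with hV'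
    have hinj : Set.InjOn (fun p : ℕ × ℕ => Nat.pair p.1 p.2) (↑(G.verts ×ˢ range q)) := by
      intro a _ b _ h
      have := Nat.pair_eq_pair.mp h
      exact Prod.ext this.1 this.2
    have hV'c : V'.card = k * q := by
      rw [hV', card_image_of_injOn hinj, card_product, card_range]
    have hcl : ∀ i, (cls V' (fun v => c (Nat.unpair v).1) i).card = q * (cls G.verts c i).card := by
      intro i
      have : cls V' (fun v => c (Nat.unpair v).1) i = ((cls G.verts c i) ×ˢ range q).image (fun p => Nat.pair p.1 p.2) := by
        ext v
        simp only [mem_cls, hV', mem_image, mem_product]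
        constructor
        · rintro ⟨⟨p, ⟨h1, h2⟩, rfl⟩, h3⟩
          refine ⟨p, ⟨⟨h1, by simpa using h3⟩, h2⟩, rfl⟩
        · rintro ⟨p, ⟨⟨h1, h2⟩, h3⟩, rfl⟩
          exact ⟨⟨p, ⟨h1, h3⟩, rfl⟩, by simpa using h2⟩
      rw [this, card_image_of_injOn, card_product, card_range, mul_comm]
      intro a _ b _ h
      have := Nat.pair_eq_pair.mp h
      exact Prod.ext this.1 this.2
    have hb : IsBlowupOf W (blow W V' (fun v => c (Nat.unpair v).1)) := by
      apply blow_isBlowup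
      intro v hv
      rw [hV', mem_image] at hv
      obtain ⟨p, hp, rfl⟩ := hv
      rw [mem_product] at hp
      simpa using hc _ hp.1
    have h1 := le_Lam W _ hb
    have h2 : (blow W V' (fun v => c (Nat.unpair v).1)).verts.card = k * q := hV'c
    rw [h2, blow_card] at h1
    refine le_trans (le_of_eq ?_) h1
    rw [hEc, mul_sum]
    apply sum_congr rfl
    intro f hf
    rw [prod_congr rfl (fun i _ => hcl i), prod_mul_distrib, prod_const, W.edges_card f hf]
  have hkr : (0:ℝ) < k := by exact_mod_cast hkpos
  have hsub : Tendsto (fun q : ℕ => k * q) atTop atTop :=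
    Filter.tendsto_id.const_mul_atTop' hkpos
  have hlim := (Lam_tendsto W).comp hsub
  have hge : (r.factorial : ℝ) * G.edges.card / (k:ℝ)^r ≤ hgLagrangian r W := by
    apply ge_of_tendsto hlim
    filter_upwards [eventually_ge_atTop r, eventually_ge_atTop 1] with q hq1 hq2
    have hkq : r ≤ k * q := by nlinarith
    have hch : 0 < (k*q).choose r := Nat.choose_pos hkq
    have hch' : (0:ℝ) < ((k*q).choose r : ℝ) := by exact_mod_cast hch
    simp only [Function.comp]
    rw [div_le_div_iff₀ (by positivity) hch']
    have hle : ((k*q).choose r : ℝ) ≤ ((k * q : ℕ) : ℝ)^r / r.factorial := Nat.choose_le_pow_div r (k*q)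
    have hfp : (0:ℝ) < r.factorial := by exact_mod_cast Nat.factorial_pos r
    rw [le_div_iff₀ hfp] at hle
    have hqq : ((q:ℝ)^r * G.edges.card) ≤ Lam W (k*q) := by exact_mod_cast hq q
    push_cast at hle
    calc (r.factorial : ℝ) * G.edges.card * ((k*q).choose r : ℝ)
        = G.edges.card * (((k*q).choose r : ℝ) * r.factorial) := by ring
      _ ≤ G.edges.card * ((k:ℝ) * q)^r := by gcongr
      _ = ((q:ℝ)^r * G.edges.card) * (k:ℝ)^r := by rw [mul_pow]; ring
      _ ≤ _ := by gcongr
  rwa [div_le_iff₀ (by positivity)] at hge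

end PartE

section PartF
open Finset
open scoped Classical

variable {r : ℕ}

/-- the complete rainbow graph -/
noncomputable def rbG (r : ℕ) (c : ℕ → ℕ) (U : Finset ℕ) : HGraph r where
  verts := U
  edges := rb c U r
  edges_sub := fun e he => (mem_rb.mp he).1
  edges_card := fun e he => (mem_rb.mp he).2.1

/-- crossing degree inside `U` -/
noncomputable def cdeg (H : HGraph r) (c : ℕ → ℕ) (U : Finset ℕ) (u : ℕ) : ℕ :=
  (H.edges.filter (fun e => u ∈ e ∧ e ⊆ U ∧ Set.InjOn c e)).card

/-- `U` is a large set of vertices of large crossing degree -/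
structure Good (ℓ : ℕ) (H : HGraph r) (c : ℕ → ℕ) (U : Finset ℕ) (η : ℝ) : Prop where
  sub : U ⊆ H.verts
  col : ∀ v ∈ H.verts, c v < ℓ
  big : ((H.verts \ U).card : ℝ) ≤ η * H.verts.card
  deg : ∀ u ∈ U, (r * pc r ℓ - η) * (H.verts.card : ℝ) ^ (r-1) ≤ cdeg H c U u

theorem cdeg_le (H : HGraph r) (c : ℕ → ℕ) (U : Finset ℕ) (u : ℕ) :
    cdeg H c U u ≤ (rbG r c U).deg u := by
  apply card_le_card
  intro e he
  rw [mem_filter] at he ⊢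
  exact ⟨mem_rb.mpr ⟨he.2.2.1, H.edges_card e he.1, he.2.2.2⟩, he.2.1⟩

theorem rbG_deg (hr : 1 ≤ r) (c : ℕ → ℕ) (U : Finset ℕ) (u : ℕ) (hu : u ∈ U) :
    (rbG r c U).deg u = (rb c (U \ cls U c (c u)) (r-1)).card := by
  apply card_bij (fun e _ => e.erase u)
  · intro e he
    rw [mem_filter] at he
    obtain ⟨h1, h2⟩ := he
    obtain ⟨h3, h4, h5⟩ := mem_rb.mp h1
    rw [mem_rb]
    refine ⟨?_, by rw [card_erase_of_mem h2, h4], h5.mono (coe_subset.mpr (erase_subset _ _))⟩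
    intro v hv
    rw [mem_erase] at hv
    rw [Finset.mem_sdiff, mem_cls]
    exact ⟨h3 hv.2, fun h => hv.1 (h5 hv.2 h2 h.2)⟩
  · intro e he f hf h
    rw [mem_filter] at he hf
    rw [← insert_erase he.2, h, insert_erase hf.2]
  · intro A hA
    obtain ⟨h1, h2, h3⟩ := mem_rb.mp hA
    have hn : u ∉ A := fun h => (Finset.mem_sdiff.mp (h1 h)).2 (mem_cls.mpr ⟨hu, rfl⟩)
    refine ⟨insert u A, ?_, erase_insert hn⟩
    rw [mem_filter]
    refine ⟨mem_rb.mpr ⟨insert_subset hu (h1.trans sdiff_subset), ?_, ?_⟩, mem_insert_self _ _⟩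
    · rw [card_insert_of_notMem hn, h2]; omega
    · rw [coe_insert, Set.injOn_insert (by simpa using hn)]
      refine ⟨h3, ?_⟩
      rintro ⟨v, hv, hvu⟩
      exact (Finset.mem_sdiff.mp (h1 hv)).2 (mem_cls.mpr ⟨(Finset.mem_sdiff.mp (h1 hv)).1, hvu⟩)

theorem pc_le_one (r ℓ : ℕ) (hr : 2 ≤ r) (hrl : r ≤ ℓ) : (r:ℝ) * pc r ℓ ≤ 1 := by
  rw [r_pc r ℓ (by omega) (by omega)]
  apply div_le_one_of_le₀ _ (by positivity)
  have h1 : (ℓ-1).choose (r-1) ≤ (ℓ-1)^(r-1) := Nat.choose_le_pow _ _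
  have h2 : (ℓ-1)^(r-1) ≤ ℓ^(r-1) := Nat.pow_le_pow_left (by omega) _
  exact_mod_cast h1.trans h2

noncomputable def kap (r ℓ : ℕ) : ℝ := (pc r ℓ - pc r (ℓ-1)) / 2

theorem kap_pos (r ℓ : ℕ) (hr : 2 ≤ r) (hrl : r ≤ ℓ) : 0 < kap r ℓ := by
  have := pc_lt r ℓ hr hrl
  rw [kap]; linarith

theorem pc_nonneg (r ℓ : ℕ) : 0 ≤ pc r ℓ := by rw [pc]; positivity

theorem good_sum (ℓ : ℕ) (hr : 2 ≤ r) (hrl : r ≤ ℓ) (H : HGraph r) (c : ℕ → ℕ) (U : Finset ℕ) (η : ℝ)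
    (hG : Good ℓ H c U η) (hη : 0 < η) (hη2 : η ≤ r * pc r ℓ) :
    (1 - η) * H.verts.card ≤ U.card ∧ (U.card : ℝ) ≤ H.verts.card ∧
    (r * pc r ℓ - 2 * η) * (H.verts.card : ℝ) ^ r ≤ r * (rb c U r).card := by
  have hU : (U.card : ℝ) + (H.verts \ U).card = H.verts.card := by
    have := card_sdiff_add_card_eq_card hG.sub
    exact_mod_cast (by omega : U.card + (H.verts \ U).card = H.verts.card)
  have h1 : (1 - η) * H.verts.card ≤ (U.card : ℝ) := by nlinarith [hG.big]
  refine ⟨h1, by have := card_le_card hG.sub; exact_mod_cast this, ?_⟩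
  have hs : ∑ u ∈ U, (rbG r c U).deg u = r * (rb c U r).card := handshake (rbG r c U)
  have hs' : (r:ℝ) * (rb c U r).card = ∑ u ∈ U, ((rbG r c U).deg u : ℝ) := by
    exact_mod_cast hs.symm
  rw [hs']
  have h2 : (U.card : ℝ) * ((r * pc r ℓ - η) * (H.verts.card : ℝ) ^ (r-1)) ≤ ∑ u ∈ U, ((rbG r c U).deg u : ℝ) := by
    rw [← nsmul_eq_mul, ← sum_const]
    apply sum_le_sum
    intro u hu
    exact (hG.deg u hu).trans (by exact_mod_cast cdeg_le H c U u)
  have h3 : ((1 - η) * H.verts.card) * ((r * pc r ℓ - η) * (H.verts.card : ℝ) ^ (r-1)) ≤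
      (U.card : ℝ) * ((r * pc r ℓ - η) * (H.verts.card : ℝ) ^ (r-1)) := by
    apply mul_le_mul_of_nonneg_right h1
    apply mul_nonneg (by linarith) (by positivity)
  have hpow : (H.verts.card : ℝ) ^ r = H.verts.card * (H.verts.card : ℝ)^(r-1) := by
    rw [← pow_succ']; congr 1; omega
  have h4 : ((1 - η) * H.verts.card) * ((r * pc r ℓ - η) * (H.verts.card : ℝ) ^ (r-1)) =
      ((1-η) * (r * pc r ℓ - η)) * (H.verts.card : ℝ) ^ r := by rw [hpow]; ring
  have h5 : (r * pc r ℓ - 2 * η) ≤ (1-η) * (r * pc r ℓ - η) := by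
    have := pc_le_one r ℓ hr hrl
    nlinarith
  have h6 := mul_le_mul_of_nonneg_right h5 (by positivity : 0 ≤ (H.verts.card : ℝ)^r)
  linarith

theorem kap_le (r ℓ : ℕ) : kap r ℓ ≤ pc r ℓ / 2 := by
  have := pc_nonneg r (ℓ-1)
  rw [kap]; linarith

theorem kap_le' (r ℓ : ℕ) (hr : 2 ≤ r) : kap r ℓ ≤ r * pc r ℓ := by
  have h1 := kap_le r ℓ
  have h2 := pc_nonneg r ℓ
  have : (2:ℝ) ≤ r := by exact_mod_cast hr
  nlinarith

theorem good_class (ℓ : ℕ) (hr : 2 ≤ r) (hrl : r ≤ ℓ) (H : HGraph r) (c : ℕ → ℕ) (U : Finset ℕ) (η : ℝ)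
    (hG : Good ℓ H c U η) (hη : 0 < η) (hη2 : η ≤ kap r ℓ) (i : ℕ) (hi : i < ℓ) :
    kap r ℓ * H.verts.card ≤ (cls U c i).card := by
  rcases Nat.eq_zero_or_pos H.verts.card with h0 | hpos
  · rw [h0]; simp
  obtain ⟨h1, h2, h3⟩ := good_sum ℓ hr hrl H c U η hG hη (hη2.trans (kap_le' r ℓ hr))
  set n : ℝ := (H.verts.card : ℝ) with hn
  have hnpos : 0 < n := by rw [hn]; exact_mod_cast hpos
  have h4 := card_remove (rbG r c U) (cls U c i)
  have h5 : ((rbG r c U).induce ((rbG r c U).verts \ cls U c i)).edges ⊆ rb c (U \ cls U c i) r := by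
    intro e he
    rw [mem_induce] at he
    have := mem_rb.mp he.1
    exact mem_rb.mpr ⟨he.2, this.2⟩
  have h6 : ((rb c (U \ cls U c i) r).card : ℝ) ≤ pc r (ℓ-1) * n ^ r := by
    refine (rb_card_le r (ℓ-1) hr (by omega) c (U \ cls U c i) ((range ℓ).erase i) ?_ ?_).trans ?_
    · rw [card_erase_of_mem (mem_range.mpr hi), card_range]
    · intro v hv
      rw [Finset.mem_sdiff, mem_cls] at hv
      exact mem_erase.mpr ⟨fun h => hv.2 ⟨hv.1, h⟩, mem_range.mpr (hG.col v (hG.sub hv.1))⟩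
    · apply mul_le_mul_of_nonneg_left _ (pc_nonneg _ _)
      apply pow_le_pow_left₀ (by positivity)
      refine le_trans ?_ h2
      exact_mod_cast card_le_card sdiff_subset
  have h7 : ∑ x ∈ cls U c i, (rbG r c U).deg x ≤ (cls U c i).card * U.card ^ (r-1) := by
    rw [← smul_eq_mul, ← sum_const]
    exact sum_le_sum (fun x _ => deg_le (rbG r c U) x)
  have h8 : (rb c U r).card ≤ (rb c (U \ cls U c i) r).card + (cls U c i).card * U.card ^ (r-1) :=
    h4.trans (Nat.add_le_add (card_le_card h5) h7)
  have h9 : ((rb c U r).card : ℝ) ≤ pc r (ℓ-1) * n ^ r + (cls U c i).card * n ^ (r-1) := by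
    have : ((rb c U r).card : ℝ) ≤ (rb c (U \ cls U c i) r).card + (cls U c i).card * (U.card : ℝ) ^ (r-1) := by
      exact_mod_cast h8
    have h' : (cls U c i).card * (U.card : ℝ) ^ (r-1) ≤ (cls U c i).card * n ^ (r-1) := by gcongr
    linarith
  have hpow : n ^ r = n * n^(r-1) := by rw [← pow_succ']; congr 1; omega
  have hr' : (2:ℝ) ≤ r := by exact_mod_cast hr
  have h10 : (r:ℝ) * (kap r ℓ * n) * n^(r-1) ≤ r * (cls U c i).card * n^(r-1) := by
    have e1 : (r:ℝ) * (rb c U r).card ≤ r * (pc r (ℓ-1) * n ^ r + (cls U c i).card * n ^ (r-1)) := by gcongr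
    have e2 : (r:ℝ) * kap r ℓ ≤ r * pc r ℓ - 2 * η - r * pc r (ℓ-1) := by
      have : pc r ℓ - pc r (ℓ-1) = 2 * kap r ℓ := by rw [kap]; ring
      nlinarith
    have e3 := mul_le_mul_of_nonneg_right e2 (by positivity : 0 ≤ n^r)
    have e4 : (r:ℝ) * (kap r ℓ * n) * n^(r-1) = r * kap r ℓ * n^r := by rw [hpow]; ring
    rw [e4]
    linarith
  have hp : 0 < n^(r-1) := by positivity
  have h11 := le_of_mul_le_mul_right h10 hp
  exact le_of_mul_le_mul_left h11 (by linarith)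

theorem good_N (ℓ : ℕ) (hr : 2 ≤ r) (hrl : r ≤ ℓ) (H : HGraph r) (c : ℕ → ℕ) (U : Finset ℕ) (η : ℝ)
    (hG : Good ℓ H c U η) (hη : 0 < η) (hη2 : η ≤ kap r ℓ) (i : ℕ) (hi : i < ℓ) :
    ((rb c (U \ cls U c i) (r-1)).card : ℝ) ≤ (r * pc r ℓ + 2 * η / kap r ℓ) * (H.verts.card : ℝ) ^ (r-1) := by
  have hκ := kap_pos r ℓ hr hrl
  have hcl := good_class ℓ hr hrl H c U η hG hη hη2 i hi
  rcases Nat.eq_zero_or_pos H.verts.card with h0 | hpos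
  · have hU : U = ∅ := by
      have := hG.sub
      rw [card_eq_zero.mp h0] at this; exact subset_empty.mp this
    have : rb c (U \ cls U c i) (r-1) = ∅ := by
      rw [eq_empty_iff_forall_notMem]
      intro e he
      obtain ⟨h1, h2, _⟩ := mem_rb.mp he
      rw [hU, empty_sdiff] at h1
      rw [subset_empty.mp h1, card_empty] at h2
      omega
    rw [this, card_empty]
    have := pc_nonneg r ℓ
    push_cast; positivity
  obtain ⟨h1, h2, h3⟩ := good_sum ℓ hr hrl H c U η hG hη (hη2.trans (kap_le' r ℓ hr))
  set n : ℝ := (H.verts.card : ℝ) with hn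
  have hnpos : 0 < n := by rw [hn]; exact_mod_cast hpos
  set N : ℝ := ((rb c (U \ cls U c i) (r-1)).card : ℝ) with hN
  have hsum : ∑ u ∈ U, ((rbG r c U).deg u : ℝ) = (r:ℝ) * (rb c U r).card := by
    have hs : ∑ u ∈ U, (rbG r c U).deg u = r * (rb c U r).card := handshake (rbG r c U)
    exact_mod_cast hs
  have hrb : ((rb c U r).card : ℝ) ≤ pc r ℓ * n ^ r := by
    refine (rb_card_le r ℓ hr (by omega) c U (range ℓ) (card_range _) ?_).trans ?_
    · intro v hv; exact mem_range.mpr (hG.col v (hG.sub hv))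
    · apply mul_le_mul_of_nonneg_left _ (pc_nonneg _ _)
      exact pow_le_pow_left₀ (by positivity) h2 _
  have hsplit : ∑ u ∈ U, ((rbG r c U).deg u : ℝ) =
      ∑ u ∈ cls U c i, ((rbG r c U).deg u : ℝ) + ∑ u ∈ U \ cls U c i, ((rbG r c U).deg u : ℝ) := by
    rw [add_comm]; exact (sum_sdiff (show cls U c i ⊆ U from filter_subset _ _)).symm
  have hA : ∑ u ∈ cls U c i, ((rbG r c U).deg u : ℝ) = (cls U c i).card * N := by
    rw [← nsmul_eq_mul, ← sum_const]
    apply sum_congr rfl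
    intro u hu
    obtain ⟨h4, h5⟩ := mem_cls.mp hu
    rw [rbG_deg (by omega) c U u h4, h5]
  have hB : ((U.card : ℝ) - (cls U c i).card) * ((r * pc r ℓ - η) * n ^ (r-1)) ≤
      ∑ u ∈ U \ cls U c i, ((rbG r c U).deg u : ℝ) := by
    have : ((U.card : ℝ) - (cls U c i).card) = ((U \ cls U c i).card : ℝ) := by
      have := card_sdiff_add_card_eq_card (filter_subset (fun v => c v = i) U)
      have h' : ((U \ cls U c i).card : ℝ) + (cls U c i).card = U.card := by exact_mod_cast this
      linarith
    rw [this, ← nsmul_eq_mul, ← sum_const]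
    apply sum_le_sum
    intro u hu
    exact (hG.deg u (Finset.mem_sdiff.mp hu).1).trans (by exact_mod_cast cdeg_le H c U u)
  have hpow : n ^ r = n * n^(r-1) := by rw [← pow_succ']; congr 1; omega
  set M : ℝ := n^(r-1) with hM
  have hMpos : 0 < M := by positivity
  set x : ℝ := ((cls U c i).card : ℝ) with hx
  set q : ℝ := r * pc r ℓ with hq
  have hq1 : q ≤ 1 := pc_le_one r ℓ hr hrl
  have hqη : η ≤ q := hη2.trans (kap_le' r ℓ hr)
  have hxpos : 0 < x := lt_of_lt_of_le (by positivity) hcl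
  have e1 : x * N ≤ q * n * M - (U.card - x) * ((q - η) * M) := by
    have : (r:ℝ) * (rb c U r).card ≤ q * n * M := by
      rw [hpow] at hrb
      have := mul_le_mul_of_nonneg_left hrb (by positivity : (0:ℝ) ≤ r)
      rw [hq]; linarith
    linarith
  have e2 : x * N ≤ (x * q + 2 * η * n) * M := by
    have h' : (1-η)*n * ((q-η)*M) ≤ U.card * ((q-η)*M) :=
      mul_le_mul_of_nonneg_right h1 (mul_nonneg (by linarith) hMpos.le)
    have h'' : q * n - (1-η)*n*(q-η) + x*(q-η) ≤ x * q + 2 * η * n := by nlinarith [mul_pos hη hnpos, mul_pos hxpos hη, mul_nonneg (mul_pos hη hnpos).le hη.le, mul_nonneg (mul_pos hη hnpos).le (by linarith : 0 ≤ 1 - q)]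
    have := mul_le_mul_of_nonneg_right h'' hMpos.le
    nlinarith
  have e3 : (x * q + 2 * η * n) ≤ x * (q + 2 * η / kap r ℓ) := by
    have : 2 * η * n ≤ x * (2 * η / kap r ℓ) := by
      rw [mul_div_assoc', le_div_iff₀ hκ]
      nlinarith
    linarith
  have e4 : x * N ≤ x * ((q + 2 * η / kap r ℓ) * M) := by
    have := mul_le_mul_of_nonneg_right e3 hMpos.le
    linarith
  exact le_of_mul_le_mul_left e4 hxpos

/-- missing rainbow edges at a vertex -/
theorem good_missing (ℓ : ℕ) (hr : 2 ≤ r) (hrl : r ≤ ℓ) (H : HGraph r) (c : ℕ → ℕ) (U : Finset ℕ) (η : ℝ)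
    (hG : Good ℓ H c U η) (hη : 0 < η) (hη2 : η ≤ kap r ℓ) (u : ℕ) (hu : u ∈ U) :
    (((rb c U r).filter (fun e => u ∈ e ∧ e ∉ H.edges)).card : ℝ) ≤
      (2 * η / kap r ℓ + η) * (H.verts.card : ℝ) ^ (r-1) := by
  have h1 := good_N ℓ hr hrl H c U η hG hη hη2 (c u) (hG.col u (hG.sub hu))
  rw [← rbG_deg (by omega) c U u hu] at h1
  have h2 := hG.deg u hu
  have h3 : ((rb c U r).filter (fun e => u ∈ e ∧ e ∉ H.edges)).card + cdeg H c U u ≤ (rbG r c U).deg u := by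
    have hd : Disjoint ((rb c U r).filter (fun e => u ∈ e ∧ e ∉ H.edges))
      (H.edges.filter (fun e => u ∈ e ∧ e ⊆ U ∧ Set.InjOn c e)) := by
      rw [disjoint_left]
      intro e he he'
      exact (mem_filter.mp he).2.2 (mem_filter.mp he').1
    rw [cdeg, ← card_union_of_disjoint hd]
    apply card_le_card
    intro e he
    rcases mem_union.mp he with h | h
    · rw [mem_filter] at h ⊢; exact ⟨h.1, h.2.1⟩
    · rw [mem_filter] at h ⊢
      exact ⟨mem_rb.mpr ⟨h.2.2.1, H.edges_card e h.1, h.2.2.2⟩, h.2.1⟩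
  have h3' : (((rb c U r).filter (fun e => u ∈ e ∧ e ∉ H.edges)).card : ℝ) + cdeg H c U u ≤ (rbG r c U).deg u := by
    exact_mod_cast h3
  linarith

theorem good_missing_total (ℓ : ℕ) (hr : 2 ≤ r) (hrl : r ≤ ℓ) (H : HGraph r) (c : ℕ → ℕ) (U : Finset ℕ) (η : ℝ)
    (hG : Good ℓ H c U η) (hη : 0 < η) (hη2 : η ≤ kap r ℓ) :
    (((rb c U r).filter (fun e => e ∉ H.edges)).card : ℝ) ≤
      (2 * η / kap r ℓ + η) * (H.verts.card : ℝ) ^ r := by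
  have hκ := kap_pos r ℓ hr hrl
  have hsub : (rb c U r).filter (fun e => e ∉ H.edges) ⊆
      U.biUnion (fun u => (rb c U r).filter (fun e => u ∈ e ∧ e ∉ H.edges)) := by
    intro e he
    rw [mem_filter] at he
    obtain ⟨h1, h2, h3⟩ := mem_rb.mp he.1
    have : e.Nonempty := card_pos.mp (by omega)
    obtain ⟨u, hu⟩ := this
    exact mem_biUnion.mpr ⟨u, h1 hu, mem_filter.mpr ⟨he.1, hu, he.2⟩⟩
  have h1 : (((rb c U r).filter (fun e => e ∉ H.edges)).card : ℝ) ≤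
      ∑ u ∈ U, (((rb c U r).filter (fun e => u ∈ e ∧ e ∉ H.edges)).card : ℝ) := by
    exact_mod_cast (card_le_card hsub).trans card_biUnion_le
  have h2 : ∑ u ∈ U, (((rb c U r).filter (fun e => u ∈ e ∧ e ∉ H.edges)).card : ℝ) ≤
      U.card * ((2 * η / kap r ℓ + η) * (H.verts.card : ℝ) ^ (r-1)) := by
    rw [← nsmul_eq_mul, ← sum_const]
    exact sum_le_sum (fun u hu => good_missing ℓ hr hrl H c U η hG hη hη2 u hu)
  have h3 : (U.card : ℝ) * ((2 * η / kap r ℓ + η) * (H.verts.card : ℝ) ^ (r-1)) ≤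
      H.verts.card * ((2 * η / kap r ℓ + η) * (H.verts.card : ℝ) ^ (r-1)) := by
    gcongr
    exact hG.sub
  have hpow : (H.verts.card : ℝ) ^ r = H.verts.card * (H.verts.card : ℝ)^(r-1) := by
    rw [← pow_succ']; congr 1; omega
  rw [hpow]
  linarith

end PartF

section PartG
open Finset
open scoped Classical

variable {r : ℕ}

theorem count_event {J α : Type*} [Fintype J] [DecidableEq J] (B : J → Finset ℕ) (n : ℕ)
    (hB : ∀ j, (B j).card ≤ n) (E : Finset (J → ℕ)) (hE : E ⊆ Fintype.piFinset B)
    (Φ : (J → ℕ) → α) (M : Finset α) (S : Finset J) (hM : ∀ y ∈ E, Φ y ∈ M)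
    (hinj : ∀ y ∈ E, ∀ z ∈ E, Φ y = Φ z → (∀ j, j ∉ S → y j = z j) → y = z) :
    E.card ≤ M.card * n ^ (Fintype.card J - S.card) := by
  have h1 : E.card ≤ (M ×ˢ Fintype.piFinset (fun j => if j ∈ S then {0} else B j)).card := by
    apply card_le_card_of_injOn (fun y => (Φ y, fun j => if j ∈ S then 0 else y j))
    · intro y hy
      rw [mem_coe, mem_product]
      refine ⟨hM y hy, ?_⟩
      rw [Fintype.mem_piFinset]
      intro j
      have := Fintype.mem_piFinset.mp (hE hy) j
      dsimp only
      split_ifs with h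
      · simp
      · exact this
    · intro y hy z hz h
      rw [Prod.mk.injEq] at h
      refine hinj y hy z hz h.1 ?_
      intro j hj
      have := congrFun h.2 j
      simpa [hj] using this
  refine h1.trans ?_
  rw [card_product]
  apply Nat.mul_le_mul_left
  rw [Fintype.card_piFinset]
  have h2 : ∏ j, (if j ∈ S then ({0} : Finset ℕ) else B j).card ≤ ∏ j, (if j ∈ S then 1 else n) := by
    apply prod_le_prod'
    intro j _
    split_ifs
    · simp
    · exact hB j
  refine h2.trans (le_of_eq ?_)
  rw [prod_ite]
  simp only [prod_const_one, one_mul, prod_const]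
  congr 1
  rw [filter_not, card_sdiff_of_subset (filter_subset _ _)]
  simp

theorem Good.mono {ℓ : ℕ} {H : HGraph r} {c : ℕ → ℕ} {U : Finset ℕ} {η η' : ℝ}
    (h : Good ℓ H c U η) (hη : η ≤ η') : Good ℓ H c U η' where
  sub := h.sub
  col := h.col
  big := h.big.trans (mul_le_mul_of_nonneg_right hη (by positivity))
  deg := fun u hu => le_trans (mul_le_mul_of_nonneg_right (by linarith) (by positivity)) (h.deg u hu)

theorem image_det {ℓ k : ℕ} {c : ℕ → ℕ} (S : Finset (Fin ℓ × Fin k))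
    (hS : Set.InjOn Prod.fst (S : Set (Fin ℓ × Fin k))) (y z : Fin ℓ × Fin k → ℕ)
    (hy : ∀ j, c (y j) = j.1) (hz : ∀ j, c (z j) = j.1)
    (h : ∀ j ∈ S, y j ∈ S.image z) (j : Fin ℓ × Fin k) (hj : j ∈ S) : y j = z j := by
  obtain ⟨j', hj', h2⟩ := mem_image.mp (h j hj)
  have : j' = j := by
    apply hS hj' hj
    apply Fin.ext
    rw [← hy j, ← hz j', h2]
  rw [← h2, this]

set_option maxHeartbeats 1000000 in
theorem emb (ℓ K : ℕ) (hr : 2 ≤ r) (hrl : r ≤ ℓ) (δ : ℝ) (hδ : 0 < δ) :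
    ∃ η0 : ℝ, 0 < η0 ∧ η0 ≤ kap r ℓ ∧ ∃ N : ℕ, ∀ (H : HGraph r) (c : ℕ → ℕ) (U : Finset ℕ),
      Good ℓ H c U η0 → N ≤ H.verts.card → ∀ P ⊆ U, P.card ≤ r → ∀ Q : Finset ℕ,
      Q.card ≤ 2 * r → ∀ D : ℕ → Finset ℕ,
      (∀ i < ℓ, D i ⊆ cls U c i ∧ δ * H.verts.card ≤ (D i).card) →
      ∃ y : Fin ℓ × Fin (K+1) → ℕ, Function.Injective y ∧
        (∀ j, y j ∈ D j.1 ∧ y j ∉ Q ∧ y j ∉ P) ∧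
        (∀ S : Finset (Fin ℓ × Fin (K+1)), S.card = r → Set.InjOn Prod.fst (S : Set (Fin ℓ × Fin (K+1))) →
          S.image y ∈ H.edges) ∧
        (∀ p ∈ P, ∀ S : Finset (Fin ℓ × Fin (K+1)), S.card + 1 = r →
          Set.InjOn Prod.fst (S : Set (Fin ℓ × Fin (K+1))) → (∀ j ∈ S, (j.1 : ℕ) ≠ c p) →
          insert p (S.image y) ∈ H.edges) := by
  have hkp := kap_pos r ℓ hr hrl
  set m := Fintype.card (Fin ℓ × Fin (K+1)) with hm
  set β : ℝ := δ / 2 with hβ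
  have hβ0 : 0 < β := by positivity
  set C : ℝ := (1 + r) * 2 ^ m * (2 / kap r ℓ + 1) with hC
  have hC0 : 0 < C := by positivity
  refine ⟨min (kap r ℓ) (β ^ m / (2 * C + 1)), by positivity, min_le_left _ _,
    ⌈(3 * r) / β⌉₊ + ⌈2 * m ^ 2 / β ^ m⌉₊ + 1, ?_⟩
  intro H c U hG hN P hPU hP Q hQ D hD
  set η := min (kap r ℓ) (β ^ m / (2 * C + 1)) with hη
  have hη0 : 0 < η := by positivity
  have hη1 : η ≤ kap r ℓ := min_le_left _ _
  have hη2 : C * η < β ^ m / 2 := by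
    have : η ≤ β ^ m / (2 * C + 1) := min_le_right _ _
    rw [le_div_iff₀ (by positivity)] at this
    nlinarith
  set nn := H.verts.card with hnn
  set n : ℝ := (nn : ℝ) with hn
  have hnN : ((⌈(3 * r) / β⌉₊ + ⌈2 * m ^ 2 / β ^ m⌉₊ + 1 : ℕ) : ℝ) ≤ n := by rw [hn]; exact_mod_cast hN
  push_cast at hnN
  have hn1 : (3 * r) / β ≤ n := by
    have := Nat.le_ceil ((3 * (r:ℝ)) / β)
    have h2 : (0:ℝ) ≤ (⌈2 * (m:ℝ) ^ 2 / β ^ m⌉₊ : ℝ) := by positivity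
    linarith
  have hn2 : 2 * m ^ 2 / β ^ m < n := by
    have := Nat.le_ceil (2 * (m:ℝ) ^ 2 / β ^ m)
    have h2 : (0:ℝ) ≤ (⌈(3 * (r:ℝ)) / β⌉₊ : ℝ) := by positivity
    linarith
  have hnpos : 0 < n := by
    have : (0:ℝ) ≤ 2 * m ^ 2 / β ^ m := by positivity
    linarith
  rw [div_le_iff₀ hβ0] at hn1
  rw [div_lt_iff₀ (by positivity)] at hn2
  set B : Fin ℓ × Fin (K+1) → Finset ℕ := fun j => D j.1 \ (Q ∪ P) with hBdef
  have hBn : ∀ j, (B j).card ≤ nn := by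
    intro j
    apply card_le_card
    intro v hv
    exact hG.sub (mem_cls.mp ((hD j.1 j.1.2).1 (Finset.mem_sdiff.mp hv).1)).1
  have hBβ : ∀ j, β * n ≤ (B j).card := by
    intro j
    have h1 := (hD j.1 j.1.2).2
    have h2 : (D j.1).card ≤ (B j).card + (Q ∪ P).card := by
      have := card_le_card_sdiff_add_card (s := D j.1) (t := Q ∪ P)
      omega
    have h3 : (Q ∪ P).card ≤ 3 * r := by
      have := card_union_le Q P
      omega
    have h4 : ((D j.1).card : ℝ) ≤ (B j).card + 3 * r := by
      have : (D j.1).card ≤ (B j).card + 3 * r := by omega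
      exact_mod_cast this
    have : δ = 2 * β := by rw [hβ]; ring
    nlinarith
  have hpi : ∀ y ∈ Fintype.piFinset B, ∀ j, y j ∈ D j.1 ∧ y j ∉ Q ∧ y j ∉ P ∧ y j ∈ U ∧ c (y j) = j.1 := by
    intro y hy j
    have := Fintype.mem_piFinset.mp hy j
    obtain ⟨h1, h2⟩ := Finset.mem_sdiff.mp this
    rw [mem_union, not_or] at h2
    have h3 := mem_cls.mp ((hD j.1 j.1.2).1 h1)
    exact ⟨h1, h2.1, h2.2, h3.1, h3.2⟩
  set θ := 2 * η / kap r ℓ + η with hθ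
  have hθC : (1 + r) * 2 ^ m * θ = C * η := by rw [hθ, hC]; ring
  have hθ0 : 0 < θ := by positivity
  -- events
  set E1 : (Fin ℓ × Fin (K+1)) × (Fin ℓ × Fin (K+1)) → Finset (Fin ℓ × Fin (K+1) → ℕ) := fun q =>
    (Fintype.piFinset B).filter (fun y => q.1 ≠ q.2 ∧ y q.1 = y q.2) with hE1
  set E2 : Finset (Fin ℓ × Fin (K+1)) → Finset (Fin ℓ × Fin (K+1) → ℕ) := fun S =>
    (Fintype.piFinset B).filter (fun y => S.card = r ∧ Set.InjOn Prod.fst (S : Set (Fin ℓ × Fin (K+1))) ∧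
      S.image y ∉ H.edges) with hE2
  set E3 : ℕ × Finset (Fin ℓ × Fin (K+1)) → Finset (Fin ℓ × Fin (K+1) → ℕ) := fun q =>
    (Fintype.piFinset B).filter (fun y => q.2.card + 1 = r ∧ Set.InjOn Prod.fst (q.2 : Set (Fin ℓ × Fin (K+1))) ∧
      (∀ j ∈ q.2, (j.1 : ℕ) ≠ c q.1) ∧ insert q.1 (q.2.image y) ∉ H.edges) with hE3
  have b1 : ∀ q, ((E1 q).card : ℝ) * n ≤ n ^ m := by
    intro q
    have hm1 : 1 ≤ m := Fintype.card_pos_iff.mpr ⟨q.1⟩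
    have := count_event B nn hBn (E1 q) (filter_subset _ _) (fun _ => ()) {()} {q.1} (by simp) (by
      intro y hy z hz _ h
      rw [hE1, mem_filter] at hy hz
      funext j
      by_cases hj : j = q.1
      · rw [hj, hy.2.2, hz.2.2]
        exact h q.2 (by simpa using hy.2.1.symm)
      · exact h j (by simpa using hj))
    rw [card_singleton, one_mul, card_singleton] at this
    have h2 : ((E1 q).card : ℝ) ≤ n ^ (m - 1) := by rw [hn]; exact_mod_cast this
    calc ((E1 q).card : ℝ) * n ≤ n ^ (m-1) * n := by gcongr
      _ = n ^ m := by rw [← pow_succ]; congr 1; omega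
  have b2 : ∀ S, ((E2 S).card : ℝ) ≤ θ * n ^ m := by
    intro S
    by_cases hS : S.card = r ∧ Set.InjOn Prod.fst (S : Set (Fin ℓ × Fin (K+1)))
    swap
    · have : E2 S = ∅ := by
        rw [hE2]; apply filter_false_of_mem; intro y _ h; exact hS ⟨h.1, h.2.1⟩
      rw [this]; simp; positivity
    have hSm : r ≤ m := by rw [← hS.1]; exact card_le_univ S
    have key := count_event B nn hBn (E2 S) (filter_subset _ _) (fun y => S.image y)
      ((rb c U r).filter (fun e => e ∉ H.edges)) S (by
        intro y hy
        rw [hE2, mem_filter] at hy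
        have hp := hpi y hy.1
        rw [mem_filter, mem_rb]
        have hinj : Set.InjOn y (S : Set (Fin ℓ × Fin (K+1))) := by
          intro j hj j' hj' h
          apply hS.2 hj hj'
          apply Fin.ext
          rw [← (hp j).2.2.2.2, ← (hp j').2.2.2.2, h]
        refine ⟨⟨?_, ?_, ?_⟩, hy.2.2.2⟩
        · intro v hv
          obtain ⟨j, _, rfl⟩ := mem_image.mp hv
          exact (hp j).2.2.2.1
        · rw [card_image_of_injOn hinj, hS.1]
        · intro v hv v' hv' h
          obtain ⟨j, hj, rfl⟩ := mem_image.mp hv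
          obtain ⟨j', hj', rfl⟩ := mem_image.mp hv'
          rw [(hp j).2.2.2.2, (hp j').2.2.2.2] at h
          rw [hS.2 hj hj' (Fin.ext h)]) (by
        intro y hy z hz h h'
        rw [hE2, mem_filter] at hy hz
        funext j
        by_cases hj : j ∈ S
        · refine image_det S hS.2 y z (fun j => (hpi y hy.1 j).2.2.2.2) (fun j => (hpi z hz.1 j).2.2.2.2) ?_ j hj
          intro j hj
          have h : S.image y = S.image z := h
          rw [← h]; exact mem_image_of_mem _ hj
        · exact h' j hj)
    have h2 := good_missing_total ℓ hr hrl H c U η hG hη0 hη1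
    rw [hS.1] at key
    have h3 : ((E2 S).card : ℝ) ≤ (((rb c U r).filter (fun e => e ∉ H.edges)).card : ℝ) * n ^ (m - r) := by
      rw [hn]; exact_mod_cast key
    calc ((E2 S).card : ℝ) ≤ _ := h3
      _ ≤ (θ * n ^ r) * n ^ (m - r) := by gcongr
      _ = θ * n ^ m := by rw [mul_assoc, ← pow_add]; congr 2; omega
  have b3 : ∀ q ∈ P ×ˢ (univ : Finset (Finset (Fin ℓ × Fin (K+1)))), ((E3 q).card : ℝ) ≤ θ * n ^ m := by
    rintro ⟨p, S⟩ hpS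
    have hpP : p ∈ P := (mem_product.mp hpS).1
    have hpU := hPU hpP
    by_cases hS : S.card + 1 = r ∧ Set.InjOn Prod.fst (S : Set (Fin ℓ × Fin (K+1))) ∧
      (∀ j ∈ S, (j.1 : ℕ) ≠ c p)
    swap
    · have : E3 (p, S) = ∅ := by
        rw [hE3]; apply filter_false_of_mem; intro y _ h; exact hS ⟨h.1, h.2.1, h.2.2.1⟩
      rw [this]; simp; positivity
    have hSm : r - 1 ≤ m := by rw [← hS.1]; exact card_le_univ S
    have key := count_event B nn hBn (E3 (p, S)) (filter_subset _ _) (fun y => insert p (S.image y))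
      ((rb c U r).filter (fun e => p ∈ e ∧ e ∉ H.edges)) S (by
        intro y hy
        rw [hE3, mem_filter] at hy
        have hp := hpi y hy.1
        rw [mem_filter, mem_rb]
        have hinj : Set.InjOn y (S : Set (Fin ℓ × Fin (K+1))) := by
          intro j hj j' hj' h
          apply hS.2.1 hj hj'
          apply Fin.ext
          rw [← (hp j).2.2.2.2, ← (hp j').2.2.2.2, h]
        have hnp : p ∉ S.image y := by
          intro h
          obtain ⟨j, _, hj⟩ := mem_image.mp h
          exact (hp j).2.2.1 (hj ▸ hpP)
        refine ⟨⟨?_, ?_, ?_⟩, mem_insert_self _ _, hy.2.2.2.2⟩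
        · apply insert_subset hpU
          intro v hv
          obtain ⟨j, _, rfl⟩ := mem_image.mp hv
          exact (hp j).2.2.2.1
        · rw [card_insert_of_notMem hnp, card_image_of_injOn hinj, hS.1]
        · rw [coe_insert, Set.injOn_insert (by simpa using hnp)]
          constructor
          · intro v hv v' hv' h
            obtain ⟨j, hj, rfl⟩ := mem_image.mp hv
            obtain ⟨j', hj', rfl⟩ := mem_image.mp hv'
            rw [(hp j).2.2.2.2, (hp j').2.2.2.2] at h
            rw [hS.2.1 hj hj' (Fin.ext h)]
          · rintro ⟨v, hv, hv'⟩
            obtain ⟨j, hj, rfl⟩ := mem_image.mp hv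
            rw [(hp j).2.2.2.2] at hv'
            exact hS.2.2 j hj hv') (by
        intro y hy z hz h h'
        rw [hE3, mem_filter] at hy hz
        funext j
        by_cases hj : j ∈ S
        · refine image_det S hS.2.1 y z (fun j => (hpi y hy.1 j).2.2.2.2) (fun j => (hpi z hz.1 j).2.2.2.2) ?_ j hj
          intro j hj
          have h : insert p (S.image y) = insert p (S.image z) := h
          have h4 : y j ∈ insert p (S.image z) := by
            rw [← h]; exact mem_insert_of_mem (mem_image_of_mem _ hj)
          rcases mem_insert.mp h4 with h5 | h5
          · exact absurd hpP (h5 ▸ (hpi y hy.1 j).2.2.1)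
          · exact h5
        · exact h' j hj)
    have h2 := good_missing ℓ hr hrl H c U η hG hη0 hη1 p hpU
    have hSc : S.card = r - 1 := by omega
    rw [hSc] at key
    have h3 : ((E3 (p, S)).card : ℝ) ≤ (((rb c U r).filter (fun e => p ∈ e ∧ e ∉ H.edges)).card : ℝ) * n ^ (m - (r-1)) := by
      rw [hn]; exact_mod_cast key
    calc ((E3 (p, S)).card : ℝ) ≤ _ := h3
      _ ≤ (θ * n ^ (r-1)) * n ^ (m - (r-1)) := by gcongr
      _ = θ * n ^ m := by rw [mul_assoc, ← pow_add]; congr 2; omega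
  set bad := (univ.biUnion E1) ∪ (univ.biUnion E2) ∪ ((P ×ˢ univ).biUnion E3) with hbad
  have hbadcard : (bad.card : ℝ) < (Fintype.piFinset B).card := by
    have c1 : (bad.card : ℝ) ≤ ∑ q, ((E1 q).card : ℝ) + ∑ S, ((E2 S).card : ℝ) +
        ∑ q ∈ P ×ˢ univ, ((E3 q).card : ℝ) := by
      have : bad.card ≤ ∑ q, (E1 q).card + ∑ S, (E2 S).card + ∑ q ∈ P ×ˢ univ, (E3 q).card := by
        refine (card_union_le _ _).trans (add_le_add ((card_union_le _ _).trans
          (add_le_add card_biUnion_le card_biUnion_le)) card_biUnion_le)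
      exact_mod_cast this
    have c2 : (∑ q, ((E1 q).card : ℝ)) * n ≤ m ^ 2 * n ^ m := by
      rw [sum_mul]
      refine (sum_le_card_nsmul _ _ (n ^ m) (fun q _ => b1 q)).trans ?_
      rw [nsmul_eq_mul, card_univ, Fintype.card_prod (Fin ℓ × Fin (K+1)), ← hm]
      push_cast
      exact le_of_eq (by ring)
    have c3 : ∑ S, ((E2 S).card : ℝ) ≤ 2 ^ m * (θ * n ^ m) := by
      refine (sum_le_card_nsmul _ _ _ (fun q _ => b2 q)).trans ?_
      rw [nsmul_eq_mul, card_univ, Fintype.card_finset]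
      push_cast
      exact le_rfl
    have c4 : ∑ q ∈ P ×ˢ univ, ((E3 q).card : ℝ) ≤ r * 2 ^ m * (θ * n ^ m) := by
      refine (sum_le_card_nsmul _ _ _ b3).trans ?_
      rw [nsmul_eq_mul, card_product, card_univ, Fintype.card_finset]
      push_cast
      have : (P.card : ℝ) ≤ r := by exact_mod_cast hP
      gcongr
    have c5 : β ^ m * n ^ m ≤ (Fintype.piFinset B).card := by
      rw [Fintype.card_piFinset, ← mul_pow]
      push_cast
      rw [hm, ← card_univ, ← prod_const]
      exact prod_le_prod (fun _ _ => by positivity) (fun j _ => hBβ j)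
    refine lt_of_le_of_lt c1 (lt_of_lt_of_le ?_ c5)
    have hnm : 0 < n ^ m := by positivity
    have c6 : ∑ q, ((E1 q).card : ℝ) < β ^ m / 2 * n ^ m := by
      have : (∑ q, ((E1 q).card : ℝ)) * n < (β ^ m / 2 * n ^ m) * n := by
        refine lt_of_le_of_lt c2 ?_
        nlinarith
      exact lt_of_mul_lt_mul_right this hnpos.le
    have c7 : 2 ^ m * (θ * n ^ m) + r * 2 ^ m * (θ * n ^ m) < β ^ m / 2 * n ^ m := by
      have : 2 ^ m * (θ * n ^ m) + r * 2 ^ m * (θ * n ^ m) = (C * η) * n ^ m := by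
        rw [← hθC]; ring
      rw [this]
      exact mul_lt_mul_of_pos_right hη2 hnm
    linarith
  have hex : ∃ y ∈ Fintype.piFinset B, y ∉ bad := by
    by_contra hcon
    push Not at hcon
    have : (Fintype.piFinset B).card ≤ bad.card := card_le_card hcon
    have : ((Fintype.piFinset B).card : ℝ) ≤ bad.card := by exact_mod_cast this
    linarith
  obtain ⟨y, hy, hyb⟩ := hex
  rw [hbad, mem_union, mem_union, not_or, not_or] at hyb
  obtain ⟨⟨y1, y2⟩, y3⟩ := hyb
  refine ⟨y, ?_, fun j => ⟨(hpi y hy j).1, (hpi y hy j).2.1, (hpi y hy j).2.2.1⟩, ?_, ?_⟩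
  · intro j j' h
    by_contra hne
    exact y1 (mem_biUnion.mpr ⟨(j, j'), mem_univ _, mem_filter.mpr ⟨hy, hne, h⟩⟩)
  · intro S h1 h2
    by_contra hne
    exact y2 (mem_biUnion.mpr ⟨S, mem_univ _, mem_filter.mpr ⟨hy, h1, h2, hne⟩⟩)
  · intro p hp S h1 h2 h3
    by_contra hne
    exact y3 (mem_biUnion.mpr ⟨(p, S), mem_product.mpr ⟨hp, mem_univ _⟩, mem_filter.mpr ⟨hy, h1, h2, h3, hne⟩⟩)

end PartG

section PartH
open Finset
open scoped Classical

variable {r : ℕ}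

/-- a system of robust representatives -/
structure Sys (ℓ K : ℕ) (H : HGraph r) (c : ℕ → ℕ) (P : Finset ℕ) (x : ℕ → ℕ) : Prop where
  mem : ∀ i < ℓ, x i ∈ H.verts
  col : ∀ i < ℓ, c (x i) = i
  notP : ∀ i < ℓ, x i ∉ P
  edge : ∀ T ⊆ range ℓ, T.card = r → T.image x ∈ H.edges
  edgeP : ∀ p ∈ P, ∀ T ⊆ range ℓ, T.card + 1 = r → c p ∉ T → insert p (T.image x) ∈ H.edges
  rob : ∀ i < ℓ, ∀ i' < ℓ, i ≠ i' → Rob H K (x i) (x i')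
  robP : ∀ p ∈ P, ∀ i < ℓ, i ≠ c p → Rob H K p (x i)

theorem Rob.symm {H : HGraph r} {K x y : ℕ} (h : Rob H K x y) : Rob H K y x := by
  intro X h1 h2 h3
  obtain ⟨e, he, h4, h5, h6⟩ := h X h1 h3 h2
  exact ⟨e, he, h5, h4, h6⟩

theorem emb2 (ℓ K : ℕ) (hr : 2 ≤ r) (hrl : r ≤ ℓ) (δ : ℝ) (hδ : 0 < δ) :
    ∃ η0 : ℝ, 0 < η0 ∧ η0 ≤ kap r ℓ ∧ ∃ N : ℕ, ∀ (H : HGraph r) (c : ℕ → ℕ) (U : Finset ℕ),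
      Good ℓ H c U η0 → N ≤ H.verts.card → ∀ P ⊆ U, P.card ≤ r → ∀ Q : Finset ℕ,
      Q.card ≤ 2 * r → ∀ D : ℕ → Finset ℕ,
      (∀ i < ℓ, D i ⊆ cls U c i ∧ δ * H.verts.card ≤ (D i).card) →
      ∃ x : ℕ → ℕ, Sys ℓ K H c P x ∧ ∀ i < ℓ, x i ∈ D i ∧ x i ∉ Q := by
  obtain ⟨η0, hη0, hη1, N, hN⟩ := emb ℓ K hr hrl δ hδ
  refine ⟨η0, hη0, hη1, N, ?_⟩
  intro H c U hG hn P hPU hP Q hQ D hD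
  obtain ⟨y, yinj, ymem, y1, y2⟩ := hN H c U hG hn P hPU hP Q hQ D hD
  set w : (ℕ → Fin (K+1)) → ℕ → ℕ := fun k i => if h : i < ℓ then y (⟨i, h⟩, k i) else 0 with hw
  obtain ⟨k0, hk0⟩ : ∃ k0 : ℕ → Fin (K+1), ∀ i, k0 i = 0 := ⟨fun _ => 0, fun _ => rfl⟩
  have hwy : ∀ k i (h : i < ℓ), w k i = y (⟨i, h⟩, k i) := fun k i h => by simp [hw, h]
  have hS : ∀ k : ℕ → Fin (K+1), ∀ T ⊆ range ℓ, ∃ S : Finset (Fin ℓ × Fin (K+1)), S.card = T.card ∧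
      Set.InjOn Prod.fst (S : Set (Fin ℓ × Fin (K+1))) ∧ S.image y = T.image (w k) ∧
      ∀ j ∈ S, (j.1 : ℕ) ∈ T := by
    intro k T hT
    refine ⟨univ.filter (fun j => (j.1 : ℕ) ∈ T ∧ j.2 = k j.1), ?_, ?_, ?_, ?_⟩
    · apply card_bij (fun j _ => (j.1 : ℕ))
      · intro j hj; exact (mem_filter.mp hj).2.1
      · intro j hj j' hj' h
        have h1 := (mem_filter.mp hj).2.2
        have h2 := (mem_filter.mp hj').2.2
        have h3 : j.1 = j'.1 := Fin.ext h
        exact Prod.ext h3 (by rw [h1, h2, h3])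
      · intro i hi
        exact ⟨(⟨i, mem_range.mp (hT hi)⟩, k i), mem_filter.mpr ⟨mem_univ _, hi, rfl⟩, rfl⟩
    · intro j hj j' hj' h3
      have h1 := (mem_filter.mp hj).2.2
      have h2 := (mem_filter.mp hj').2.2
      exact Prod.ext h3 (by rw [h1, h2, h3])
    · ext v
      simp only [mem_image]
      constructor
      · rintro ⟨j, hj, rfl⟩
        obtain ⟨h1, h2⟩ := (mem_filter.mp hj).2
        refine ⟨j.1, h1, ?_⟩
        rw [hwy k j.1 j.1.2, ← h2]
      · rintro ⟨i, hi, rfl⟩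
        refine ⟨(⟨i, mem_range.mp (hT hi)⟩, k i), mem_filter.mpr ⟨mem_univ _, hi, rfl⟩, ?_⟩
        rw [hwy]
    · intro j hj; exact (mem_filter.mp hj).2.1
  have e1 : ∀ k, ∀ T ⊆ range ℓ, T.card = r → T.image (w k) ∈ H.edges := by
    intro k T hT hc
    obtain ⟨S, s1, s2, s3, _⟩ := hS k T hT
    rw [← s3]
    exact y1 S (by omega) s2
  have e2 : ∀ k, ∀ p ∈ P, ∀ T ⊆ range ℓ, T.card + 1 = r → c p ∉ T → insert p (T.image (w k)) ∈ H.edges := by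
    intro k p hp T hT hc hcp
    obtain ⟨S, s1, s2, s3, s4⟩ := hS k T hT
    rw [← s3]
    exact y2 p hp S (by omega) s2 (fun j hj h => hcp (h ▸ s4 j hj))
  have hch : ∀ X : Finset ℕ, X.card ≤ K → ∃ k : ℕ → Fin (K+1), (∀ i < ℓ, w k i ∉ X) ∧
      ∀ i < ℓ, w k0 i ∉ X → w k i = w k0 i := by
    intro X hX
    have : ∀ i : ℕ, ∃ k : Fin (K+1), ∀ h : i < ℓ, y (⟨i, h⟩, k) ∉ X ∧
        (y (⟨i, h⟩, 0) ∉ X → k = 0) := by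
      intro i
      by_cases h : i < ℓ
      swap
      · exact ⟨0, fun h' => absurd h' h⟩
      by_cases h0 : y (⟨i, h⟩, 0) ∈ X
      · by_contra hcon
        push Not at hcon
        have h3 : (univ.image (fun k : Fin (K+1) => y (⟨i, h⟩, k))) ⊆ X := by
          intro v hv
          obtain ⟨k, _, rfl⟩ := mem_image.mp hv
          obtain ⟨_, h5⟩ := hcon k
          by_contra h6
          have := (h5 h6).1
          exact this h0
        have h4 := card_le_card h3
        rw [card_image_of_injective _ (fun a b hab => by
          have := yinj hab; simpa using this), card_univ, Fintype.card_fin] at h4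
        omega
      · exact ⟨0, fun _ => ⟨h0, fun _ => rfl⟩⟩
    choose k hk using this
    refine ⟨k, ?_, ?_⟩
    · intro i h; rw [hwy k i h]; exact (hk i h).1
    · intro i h hx
      rw [hwy k0 i h, hk0] at hx
      rw [hwy k i h, hwy k0 i h, hk0, (hk i h).2 hx]
  have hcol : ∀ i < ℓ, ∀ k, w k i ∈ D i ∧ w k i ∉ Q ∧ w k i ∉ P := by
    intro i hi k
    rw [hwy k i hi]
    exact ymem _
  refine ⟨w k0, ⟨?_, ?_, ?_, ?_, ?_, ?_, ?_⟩, ?_⟩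
  · intro i hi
    exact hG.sub (mem_cls.mp ((hD i hi).1 (hcol i hi k0).1)).1
  · intro i hi
    exact (mem_cls.mp ((hD i hi).1 (hcol i hi k0).1)).2
  · intro i hi; exact (hcol i hi k0).2.2
  · exact e1 _
  · exact e2 _
  · intro i hi i' hi' hne X hX h1 h2
    obtain ⟨k, k1, k2⟩ := hch X hX
    obtain ⟨T, t1, t2, t3⟩ := exists_subsuperset_card_eq (s := {i, i'}) (t := range ℓ) (n := r)
      (by intro v hv; simp only [mem_insert, mem_singleton] at hv; rw [mem_range]; rcases hv with rfl | rfl <;> assumption)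
      (by rw [card_pair hne]; omega) (by rw [card_range]; exact hrl)
    refine ⟨T.image (w k), e1 k T t2 t3, ?_, ?_, ?_⟩
    · rw [← k2 i hi h1]; exact mem_image_of_mem _ (t1 (by simp))
    · rw [← k2 i' hi' h2]; exact mem_image_of_mem _ (t1 (by simp))
    · rw [disjoint_left]
      intro v hv
      obtain ⟨j, hj, rfl⟩ := mem_image.mp hv
      exact k1 j (mem_range.mp (t2 hj))
  · intro p hp i hi hne X hX h1 h2
    obtain ⟨k, k1, k2⟩ := hch X hX
    have hcp : c p < ℓ := hG.col p (hG.sub (hPU hp))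
    obtain ⟨T, t1, t2, t3⟩ := exists_subsuperset_card_eq (s := {i}) (t := (range ℓ).erase (c p)) (n := r - 1)
      (by intro v hv; rw [mem_singleton] at hv; subst hv; exact mem_erase.mpr ⟨hne, mem_range.mpr hi⟩)
      (by rw [card_singleton]; omega) (by rw [card_erase_of_mem (mem_range.mpr hcp), card_range]; omega)
    have t4 : T ⊆ range ℓ := t2.trans (erase_subset _ _)
    refine ⟨insert p (T.image (w k)), e2 k p hp T t4 (by omega) (fun h => (mem_erase.mp (t2 h)).1 rfl),
      mem_insert_self _ _, ?_, ?_⟩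
    · rw [← k2 i hi h2]; exact mem_insert_of_mem (mem_image_of_mem _ (t1 (by simp)))
    · rw [disjoint_left]
      intro v hv
      rcases mem_insert.mp hv with rfl | hv
      · exact h1
      obtain ⟨j, hj, rfl⟩ := mem_image.mp hv
      exact k1 j (mem_range.mp (t4 hj))
  · intro i hi; exact ⟨(hcol i hi k0).1, (hcol i hi k0).2.1⟩

/-- hosting most of `F` on a system of representatives -/
theorem host (ℓ K : ℕ) (H : HGraph r) (c : ℕ → ℕ) (P : Finset ℕ) (hP : P ⊆ H.verts) (x : ℕ → ℕ)
    (hx : Sys ℓ K H c P x) (A B : Finset ℕ) (hAB : Disjoint A B) (g φ : ℕ → ℕ)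
    (hgA : ∀ v ∈ A, g v ∈ P) (hgi : Set.InjOn g A) (hφ : ∀ v ∈ B, φ v < ℓ) (hφi : Set.InjOn φ B)
    (hφP : ∀ v ∈ B, ∀ p ∈ P, φ v ≠ c p) (hgB : ∀ v ∈ B, g v = x (φ v)) :
    Set.InjOn g ↑(A ∪ B) ∧ (∀ v ∈ A ∪ B, g v ∈ H.verts) ∧
    (∀ e : Finset ℕ, e.card = r → e ⊆ A ∪ B → (e ∩ A).card ≤ 1 → e.image g ∈ H.edges) ∧
    (∀ u ∈ A ∪ B, ∀ v ∈ A ∪ B, u ≠ v → ¬ (u ∈ A ∧ v ∈ A) → Rob H K (g u) (g v)) := by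
  refine ⟨?_, ?_, ?_, ?_⟩
  · intro u hu v hv h
    rw [mem_coe, mem_union] at hu hv
    rcases hu with hu | hu <;> rcases hv with hv | hv
    · exact hgi hu hv h
    · exfalso
      have := hgA u hu
      rw [h, hgB v hv] at this
      exact hx.notP _ (hφ v hv) this
    · exfalso
      have := hgA v hv
      rw [← h, hgB u hu] at this
      exact hx.notP _ (hφ u hu) this
    · rw [hgB u hu, hgB v hv] at h
      apply hφi hu hv
      rw [← hx.col _ (hφ u hu), ← hx.col _ (hφ v hv), h]
  · intro v hv
    rcases mem_union.mp hv with h | h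
    · exact hP (hgA v h)
    · rw [hgB v h]; exact hx.mem _ (hφ v h)
  · intro e he hs hc
    rcases Nat.lt_or_ge (e ∩ A).card 1 with h0 | h1
    · have h0 : e ∩ A = ∅ := card_eq_zero.mp (by omega)
      have heB : e ⊆ B := by
        intro v hv
        rcases mem_union.mp (hs hv) with h | h
        · exact absurd (mem_inter.mpr ⟨hv, h⟩) (by rw [h0]; simp)
        · exact h
      have : e.image g = (e.image φ).image x := by
        rw [image_image]; apply image_congr; intro v hv; exact hgB v (heB hv)
      rw [this]
      apply hx.edge
      · intro i hi; obtain ⟨v, hv, rfl⟩ := mem_image.mp hi; exact mem_range.mpr (hφ v (heB hv))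
      · rw [card_image_of_injOn (hφi.mono (coe_subset.mpr heB)), he]
    · obtain ⟨a, ha⟩ := card_eq_one.mp (le_antisymm hc h1)
      have hae : a ∈ e ∩ A := by rw [ha]; simp
      obtain ⟨ha1, ha2⟩ := mem_inter.mp hae
      have heB : e.erase a ⊆ B := by
        intro v hv
        obtain ⟨h2, h3⟩ := mem_erase.mp hv
        rcases mem_union.mp (hs h3) with h | h
        · have : v ∈ e ∩ A := mem_inter.mpr ⟨h3, h⟩
          rw [ha, mem_singleton] at this; exact absurd this h2
        · exact h
      have : e.image g = insert (g a) (((e.erase a).image φ).image x) := by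
        rw [image_image]
        conv_lhs => rw [← insert_erase ha1, image_insert]
        congr 1
        apply image_congr; intro v hv; exact hgB v (heB hv)
      rw [this]
      apply hx.edgeP _ (hgA a ha2)
      · intro i hi; obtain ⟨v, hv, rfl⟩ := mem_image.mp hi; exact mem_range.mpr (hφ v (heB hv))
      · rw [card_image_of_injOn (hφi.mono (coe_subset.mpr heB)), card_erase_of_mem ha1, he]
        have : 0 < e.card := card_pos.mpr ⟨a, ha1⟩
        omega
      · intro hi; obtain ⟨v, hv, hv'⟩ := mem_image.mp hi
        exact hφP v (heB hv) _ (hgA a ha2) hv'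
  · intro u hu v hv huv hA
    by_cases hu' : u ∈ A
    · have hv' : v ∈ B := (mem_union.mp hv).resolve_left (fun h => hA ⟨hu', h⟩)
      rw [hgB v hv']
      exact hx.robP _ (hgA u hu') _ (hφ v hv') (hφP v hv' _ (hgA u hu'))
    have hu'' := (mem_union.mp hu).resolve_left hu'
    by_cases hv' : v ∈ A
    · rw [hgB u hu'']
      exact (hx.robP _ (hgA v hv') _ (hφ u hu'') (hφP u hu'' _ (hgA v hv'))).symm
    have hv'' := (mem_union.mp hv).resolve_left hv'
    rw [hgB u hu'', hgB v hv'']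
    exact hx.rob _ (hφ u hu'') _ (hφ v hv'') (fun h => huv (hφi hu'' hv'' h))

theorem rob_of_codeg (H : HGraph r) (K z u : ℕ) (hzu : z ≠ u) (δ : ℝ) (hK : K < δ * H.verts.card)
    (h : δ * (H.verts.card : ℝ) ^ (r - 2) ≤ ((H.edges.filter (fun e => z ∈ e ∧ u ∈ e)).card : ℝ)) :
    Rob H K z u := by
  intro X hX hz hu
  by_contra hcon
  push Not at hcon
  have hsub : H.edges.filter (fun e => z ∈ e ∧ u ∈ e) ⊆
      X.biUnion (fun x => H.edges.filter (fun e => ({z, u, x} : Finset ℕ) ⊆ e)) := by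
    intro e he
    rw [mem_filter] at he
    have h1 := hcon e he.1 he.2.1 he.2.2
    rw [not_disjoint_iff] at h1
    obtain ⟨x, hx, hx'⟩ := h1
    refine mem_biUnion.mpr ⟨x, hx', mem_filter.mpr ⟨he.1, ?_⟩⟩
    intro v hv
    simp only [mem_insert, mem_singleton] at hv
    rcases hv with rfl | rfl | rfl
    · exact he.2.1
    · exact he.2.2
    · exact hx
  set n : ℝ := (H.verts.card : ℝ) with hn
  have hn0 : 0 ≤ n := by positivity
  have h2 : ∀ x ∈ X, ((H.edges.filter (fun e => ({z, u, x} : Finset ℕ) ⊆ e)).card : ℝ) * n ≤ n ^ (r - 2) := by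
    intro x hx
    have hc3 : ({z, u, x} : Finset ℕ).card = 3 := by
      rw [card_eq_three]
      exact ⟨z, u, x, hzu, fun h => hz (h ▸ hx), fun h => hu (h ▸ hx), rfl⟩
    by_cases h0 : (H.edges.filter (fun e => ({z, u, x} : Finset ℕ) ⊆ e)) = ∅
    · rw [h0]; simp; positivity
    · obtain ⟨e, he⟩ := nonempty_iff_ne_empty.mpr h0
      rw [mem_filter] at he
      have h3 : 3 ≤ r := by rw [← H.edges_card e he.1, ← hc3]; exact card_le_card he.2
      have := card_edges_sup H {z, u, x}
      rw [hc3] at this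
      have h4 : ((H.edges.filter (fun e => ({z, u, x} : Finset ℕ) ⊆ e)).card : ℝ) ≤ n ^ (r - 3) := by
        rw [hn]; exact_mod_cast this
      calc _ ≤ n ^ (r-3) * n := by gcongr
        _ = n ^ (r-2) := by rw [← pow_succ]; congr 1; omega
  have h3 : ((H.edges.filter (fun e => z ∈ e ∧ u ∈ e)).card : ℝ) * n ≤ K * n ^ (r-2) := by
    have h4 : ((H.edges.filter (fun e => z ∈ e ∧ u ∈ e)).card : ℝ) ≤
        ∑ x ∈ X, ((H.edges.filter (fun e => ({z, u, x} : Finset ℕ) ⊆ e)).card : ℝ) := by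
      exact_mod_cast (card_le_card hsub).trans card_biUnion_le
    calc _ ≤ (∑ x ∈ X, ((H.edges.filter (fun e => ({z, u, x} : Finset ℕ) ⊆ e)).card : ℝ)) * n := by gcongr
      _ = ∑ x ∈ X, ((H.edges.filter (fun e => ({z, u, x} : Finset ℕ) ⊆ e)).card : ℝ) * n := sum_mul ..
      _ ≤ X.card • n ^ (r-2) := sum_le_card_nsmul _ _ _ h2
      _ ≤ K * n ^ (r-2) := by
        rw [nsmul_eq_mul]; gcongr
  have hnpos : 0 < n := by
    rcases hn0.eq_or_lt with h | h
    · rw [← h, mul_zero] at hK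
      have : (0:ℝ) ≤ K := by positivity
      linarith
    · exact h
  have : δ * n ^ (r-2) * n ≤ K * n ^ (r-2) := le_trans (by gcongr) h3
  have hp : 0 < n ^ (r-2) := by positivity
  nlinarith

end PartH

section PartI
open Finset
open scoped Classical

variable {r : ℕ}

/-- The condition (b) on `F`. -/
def CondB (ℓ : ℕ) (F : HGraph r) : Prop :=
  (∃ v ∈ F.verts, ∀ e ∈ F.edges, v ∉ e) ∨ F.IsCopyIn (BGraph r ℓ)

theorem B_verts (ℓ : ℕ) : (BGraph r ℓ).verts = Icc 1 (ℓ+1) := rfl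

theorem B_edges (ℓ : ℕ) (e : Finset ℕ) (he : e ∈ (BGraph r ℓ).edges) :
    e = Icc 1 r ∨ (e ⊆ Icc 2 (ℓ+1) ∧ (e ∩ Icc 2 r).card ≤ 1) := by
  simp only [BGraph, HGraph.ofEdges, mem_filter, mem_insert, mem_powersetCard] at he
  rcases he.1 with h | h
  · exact Or.inl h
  · exact Or.inr ⟨h.1.1, h.2⟩

theorem F_upair (ℓ : ℕ) (hr : 2 ≤ r) (hrl : r ≤ ℓ) (F : HGraph r) (hF : F.verts.card = ℓ + 1)
    (hb : CondB ℓ F) : ∃ a b, (a, b) ∈ upairs F := by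
  have key : ∃ a ∈ F.verts, ∃ b ∈ F.verts, a ≠ b ∧ ∀ e ∈ F.edges, ¬ (a ∈ e ∧ b ∈ e) := by
    rcases hb with ⟨v, hv, h⟩ | ⟨h, h1, h2, h3⟩
    · obtain ⟨b, hb, hne⟩ := exists_mem_ne (by omega : 1 < F.verts.card) v
      exact ⟨v, hv, b, hb, hne.symm, fun e he h' => h e he h'.1⟩
    · have himg : F.verts.image h = Icc 1 (ℓ+1) := by
        apply eq_of_subset_of_card_le
        · intro v hv; obtain ⟨u, hu, rfl⟩ := mem_image.mp hv; exact h2 u hu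
        · rw [card_image_of_injOn h1, hF, Nat.card_Icc]; omega
      have m1 : 1 ∈ F.verts.image h := by rw [himg, mem_Icc]; omega
      have m2 : r + 1 ∈ F.verts.image h := by rw [himg, mem_Icc]; omega
      obtain ⟨a, ha, ha'⟩ := mem_image.mp m1
      obtain ⟨b, hb, hb'⟩ := mem_image.mp m2
      refine ⟨a, ha, b, hb, fun h => by subst h; omega, ?_⟩
      intro e he hab
      have q1 : 1 ∈ e.image h := ha' ▸ mem_image_of_mem h hab.1
      have q2 : r + 1 ∈ e.image h := hb' ▸ mem_image_of_mem h hab.2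
      rcases B_edges ℓ _ (h3 e he) with h4 | h4
      · rw [h4, mem_Icc] at q2; omega
      · have := h4.1 q1; rw [mem_Icc] at this; omega
  obtain ⟨a, ha, b, hb, hne, hab⟩ := key
  rcases lt_or_gt_of_ne hne with h | h
  · exact ⟨a, b, by simp only [upairs, mem_filter, mem_product]; exact ⟨⟨ha, hb⟩, h, hab⟩⟩
  · exact ⟨b, a, by
      simp only [upairs, mem_filter, mem_product]; exact ⟨⟨hb, ha⟩, h, fun e he h' => hab e he h'.symm⟩⟩

theorem F_struct (ℓ : ℕ) (hr : 2 ≤ r) (F : HGraph r) (hF : F.verts.card = ℓ + 1)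
    (hb : CondB ℓ F) : (∃ v ∈ F.verts, ∀ e ∈ F.edges, v ∉ e) ∨
      ∃ (w : ℕ) (A f0 : Finset ℕ), w ∈ F.verts ∧ A ⊆ F.verts ∧ w ∉ A ∧ f0 = insert w A ∧ f0 ∈ F.edges ∧
        ∀ e ∈ F.edges, e = f0 ∨ (w ∉ e ∧ (e ∩ A).card ≤ 1) := by
  rcases hb with h | ⟨h, h1, h2, h3⟩
  · exact Or.inl h
  have himg : F.verts.image h = Icc 1 (ℓ+1) := by
    apply eq_of_subset_of_card_le
    · intro v hv; obtain ⟨u, hu, rfl⟩ := mem_image.mp hv; exact h2 u hu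
    · rw [card_image_of_injOn h1, hF, Nat.card_Icc]; omega
  have m1 : 1 ∈ F.verts.image h := by rw [himg, mem_Icc]; omega
  obtain ⟨w, hw, hw'⟩ := mem_image.mp m1
  by_cases hex : ∃ f0 ∈ F.edges, f0.image h = Icc 1 r
  · obtain ⟨f0, hf0, hf0'⟩ := hex
    right
    have hsub := F.edges_sub f0 hf0
    have hcard := F.edges_card f0 hf0
    have hwf : w ∈ f0 := by
      have : 1 ∈ f0.image h := by rw [hf0', mem_Icc]; omega
      obtain ⟨w', hw1, hw2⟩ := mem_image.mp this
      rwa [← h1 (hsub hw1) hw (by rw [hw2, hw'])]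
    refine ⟨w, f0.erase w, f0, hw, (erase_subset _ _).trans hsub, notMem_erase _ _, (insert_erase hwf).symm, hf0, ?_⟩
    intro e he
    rcases B_edges ℓ _ (h3 e he) with h4 | h4
    · left
      have : (e : Set ℕ) = f0 := by
        apply h1.image_eq_image_iff (coe_subset.mpr (F.edges_sub e he)) (coe_subset.mpr hsub) |>.mp
        rw [← coe_image, ← coe_image, h4, hf0']
      exact_mod_cast this
    · right
      constructor
      · intro hwe
        have := h4.1 (hw' ▸ mem_image_of_mem h hwe)
        rw [mem_Icc] at this; omega
      · refine le_trans ?_ h4.2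
        rw [← card_image_of_injOn (s := e ∩ f0.erase w) (f := h) (h1.mono (coe_subset.mpr (inter_subset_left.trans (F.edges_sub e he))))]
        apply card_le_card
        intro v hv
        obtain ⟨u, hu, rfl⟩ := mem_image.mp hv
        obtain ⟨hu1, hu2⟩ := mem_inter.mp hu
        obtain ⟨hu3, hu4⟩ := mem_erase.mp hu2
        have h5 : h u ∈ f0.image h := mem_image_of_mem h hu4
        rw [hf0', mem_Icc] at h5
        rw [mem_inter, mem_Icc]
        refine ⟨mem_image_of_mem h hu1, ?_, h5.2⟩
        have : h u ≠ 1 := fun h6 => hu3 (h1 (hsub hu4) hw (by rw [h6, hw']))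
        omega
  · left
    refine ⟨w, hw, ?_⟩
    intro e he hwe
    rcases B_edges ℓ _ (h3 e he) with h4 | h4
    · exact hex ⟨e, he, h4⟩
    · have := h4.1 (hw' ▸ mem_image_of_mem h hwe)
      rw [mem_Icc] at this; omega

theorem exists_inj (A : Finset ℕ) (B : Finset ℕ) (h : A.card = B.card) :
    ∃ φ : ℕ → ℕ, Set.InjOn φ A ∧ (∀ v ∈ A, φ v ∈ B) ∧ A.image φ = B := by
  obtain ⟨φ, h1⟩ := bij_of_card A B h
  refine ⟨φ, h1.injOn, fun v hv => h1.mapsTo hv, ?_⟩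
  have := h1.image_eq
  exact_mod_cast this

/-- no edge has two vertices of the same colour in `U` -/
theorem nb (ℓ : ℕ) (hr : 2 ≤ r) (hrl : r ≤ ℓ) (F : HGraph r) (hF : F.verts.card = ℓ + 1)
    (hb : CondB ℓ F) : ∃ η0 : ℝ, 0 < η0 ∧ η0 ≤ kap r ℓ ∧ ∃ N : ℕ, ∀ (H : HGraph r) (c : ℕ → ℕ) (U : Finset ℕ),
      Good ℓ H c U η0 → N ≤ H.verts.card → ¬ F.expansion.IsCopyIn H →
      ∀ e ∈ H.edges, ∀ p ∈ e, ∀ p' ∈ e, p ∈ U → p' ∈ U → c p = c p' → p = p' := by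
  obtain ⟨η0, hη0, hη1, N, hN⟩ := emb2 (r := r) ℓ (Kn F) hr hrl (kap r ℓ) (kap_pos r ℓ hr hrl)
  refine ⟨η0, hη0, hη1, N, ?_⟩
  intro H c U hG hn hfree e he p hp p' hp' hpU hpU' hcc
  by_contra hne
  apply hfree
  obtain ⟨a, b, hab⟩ := F_upair ℓ hr hrl F hF hb
  have hab' := hab
  simp only [upairs, mem_filter, mem_product] at hab'
  obtain ⟨⟨ha, hbb⟩, hlt, hcov⟩ := hab'
  obtain ⟨x, hx, hxD⟩ := hN H c U hG hn {p, p'} (by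
      intro v hv; simp only [mem_insert, mem_singleton] at hv; rcases hv with rfl | rfl <;> assumption)
    (by rw [card_pair hne]; exact hr) e (by rw [H.edges_card e he]; omega) (fun i => cls U c i)
    (fun i hi => ⟨subset_refl _, good_class ℓ hr hrl H c U η0 hG hη0 hη1 i hi⟩)
  have hcp : c p < ℓ := hG.col p (hG.sub hpU)
  have hsubF : ({a, b} : Finset ℕ) ⊆ F.verts := by
    intro v hv; simp only [mem_insert, mem_singleton] at hv; rcases hv with rfl | rfl <;> assumption
  obtain ⟨φ, f1, f2, -⟩ := exists_inj (F.verts \ {a, b}) ((range ℓ).erase (c p)) (by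
    rw [card_sdiff_of_subset hsubF, hF, card_pair hlt.ne, card_erase_of_mem (mem_range.mpr hcp), card_range]; omega)
  set g : ℕ → ℕ := fun v => if v = a then p else if v = b then p' else x (φ v) with hg
  have ga : g a = p := by simp [hg]
  have gb : g b = p' := by simp [hg, hlt.ne']
  have gB : ∀ v ∈ F.verts \ {a, b}, g v = x (φ v) := by
    intro v hv
    simp only [Finset.mem_sdiff, mem_insert, mem_singleton, not_or] at hv
    simp [hg, hv.2.1, hv.2.2]
  have hPc : ∀ q ∈ ({p, p'} : Finset ℕ), c q = c p := by
    intro v hv; simp only [mem_insert, mem_singleton] at hv; rcases hv with rfl | rfl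
    · rfl
    · exact hcc.symm
  have hunion : ({a, b} : Finset ℕ) ∪ (F.verts \ {a, b}) = F.verts := union_sdiff_of_subset hsubF
  obtain ⟨t1, t2, t3, t4⟩ := host ℓ (Kn F) H c {p, p'} (by
      intro v hv; simp only [mem_insert, mem_singleton] at hv; rcases hv with rfl | rfl
      · exact hG.sub hpU
      · exact hG.sub hpU') x hx {a, b} (F.verts \ {a, b}) disjoint_sdiff g φ
    (by intro v hv; simp only [mem_insert, mem_singleton] at hv; rcases hv with rfl | rfl
        · rw [ga]; simp
        · rw [gb]; simp)
    (by intro u hu v hv h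
        simp only [coe_insert, coe_singleton, Set.mem_insert_iff, Set.mem_singleton_iff] at hu hv
        rcases hu with rfl | rfl <;> rcases hv with rfl | rfl
        · rfl
        · rw [ga, gb] at h; exact absurd h hne
        · rw [ga, gb] at h; exact absurd h.symm hne
        · rfl)
    (fun v hv => mem_range.mp (mem_erase.mp (f2 v hv)).2) f1
    (fun v hv q hq => by rw [hPc q hq]; exact (mem_erase.mp (f2 v hv)).1) gB
  rw [hunion] at t1 t2 t3 t4
  refine exp_of_rob_special F H hr g ⟨t1, t2, ?_⟩ a b hab e he (by rw [ga]; exact hp) (by rw [gb]; exact hp') ?_ ?_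
  · intro f hf
    apply t3 f (F.edges_card f hf) (F.edges_sub f hf)
    rw [card_le_one]
    intro u hu v hv
    simp only [mem_inter, mem_insert, mem_singleton] at hu hv
    obtain ⟨u1, u2⟩ := hu
    obtain ⟨v1, v2⟩ := hv
    rcases u2 with rfl | rfl <;> rcases v2 with rfl | rfl
    · rfl
    · exact absurd ⟨u1, v1⟩ (hcov f hf)
    · exact absurd ⟨v1, u1⟩ (hcov f hf)
    · rfl
  · intro v hv hva hvb
    have hvB : v ∈ F.verts \ {a, b} := by
      simp only [Finset.mem_sdiff, mem_insert, mem_singleton, not_or]; exact ⟨hv, hva, hvb⟩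
    rw [gB v hvB]
    exact (hxD _ (mem_range.mp (mem_erase.mp (f2 v hvB)).2)).2
  · rintro ⟨u, v⟩ hq hqne
    simp only [upairs, mem_filter, mem_product] at hq
    obtain ⟨⟨hu, hv⟩, huv, _⟩ := hq
    apply t4 u hu v hv huv.ne
    simp only [mem_insert, mem_singleton]
    rintro ⟨rfl | rfl, rfl | rfl⟩
    · omega
    · exact hqne rfl
    · omega
    · omega

/-- edges through `z` whose other vertices lie in `U` -/
noncomputable def zE (H : HGraph r) (U : Finset ℕ) (z : ℕ) : Finset (Finset ℕ) :=
  H.edges.filter (fun e => z ∈ e ∧ e.erase z ⊆ U)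

theorem va (ℓ : ℕ) (hr : 2 ≤ r) (hrl : r ≤ ℓ) (F : HGraph r) (hF : F.verts.card = ℓ + 1)
    (hb : CondB ℓ F) (δ : ℝ) (hδ : 0 < δ) : ∃ η0 : ℝ, 0 < η0 ∧ η0 ≤ kap r ℓ ∧ ∃ N : ℕ,
      ∀ (H : HGraph r) (c : ℕ → ℕ) (U : Finset ℕ),
      Good ℓ H c U η0 → N ≤ H.verts.card → ¬ F.expansion.IsCopyIn H →
      ∀ z ∈ H.verts, ∃ i < ℓ, (((cls U c i).filter (fun u => u ≠ z ∧ 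
        δ * (H.verts.card : ℝ) ^ (r-2) ≤ (((zE H U z).filter (fun e => u ∈ e)).card : ℝ))).card : ℝ) <
          δ * H.verts.card := by
  obtain ⟨η1, hη1, hη1', N1, hN1⟩ := nb ℓ hr hrl F hF hb
  obtain ⟨η2, hη2, hη2', N2, hN2⟩ := emb2 (r := r) ℓ (Kn F) hr hrl δ hδ
  refine ⟨min η1 η2, lt_min hη1 hη2, (min_le_left _ _).trans hη1', N1 + N2 + ⌈(Kn F) / δ⌉₊ + 1, ?_⟩
  intro H c U hG hn hfree z hz
  by_contra hcon
  push Not at hcon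
  apply hfree
  set D : ℕ → Finset ℕ := fun i => (cls U c i).filter (fun u => u ≠ z ∧ 
        δ * (H.verts.card : ℝ) ^ (r-2) ≤ (((zE H U z).filter (fun e => u ∈ e)).card : ℝ)) with hD
  have hn' : ((N1 + N2 + ⌈(Kn F) / δ⌉₊ + 1 : ℕ) : ℝ) ≤ H.verts.card := by exact_mod_cast hn
  have hnK : (Kn F : ℝ) < δ * H.verts.card := by
    have h1 := Nat.le_ceil ((Kn F : ℝ) / δ)
    push_cast at hn'
    have h2 : (0:ℝ) ≤ N1 := by positivity
    have h3 : (0:ℝ) ≤ N2 := by positivity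
    have h4 : (Kn F : ℝ) / δ < H.verts.card := by linarith
    rw [div_lt_iff₀ hδ] at h4
    linarith
  have hnpos : (0:ℝ) < H.verts.card := by
    have : 0 < H.verts.card := by omega
    exact_mod_cast this
  have hDrob : ∀ i, ∀ u ∈ D i, Rob H (Kn F) z u := by
    intro i u hu
    rw [hD, mem_filter] at hu
    apply rob_of_codeg H _ z u hu.2.1.symm δ hnK
    refine hu.2.2.trans ?_
    have : ((zE H U z).filter (fun e => u ∈ e)).card ≤ (H.edges.filter (fun e => z ∈ e ∧ u ∈ e)).card := by
      apply card_le_card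
      intro e he
      rw [zE, filter_filter, mem_filter] at he
      exact mem_filter.mpr ⟨he.1, he.2.1.1, he.2.2⟩
    exact_mod_cast this
  have hDD : ∀ i < ℓ, D i ⊆ cls U c i ∧ δ * H.verts.card ≤ (D i).card :=
    fun i hi => ⟨filter_subset _ _, hcon i hi⟩
  rcases F_struct ℓ hr F hF hb with ⟨w, hw, hiso⟩ | ⟨w, A, f0, hw, hA, hwA, hf0, hf0e, hfe⟩
  · -- isolated vertex
    obtain ⟨x, hx, hxD⟩ := hN2 H c U (hG.mono (min_le_right _ _)) (by omega) ∅ (by simp) (by simp) {z}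
      (by simp; omega) D hDD
    obtain ⟨φ, f1, f2, -⟩ := exists_inj (F.verts.erase w) (range ℓ) (by
      rw [card_erase_of_mem hw, hF, card_range]; omega)
    set g : ℕ → ℕ := fun v => if v = w then z else x (φ v) with hg
    have gw : g w = z := by simp [hg]
    have gB : ∀ v ∈ F.verts.erase w, g v = x (φ v) := by
      intro v hv
      simp [hg, (mem_erase.mp hv).1]
    obtain ⟨t1, t2, t3, t4⟩ := host ℓ (Kn F) H c ∅ (by simp) x hx ∅ (F.verts.erase w) (by simp) g φ
      (by simp) (by simp) (fun v hv => mem_range.mp (f2 v hv)) f1 (by simp) gB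
    rw [empty_union] at t1 t2 t3 t4
    have gz : ∀ v ∈ F.verts.erase w, g v ≠ z := by
      intro v hv h
      rw [gB v hv] at h
      exact (hxD _ (mem_range.mp (f2 v hv))).2 (by rw [h]; simp)
    have hrobw : ∀ v ∈ F.verts.erase w, Rob H (Kn F) z (g v) := by
      intro v hv
      rw [gB v hv]
      exact hDrob _ _ (hxD _ (mem_range.mp (f2 v hv))).1
    refine exp_of_rob F H hr g ⟨?_, ?_, ?_⟩ ?_
    · rw [← insert_erase hw, coe_insert, Set.injOn_insert (by simp)]
      refine ⟨t1, ?_⟩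
      rintro ⟨v, hv, h⟩
      rw [gw] at h
      exact gz v hv h
    · intro v hv
      by_cases h : v = w
      · rw [h, gw]; exact hz
      · exact t2 v (mem_erase.mpr ⟨h, hv⟩)
    · intro e he
      refine t3 e (F.edges_card e he) ?_ (by simp)
      intro v hv
      exact mem_erase.mpr ⟨fun h => hiso e he (h ▸ hv), F.edges_sub e he hv⟩
    · rintro ⟨u, v⟩ hq
      simp only [upairs, mem_filter, mem_product] at hq
      obtain ⟨⟨hu, hv⟩, huv, _⟩ := hq
      by_cases h1 : u = w
      · rw [h1, gw]; exact hrobw v (mem_erase.mpr ⟨by omega, hv⟩)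
      by_cases h2 : v = w
      · rw [h2, gw]; exact (hrobw u (mem_erase.mpr ⟨h1, hu⟩)).symm
      exact t4 u (mem_erase.mpr ⟨h1, hu⟩) v (mem_erase.mpr ⟨h2, hv⟩) huv.ne (by simp)
  · -- B-case
    have hex : ∃ e ∈ H.edges, z ∈ e ∧ e.erase z ⊆ U := by
      have h0 := hcon 0 (by omega)
      have h1 : 0 < (D 0).card := by
        have : (0:ℝ) < (D 0).card := lt_of_lt_of_le (by positivity) h0
        exact_mod_cast this
      obtain ⟨u, hu⟩ := card_pos.mp h1
      rw [hD, mem_filter] at hu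
      have h2 : 0 < ((zE H U z).filter (fun e => u ∈ e)).card := by
        have : (0:ℝ) < ((zE H U z).filter (fun e => u ∈ e)).card := lt_of_lt_of_le (by positivity) hu.2.2
        exact_mod_cast this
      obtain ⟨e, he⟩ := card_pos.mp h2
      rw [zE, filter_filter, mem_filter] at he
      exact ⟨e, he.1, he.2.1⟩
    obtain ⟨e, he, hze, heU⟩ := hex
    set P := e.erase z with hP
    have hPc : P.card = r - 1 := by rw [hP, card_erase_of_mem hze, H.edges_card e he]
    have hPinj : Set.InjOn c P := by
      intro p hp p' hp' h
      exact hN1 H c U (hG.mono (min_le_left _ _)) (by omega) hfree e he p (mem_erase.mp hp).2 p'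
        (mem_erase.mp hp').2 (heU hp) (heU hp') h
    obtain ⟨x, hx, hxD⟩ := hN2 H c U (hG.mono (min_le_right _ _)) (by omega) P heU (by omega) {z}
      (by simp; omega) D hDD
    have hAc : A.card = r - 1 := by
      have := F.edges_card f0 hf0e
      rw [hf0, card_insert_of_notMem hwA] at this; omega
    obtain ⟨ψ, s1, s2, s3⟩ := exists_inj A P (by rw [hAc, hPc])
    have hfsub : insert w A ⊆ F.verts := insert_subset hw hA
    have hPimg : P.image c ⊆ range ℓ := by
      intro i hi
      obtain ⟨p, hp, rfl⟩ := mem_image.mp hi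
      exact mem_range.mpr (hG.col p (hG.sub (heU hp)))
    obtain ⟨φ, f1, f2, -⟩ := exists_inj (F.verts \ insert w A) (range ℓ \ P.image c) (by
      rw [card_sdiff_of_subset hfsub, card_sdiff_of_subset hPimg, hF, card_insert_of_notMem hwA, hAc,
        card_image_of_injOn hPinj, hPc, card_range]; omega)
    set B := F.verts \ insert w A with hB
    have hBm : ∀ v ∈ B, v ∈ F.verts ∧ v ≠ w ∧ v ∉ A := by
      intro v hv
      simpa [hB, Finset.mem_sdiff, mem_insert, not_or] using hv
    have hφl : ∀ v ∈ B, φ v < ℓ := fun v hv => mem_range.mp (Finset.mem_sdiff.mp (f2 v hv)).1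
    set g : ℕ → ℕ := fun v => if v = w then z else if v ∈ A then ψ v else x (φ v) with hg
    have gw : g w = z := by simp [hg]
    have gA : ∀ v ∈ A, g v = ψ v := by
      intro v hv
      have : v ≠ w := fun h => hwA (h ▸ hv)
      simp [hg, this, hv]
    have gB : ∀ v ∈ B, g v = x (φ v) := by
      intro v hv
      simp [hg, (hBm v hv).2.1, (hBm v hv).2.2]
    obtain ⟨t1, t2, t3, t4⟩ := host ℓ (Kn F) H c P (heU.trans hG.sub) x hx A B
      (by rw [disjoint_left]; intro v hv hv'; exact (hBm v hv').2.2 hv) g φ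
      (fun v hv => by rw [gA v hv]; exact s2 v hv)
      (fun u hu v hv h => s1 hu hv (by rw [← gA u hu, ← gA v hv, h])) hφl f1
      (fun v hv p hp h => (Finset.mem_sdiff.mp (f2 v hv)).2 (mem_image.mpr ⟨p, hp, h.symm⟩)) gB
    have hAB : ∀ v ∈ F.verts, v ≠ w → v ∈ A ∪ B := by
      intro v hv hvw
      by_cases h : v ∈ A
      · exact mem_union_left _ h
      · exact mem_union_right _ (by rw [hB]; simp [hv, hvw, h])
    have gz : ∀ v ∈ A ∪ B, g v ≠ z := by
      intro v hv h
      rcases mem_union.mp hv with hv | hv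
      · rw [gA v hv] at h
        have := s2 v hv
        rw [h, hP] at this
        exact notMem_erase _ _ this
      · rw [gB v hv] at h
        exact (hxD _ (hφl v hv)).2 (by rw [h]; simp)
    have hrobw : ∀ v ∈ B, Rob H (Kn F) z (g v) := by
      intro v hv
      rw [gB v hv]
      exact hDrob _ _ (hxD _ (hφl v hv)).1
    refine exp_of_rob F H hr g ⟨?_, ?_, ?_⟩ ?_
    · intro u hu v hv h
      by_cases h1 : u = w <;> by_cases h2 : v = w
      · rw [h1, h2]
      · rw [h1, gw] at h; exact absurd h.symm (gz v (hAB v hv h2))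
      · rw [h2, gw] at h; exact absurd h (gz u (hAB u hu h1))
      · exact t1 (hAB u hu h1) (hAB v hv h2) h
    · intro v hv
      by_cases h : v = w
      · rw [h, gw]; exact hz
      · exact t2 v (hAB v hv h)
    · intro f hf
      rcases hfe f hf with rfl | ⟨h1, h2⟩
      · have : f.image g = e := by
          rw [hf0, image_insert, gw]
          have : A.image g = P := by
            rw [← s3]; apply image_congr; intro v hv; exact gA v hv
          rw [this, hP, insert_erase hze]
        rw [this]; exact he
      · exact t3 f (F.edges_card f hf) (fun v hv => hAB v (F.edges_sub f hf hv) (fun h => h1 (h ▸ hv))) h2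
    · rintro ⟨u, v⟩ hq
      simp only [upairs, mem_filter, mem_product] at hq
      obtain ⟨⟨hu, hv⟩, huv, hcov⟩ := hq
      have hcov0 := hcov f0 hf0e
      rw [hf0] at hcov0
      by_cases h1 : u = w
      · have hvw : v ≠ w := by omega
        have hvA : v ∉ A := fun h => hcov0 ⟨by rw [h1]; simp, mem_insert_of_mem h⟩
        rw [h1, gw]; exact hrobw v ((mem_union.mp (hAB v hv hvw)).resolve_left hvA)
      by_cases h2 : v = w
      · have huA : u ∉ A := fun h => hcov0 ⟨mem_insert_of_mem h, by rw [h2]; simp⟩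
        rw [h2, gw]; exact (hrobw u ((mem_union.mp (hAB u hu h1)).resolve_left huA)).symm
      exact t4 u (hAB u hu h1) v (hAB v hv h2) huv.ne
        (fun h => hcov0 ⟨mem_insert_of_mem h.1, mem_insert_of_mem h.2⟩)

/-- edges through `z`, otherwise in `U`, hitting colour `i` outside of `z` -/
noncomputable def zEi (H : HGraph r) (c : ℕ → ℕ) (U : Finset ℕ) (z i : ℕ) : Finset (Finset ℕ) :=
  (zE H U z).filter (fun e => ∃ u ∈ e, u ≠ z ∧ c u = i)

theorem core (ℓ : ℕ) (hr : 2 ≤ r) (hrl : r ≤ ℓ) (F : HGraph r) (hF : F.verts.card = ℓ + 1)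
    (hb : CondB ℓ F) (ε : ℝ) (hε : 0 < ε) : ∃ η0 : ℝ, 0 < η0 ∧ ∃ N : ℕ,
      ∀ (H : HGraph r) (c : ℕ → ℕ) (U : Finset ℕ),
      Good ℓ H c U η0 → N ≤ H.verts.card → ¬ F.expansion.IsCopyIn H →
      (∀ e ∈ H.edges, ∀ p ∈ e, ∀ p' ∈ e, p ∈ U → p' ∈ U → c p = c p' → p = p') ∧
      (∀ z ∈ H.verts, ∃ i < ℓ, ((zEi H c U z i).card : ℝ) ≤ ε * (H.verts.card : ℝ) ^ (r-1)) ∧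
      (∀ i < ℓ, ((rb c (U \ cls U c i) (r-1)).card : ℝ) ≤ (r * pc r ℓ + ε) * (H.verts.card : ℝ) ^ (r-1)) := by
  have hκ := kap_pos r ℓ hr hrl
  obtain ⟨η1, hη1, hη1', N1, hN1⟩ := nb ℓ hr hrl F hF hb
  obtain ⟨η2, hη2, hη2', N2, hN2⟩ := va ℓ hr hrl F hF hb (ε / 2) (by positivity)
  refine ⟨min (min η1 η2) (ε * kap r ℓ / 2), by positivity, N1 + N2, ?_⟩
  intro H c U hG hn hfree
  refine ⟨hN1 H c U (hG.mono ((min_le_left _ _).trans (min_le_left _ _))) (by omega) hfree, ?_, ?_⟩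
  · intro z hz
    obtain ⟨i, hi, hD⟩ := hN2 H c U (hG.mono ((min_le_left _ _).trans (min_le_right _ _))) (by omega) hfree z hz
    refine ⟨i, hi, ?_⟩
    set n : ℝ := (H.verts.card : ℝ) with hn
    set D := (cls U c i).filter (fun u => u ≠ z ∧ 
        ε / 2 * n ^ (r-2) ≤ (((zE H U z).filter (fun e => u ∈ e)).card : ℝ)) with hDdef
    set D' := (cls U c i).filter (fun u => u ≠ z ∧ 
        ¬ ε / 2 * n ^ (r-2) ≤ (((zE H U z).filter (fun e => u ∈ e)).card : ℝ)) with hDdef'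
    have hsub : zEi H c U z i ⊆ (D ∪ D').biUnion (fun u => (zE H U z).filter (fun e => u ∈ e)) := by
      intro e he
      rw [zEi, mem_filter] at he
      obtain ⟨h1, u, hu, huz, hcu⟩ := he
      have h1' := h1
      rw [zE, mem_filter] at h1'
      refine mem_biUnion.mpr ⟨u, ?_, mem_filter.mpr ⟨h1, hu⟩⟩
      have hm : u ∈ cls U c i := mem_cls.mpr ⟨h1'.2.2 (mem_erase.mpr ⟨huz, hu⟩), hcu⟩
      rw [mem_union, mem_filter, mem_filter]
      tauto
    have hd : Disjoint D D' := by
      rw [disjoint_left]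
      intro u hu hu'
      exact (mem_filter.mp hu').2.2 (mem_filter.mp hu).2.2
    have h1 : ((zEi H c U z i).card : ℝ) ≤ ∑ u ∈ D, (((zE H U z).filter (fun e => u ∈ e)).card : ℝ) +
        ∑ u ∈ D', (((zE H U z).filter (fun e => u ∈ e)).card : ℝ) := by
      rw [← sum_union hd]
      exact_mod_cast (card_le_card hsub).trans card_biUnion_le
    have h2 : ∑ u ∈ D, (((zE H U z).filter (fun e => u ∈ e)).card : ℝ) ≤ D.card * n ^ (r-2) := by
      rw [← nsmul_eq_mul]
      apply sum_le_card_nsmul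
      intro u hu
      have h3 := card_edges_pair H z u (mem_filter.mp hu).2.1.symm
      have h4 : ((zE H U z).filter (fun e => u ∈ e)).card ≤ (H.edges.filter (fun e => z ∈ e ∧ u ∈ e)).card := by
        apply card_le_card
        intro e he
        rw [zE, filter_filter, mem_filter] at he
        exact mem_filter.mpr ⟨he.1, he.2.1.1, he.2.2⟩
      rw [hn]
      exact_mod_cast h4.trans h3
    have h3 : ∑ u ∈ D', (((zE H U z).filter (fun e => u ∈ e)).card : ℝ) ≤ n * (ε / 2 * n ^ (r-2)) := by
      have : ∑ u ∈ D', (((zE H U z).filter (fun e => u ∈ e)).card : ℝ) ≤ D'.card • (ε / 2 * n ^ (r-2)) := by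
        apply sum_le_card_nsmul
        intro u hu
        exact (not_le.mp (mem_filter.mp hu).2.2).le
      refine this.trans ?_
      rw [nsmul_eq_mul]
      have : (D'.card : ℝ) ≤ n := by
        rw [hn]
        exact_mod_cast card_le_card (fun u hu => hG.sub (mem_cls.mp (mem_filter.mp hu).1).1)
      gcongr
    have hpow : n ^ (r-1) = n * n ^ (r-2) := by rw [← pow_succ']; congr 1; omega
    rw [hpow]
    have h4 : (D.card : ℝ) * n ^ (r-2) ≤ (ε / 2 * n) * n ^ (r-2) := by
      apply mul_le_mul_of_nonneg_right hD.le (by positivity)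
    nlinarith
  · intro i hi
    have hη : min (min η1 η2) (ε * kap r ℓ / 2) ≤ kap r ℓ := ((min_le_left _ _).trans (min_le_left _ _)).trans hη1'
    refine (good_N ℓ hr hrl H c U _ hG (by positivity) hη i hi).trans ?_
    have h1 : min (min η1 η2) (ε * kap r ℓ / 2) ≤ ε * kap r ℓ / 2 := min_le_right _ _
    have h2 : 2 * min (min η1 η2) (ε * kap r ℓ / 2) / kap r ℓ ≤ ε := by
      rw [div_le_iff₀ hκ]; linarith
    gcongr

end PartI

section PartJ
open Finset
open scoped Classical

variable {r : ℕ}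

noncomputable def badT (H : HGraph r) (c : ℕ → ℕ) : Finset (Finset ℕ) :=
  H.edges.filter (fun e => ¬ Set.InjOn c (e : Set ℕ))

noncomputable def badE (H : HGraph r) (c : ℕ → ℕ) (z : ℕ) : Finset (Finset ℕ) :=
  H.edges.filter (fun e => z ∈ e ∧ ¬ Set.InjOn c (e : Set ℕ))

structure Nice (ℓ : ℕ) (H : HGraph r) (c : ℕ → ℕ) (ε : ℝ) : Prop where
  col : ∀ v ∈ H.verts, c v < ℓ
  bad : ∀ z ∈ H.verts, ((badE H c z).card : ℝ) ≤ ε * (H.verts.card : ℝ) ^ (r-1)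
  deg : ∀ z ∈ H.verts, (H.deg z : ℝ) ≤ (r * pc r ℓ + ε) * (H.verts.card : ℝ) ^ (r-1)

/-- edges through `z` meeting a small set elsewhere -/
theorem card_meet (hr : 2 ≤ r) (H : HGraph r) (Z : Finset ℕ) (z : ℕ) (x : ℝ) 
    (hZ : (Z.card : ℝ) ≤ x * H.verts.card) :
    ((H.edges.filter (fun e => z ∈ e ∧ ∃ v ∈ Z, v ≠ z ∧ v ∈ e)).card : ℝ) ≤ x * (H.verts.card : ℝ) ^ (r-1) := by
  have hsub : H.edges.filter (fun e => z ∈ e ∧ ∃ v ∈ Z, v ≠ z ∧ v ∈ e) ⊆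
      (Z.erase z).biUnion (fun v => H.edges.filter (fun e => z ∈ e ∧ v ∈ e)) := by
    intro e he
    obtain ⟨h1, h2, v, h3, h4, h5⟩ := mem_filter.mp he
    exact mem_biUnion.mpr ⟨v, mem_erase.mpr ⟨h4, h3⟩, mem_filter.mpr ⟨h1, h2, h5⟩⟩
  have h1 : (H.edges.filter (fun e => z ∈ e ∧ ∃ v ∈ Z, v ≠ z ∧ v ∈ e)).card ≤
      Z.card * H.verts.card ^ (r-2) := by
    refine (card_le_card hsub).trans (card_biUnion_le.trans ?_)
    refine (sum_le_card_nsmul _ _ (H.verts.card ^ (r-2)) ?_).trans ?_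
    · intro v hv
      exact card_edges_pair H z v (mem_erase.mp hv).1.symm
    · rw [smul_eq_mul]
      exact Nat.mul_le_mul_right _ (card_le_card (erase_subset _ _))
  have h2 : ((H.edges.filter (fun e => z ∈ e ∧ ∃ v ∈ Z, v ≠ z ∧ v ∈ e)).card : ℝ) ≤
      Z.card * (H.verts.card : ℝ) ^ (r-2) := by exact_mod_cast h1
  refine h2.trans ?_
  have hpow : (H.verts.card : ℝ) ^ (r-1) = H.verts.card * (H.verts.card : ℝ) ^ (r-2) := by
    rw [← pow_succ']; congr 1; omega
  rw [hpow, ← mul_assoc]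
  gcongr

theorem rec_nice (ℓ : ℕ) (hr : 2 ≤ r) (hrl : r ≤ ℓ) (F : HGraph r) (hF : F.verts.card = ℓ + 1)
    (hb : CondB ℓ F) (ε : ℝ) (hε : 0 < ε) : ∃ η0 : ℝ, 0 < η0 ∧ ∃ N : ℕ,
      ∀ (H : HGraph r) (c : ℕ → ℕ) (U : Finset ℕ),
      Good ℓ H c U η0 → N ≤ H.verts.card → ¬ F.expansion.IsCopyIn H → ∃ c', Nice ℓ H c' ε := by
  obtain ⟨η1, hη1, N, hN⟩ := core ℓ hr hrl F hF hb (ε / 3) (by positivity)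
  refine ⟨min η1 (ε / 3), by positivity, N, ?_⟩
  intro H c U hG hn hfree
  obtain ⟨h1, h2, h3⟩ := hN H c U (hG.mono (min_le_left _ _)) hn hfree
  have h2' : ∀ z, ∃ i, z ∈ H.verts → i < ℓ ∧ ((zEi H c U z i).card : ℝ) ≤ ε / 3 * (H.verts.card : ℝ) ^ (r-1) := by
    intro z
    by_cases hz : z ∈ H.verts
    · obtain ⟨i, hi, hi'⟩ := h2 z hz
      exact ⟨i, fun _ => ⟨hi, hi'⟩⟩
    · exact ⟨0, fun h => absurd h hz⟩
  choose i hi using h2'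
  set n : ℝ := (H.verts.card : ℝ) with hn'
  have hout : ∀ z, ((H.edges.filter (fun e => z ∈ e ∧ ∃ v ∈ H.verts \ U, v ≠ z ∧ v ∈ e)).card : ℝ) ≤
      ε / 3 * n ^ (r-1) := by
    intro z
    apply card_meet hr
    refine hG.big.trans ?_
    gcongr
    exact min_le_right _ _
  have hin : ∀ z, ∀ e ∈ H.edges, ¬ (∃ v ∈ H.verts \ U, v ≠ z ∧ v ∈ e) → e.erase z ⊆ U := by
    intro z e he h v hv
    obtain ⟨hv1, hv2⟩ := mem_erase.mp hv
    by_contra hvU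
    exact h ⟨v, Finset.mem_sdiff.mpr ⟨H.edges_sub e he hv2, hvU⟩, hv1, hv2⟩
  have hpos : 0 ≤ n ^ (r-1) := by positivity
  refine ⟨fun v => if v ∈ U then c v else i v, ?_, ?_, ?_⟩
  · intro v hv
    by_cases h : v ∈ U
    · simp only [h, if_true]; exact hG.col v hv
    · simp only [h, if_false]; exact (hi v hv).1
  · intro z hz
    have hsub : badE H (fun v => if v ∈ U then c v else i v) z ⊆
        (H.edges.filter (fun e => z ∈ e ∧ ∃ v ∈ H.verts \ U, v ≠ z ∧ v ∈ e)) ∪ zEi H c U z (i z) := by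
      intro e he
      obtain ⟨he1, hze, hinj⟩ := mem_filter.mp he
      rw [mem_union]
      by_contra hcon
      rw [not_or] at hcon
      obtain ⟨q1, q2⟩ := hcon
      have hU : e.erase z ⊆ U := hin z e he1 (fun h => q1 (mem_filter.mpr ⟨he1, hze, h⟩))
      have hz' : ∀ u ∈ e, u ≠ z → c u ≠ i z := by
        intro u hu huz hcu
        exact q2 (mem_filter.mpr ⟨mem_filter.mpr ⟨he1, hze, hU⟩, u, hu, huz, hcu⟩)
      apply hinj
      intro u hu v hv huv
      have hu : u ∈ e := hu
      have hv : v ∈ e := hv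
      have hmem : ∀ w ∈ e, w ∉ U → w = z := by
        intro w hw hwU; by_contra hwz; exact hwU (hU (mem_erase.mpr ⟨hwz, hw⟩))
      beta_reduce at huv
      by_cases huU : u ∈ U <;> by_cases hvU : v ∈ U
      · simp only [huU, hvU, if_true] at huv
        exact h1 e he1 u hu v hv huU hvU huv
      · simp only [huU, hvU, if_true, if_false] at huv
        have := hmem v hv hvU
        subst this
        exact absurd huv (hz' u hu (fun h => hvU (h ▸ huU)))
      · simp only [huU, hvU, if_true, if_false] at huv
        have := hmem u hu huU
        subst this
        exact absurd huv.symm (hz' v hv (fun h => huU (h ▸ hvU)))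
      · rw [hmem u hu huU, hmem v hv hvU]
    have : ((badE H (fun v => if v ∈ U then c v else i v) z).card : ℝ) ≤
      ((H.edges.filter (fun e => z ∈ e ∧ ∃ v ∈ H.verts \ U, v ≠ z ∧ v ∈ e)).card : ℝ) + (zEi H c U z (i z)).card := by
      exact_mod_cast (card_le_card hsub).trans (card_union_le _ _)
    have h5 := hout z
    have h6 := (hi z hz).2
    nlinarith
  · intro z hz
    set R := (H.edges.filter (fun e => z ∈ e ∧ e.erase z ∈ rb c (U \ cls U c (i z)) (r-1))) with hR
    have hsub : H.edges.filter (fun e => z ∈ e) ⊆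
        (H.edges.filter (fun e => z ∈ e ∧ ∃ v ∈ H.verts \ U, v ≠ z ∧ v ∈ e)) ∪ zEi H c U z (i z) ∪ R := by
      intro e he
      obtain ⟨he1, hze⟩ := mem_filter.mp he
      rw [mem_union, mem_union]
      by_cases q1 : ∃ v ∈ H.verts \ U, v ≠ z ∧ v ∈ e
      · exact Or.inl (Or.inl (mem_filter.mpr ⟨he1, hze, q1⟩))
      have hU := hin z e he1 q1
      by_cases q2 : ∃ u ∈ e, u ≠ z ∧ c u = i z
      · exact Or.inl (Or.inr (mem_filter.mpr ⟨mem_filter.mpr ⟨he1, hze, hU⟩, q2⟩))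
      right
      refine mem_filter.mpr ⟨he1, hze, mem_rb.mpr ⟨?_, ?_, ?_⟩⟩
      · intro u hu
        rw [Finset.mem_sdiff, mem_cls]
        obtain ⟨hu1, hu2⟩ := mem_erase.mp hu
        exact ⟨hU hu, fun h => q2 ⟨u, hu2, hu1, h.2⟩⟩
      · rw [card_erase_of_mem hze, H.edges_card e he1]
      · intro u hu v hv huv
        exact h1 e he1 u (mem_erase.mp hu).2 v (mem_erase.mp hv).2 (hU hu) (hU hv) huv
    have hRc : R.card ≤ (rb c (U \ cls U c (i z)) (r-1)).card := by
      apply card_le_card_of_injOn (fun e => e.erase z)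
      · intro e he; exact (mem_filter.mp he).2.2
      · intro e he f hf h
        have h : e.erase z = f.erase z := h
        rw [← insert_erase (mem_filter.mp he).2.1, h, insert_erase (mem_filter.mp hf).2.1]
    have h7 : (R.card : ℝ) ≤ (r * pc r ℓ + ε / 3) * n ^ (r-1) := by
      have : (R.card : ℝ) ≤ (rb c (U \ cls U c (i z)) (r-1)).card := by exact_mod_cast hRc
      exact this.trans (h3 (i z) (hi z hz).1)
    have : (H.deg z : ℝ) ≤
      ((H.edges.filter (fun e => z ∈ e ∧ ∃ v ∈ H.verts \ U, v ≠ z ∧ v ∈ e)).card : ℝ) + (zEi H c U z (i z)).card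
       + R.card := by
      have := (card_le_card hsub).trans ((card_union_le _ _).trans (Nat.add_le_add_right (card_union_le _ _) _))
      rw [HGraph.deg]
      exact_mod_cast this
    have h5 := hout z
    have h6 := (hi z hz).2
    nlinarith

theorem bonf (r : ℕ) (x : ℝ) (h0 : 0 ≤ x) (h1 : x ≤ 1) : (1 - x) ^ r ≤ 1 - r * x + r ^ 2 * x ^ 2 := by
  induction r with
  | zero => simp
  | succ k ih =>
    have h2 : (1 - x) ^ (k+1) ≤ (1 - k * x + k ^ 2 * x ^ 2) * (1 - x) := by
      rw [pow_succ]; exact mul_le_mul_of_nonneg_right ih (by linarith)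
    refine h2.trans ?_
    push_cast
    have : 0 ≤ (k:ℝ) ^ 2 * x ^ 3 := by positivity
    have h4 : 0 ≤ ((k:ℝ) + 1) * x ^ 2 := by positivity
    nlinarith

theorem del_alg (r : ℕ) (hr : 1 ≤ r) (p x ζ η : ℝ) (hp : p ≤ 1) (h0 : 0 ≤ x) (h1 : x ≤ 1) (hp0 : 0 ≤ p)
    (hη : 0 < η) (hx : x ≤ η / (2 * r ^ 2))
    (h : p - ζ ≤ p * (1 - x) ^ r + x * (r * p - η)) : x ≤ 2 * ζ / η := by
  have hb := bonf r x h0 h1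
  have hr0 : (0:ℝ) < r := by exact_mod_cast hr
  rw [le_div_iff₀ (by positivity)] at hx
  rw [le_div_iff₀ hη]
  have h2 : p * (1 - x) ^ r ≤ p * (1 - r * x + r ^ 2 * x ^ 2) := mul_le_mul_of_nonneg_left hb hp0
  have h3 : p * (r ^ 2 * x ^ 2) ≤ r ^ 2 * x ^ 2 := mul_le_of_le_one_left (by positivity) hp
  have h4 : r ^ 2 * x ^ 2 * 2 ≤ η * x := by nlinarith
  nlinarith

/-- deletion of a set of low degree vertices -/
theorem del_real (ℓ : ℕ) (hr : 2 ≤ r) (hrl : r ≤ ℓ) (H : HGraph r) (Z : Finset ℕ) (hZ : Z ⊆ H.verts)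
    (ζ η : ℝ) (hη : 0 < η) (hn : 0 < H.verts.card)
    (he : (pc r ℓ - ζ) * (H.verts.card : ℝ) ^ r ≤ H.edges.card)
    (hd : ∀ z ∈ Z, (H.deg z : ℝ) ≤ (r * pc r ℓ - η) * (H.verts.card : ℝ) ^ (r-1))
    (hrem : ((H.induce (H.verts \ Z)).edges.card : ℝ) ≤ pc r ℓ * ((H.verts.card : ℝ) - Z.card) ^ r)
    (hx : (Z.card : ℝ) / H.verts.card ≤ η / (2 * r ^ 2)) :
    (Z.card : ℝ) ≤ 2 * ζ / η * H.verts.card := by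
  set n : ℝ := (H.verts.card : ℝ) with hn'
  have hn0 : 0 < n := by rw [hn']; exact_mod_cast hn
  have hZn : (Z.card : ℝ) ≤ n := by rw [hn']; exact_mod_cast card_le_card hZ
  rw [← div_le_iff₀ hn0]
  apply del_alg r (by omega) (pc r ℓ) _ ζ η _ (by positivity) ((div_le_one hn0).mpr hZn) (pc_nonneg _ _) hη hx
  · have h1 := card_remove H Z
    have h2 : (H.edges.card : ℝ) ≤ (H.induce (H.verts \ Z)).edges.card + ∑ x ∈ Z, (H.deg x : ℝ) := by
      exact_mod_cast h1
    have h3 : ∑ x ∈ Z, (H.deg x : ℝ) ≤ Z.card * ((r * pc r ℓ - η) * n ^ (r-1)) := by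
      rw [← nsmul_eq_mul]; exact sum_le_card_nsmul _ _ _ hd
    have hpow : n ^ r = n * n ^ (r-1) := by rw [← pow_succ']; congr 1; omega
    have h4 : (n - Z.card) ^ r = n ^ r * (1 - Z.card / n) ^ r := by
      rw [← mul_pow]; congr 1; field_simp
    have h5 : (Z.card : ℝ) * ((r * pc r ℓ - η) * n ^ (r-1)) = n ^ r * (Z.card / n * (r * pc r ℓ - η)) := by
      rw [hpow]; field_simp
    have h6 : n ^ r * (pc r ℓ - ζ) ≤ n ^ r * (pc r ℓ * (1 - Z.card / n) ^ r + Z.card / n * (r * pc r ℓ - η)) := by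
      rw [h4] at hrem; rw [h5] at h3
      nlinarith
    exact le_of_mul_le_mul_left h6 (by positivity)
  · have := pc_le_one r ℓ hr hrl
    have h2 : (2:ℝ) ≤ r := by exact_mod_cast hr
    have := pc_nonneg r ℓ
    nlinarith

/-- rainbow subgraph -/
noncomputable def rainG (H : HGraph r) (c : ℕ → ℕ) : HGraph r where
  verts := H.verts
  edges := H.edges.filter (fun e => Set.InjOn c (e : Set ℕ))
  edges_sub := fun e he => H.edges_sub e (mem_filter.mp he).1
  edges_card := fun e he => H.edges_card e (mem_filter.mp he).1

theorem rain_induce_le (ℓ : ℕ) (hr : 2 ≤ r) (hrl : r ≤ ℓ) (H : HGraph r) (c : ℕ → ℕ)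
    (hc : ∀ v ∈ H.verts, c v < ℓ) (Z : Finset ℕ) (hZ : Z ⊆ H.verts)
    (hH : ∀ e ∈ H.edges, e ⊆ H.verts \ Z → Set.InjOn c (e : Set ℕ)) :
    ((H.induce (H.verts \ Z)).edges.card : ℝ) ≤ pc r ℓ * ((H.verts.card : ℝ) - Z.card) ^ r := by
  have h1 : (H.induce (H.verts \ Z)).edges ⊆ rb c (H.verts \ Z) r := by
    intro e he
    rw [mem_induce] at he
    exact mem_rb.mpr ⟨he.2, H.edges_card e he.1, hH e he.1 he.2⟩
  have h2 := rb_card_le r ℓ hr (by omega) c (H.verts \ Z) (range ℓ) (card_range _)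
    (fun v hv => mem_range.mpr (hc v (Finset.mem_sdiff.mp hv).1))
  have h3 : ((H.verts \ Z).card : ℝ) = (H.verts.card : ℝ) - Z.card := by
    have := card_sdiff_add_card_eq_card hZ
    have : ((H.verts \ Z).card : ℝ) + Z.card = H.verts.card := by exact_mod_cast this
    linarith
  rw [h3] at h2
  have h4 : ((H.induce (H.verts \ Z)).edges.card : ℝ) ≤ (rb c (H.verts \ Z) r).card := by
    exact_mod_cast card_le_card h1
  exact h4.trans h2

/-- few vertices of low crossing degree -/
theorem low_set (ℓ : ℕ) (hr : 2 ≤ r) (hrl : r ≤ ℓ) (H : HGraph r) (c : ℕ → ℕ)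
    (hc : ∀ v ∈ H.verts, c v < ℓ) (ζ η x0 : ℝ) (hη : 0 < η) (hx0 : 2 * x0 ≤ η / (2 * r ^ 2)) 
    (hζ : 2 * ζ / η < x0) (hx0p : 0 < x0)
    (he : (pc r ℓ - ζ) * (H.verts.card : ℝ) ^ r ≤ (rainG H c).edges.card)
    (hn : 1 ≤ x0 * H.verts.card) :
    ((H.verts.filter (fun z => ((rainG H c).deg z : ℝ) ≤ (r * pc r ℓ - η) * (H.verts.card : ℝ) ^ (r-1))).card : ℝ)
      ≤ x0 * H.verts.card := by
  by_contra hcon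
  push Not at hcon
  set Z := H.verts.filter (fun z => ((rainG H c).deg z : ℝ) ≤ (r * pc r ℓ - η) * (H.verts.card : ℝ) ^ (r-1)) with hZ
  have hn0 : 0 < H.verts.card := by
    by_contra h
    have : H.verts.card = 0 := by omega
    rw [this] at hn; norm_num at hn
  have hk : ⌈x0 * H.verts.card⌉₊ ≤ Z.card := Nat.ceil_le.mpr hcon.le
  obtain ⟨Z', hZ', hZc⟩ := exists_subset_card_eq hk
  have h1 := Nat.le_ceil (x0 * H.verts.card)
  have h2 := Nat.ceil_lt_add_one (show 0 ≤ x0 * H.verts.card by positivity)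
  have hsub : Z' ⊆ H.verts := hZ'.trans (filter_subset _ _)
  have hn0' : (0:ℝ) < H.verts.card := by exact_mod_cast hn0
  have := del_real ℓ hr hrl (rainG H c) Z' hsub ζ η hη hn0 he
    (fun z hz => (mem_filter.mp (hZ' hz)).2)
    (rain_induce_le ℓ hr hrl (rainG H c) c hc Z' hsub (fun e he _ => (mem_filter.mp he).2))
    (by
      change (Z'.card : ℝ) / H.verts.card ≤ _
      refine le_trans ?_ hx0
      rw [div_le_iff₀ hn0', hZc]
      linarith)
  change (Z'.card : ℝ) ≤ 2 * ζ / η * H.verts.card at this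
  rw [hZc] at this
  have h3 : 2 * ζ / η * H.verts.card < x0 * H.verts.card := mul_lt_mul_of_pos_right hζ hn0'
  linarith

theorem rain_card (H : HGraph r) (c : ℕ → ℕ) : (rainG H c).edges.card + (badT H c).card = H.edges.card :=
  card_filter_add_card_filter_not _

theorem rain_deg (H : HGraph r) (c : ℕ → ℕ) (z : ℕ) : (rainG H c).deg z + (badE H c z).card = H.deg z := by
  rw [HGraph.deg, HGraph.deg, badE, rainG]
  rw [← card_filter_add_card_filter_not (s := H.edges.filter (fun e => z ∈ e)) (fun e => Set.InjOn c (e : Set ℕ))]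
  rw [filter_filter, filter_filter, filter_filter]
  congr 2
  ext e; simp only [mem_filter]; tauto

theorem cdeg_ge (hr : 2 ≤ r) (H : HGraph r) (c : ℕ → ℕ) (Z : Finset ℕ) (x : ℝ) 
    (hZ : (Z.card : ℝ) ≤ x * H.verts.card) (u : ℕ) (hu : u ∉ Z) :
    ((rainG H c).deg u : ℝ) - x * (H.verts.card : ℝ) ^ (r-1) ≤ cdeg H c (H.verts \ Z) u := by
  have h1 := card_meet hr H Z u x hZ
  have h2 : (rainG H c).deg u ≤ cdeg H c (H.verts \ Z) u + (H.edges.filter (fun e => u ∈ e ∧ ∃ v ∈ Z, v ≠ u ∧ v ∈ e)).card := by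
    rw [cdeg]
    refine le_trans (card_le_card ?_) (card_union_le _ _)
    intro e he
    obtain ⟨h3, h4⟩ := mem_filter.mp he
    obtain ⟨h5, h6⟩ := mem_filter.mp h3
    rw [mem_union]
    by_cases h7 : ∃ v ∈ Z, v ≠ u ∧ v ∈ e
    · exact Or.inr (mem_filter.mpr ⟨h5, h4, h7⟩)
    · refine Or.inl (mem_filter.mpr ⟨h5, h4, ?_, h6⟩)
      intro v hv
      refine Finset.mem_sdiff.mpr ⟨H.edges_sub e h5 hv, fun hvZ => ?_⟩
      exact h7 ⟨v, hvZ, fun h => hu (h ▸ hvZ), hv⟩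
  have h3 : ((rainG H c).deg u : ℝ) ≤ cdeg H c (H.verts \ Z) u + ((H.edges.filter (fun e => u ∈ e ∧ ∃ v ∈ Z, v ≠ u ∧ v ∈ e)).card : ℝ) := by
    exact_mod_cast h2
  linarith

theorem stab1 (ℓ : ℕ) (hr : 2 ≤ r) (hrl : r ≤ ℓ) (F : HGraph r) (hF : F.verts.card = ℓ + 1)
    (hb : CondB ℓ F) (ε : ℝ) (hε : 0 < ε) : ∃ ζ : ℝ, 0 < ζ ∧ ∃ N : ℕ,
      ∀ (H : HGraph r) (c : ℕ → ℕ), N ≤ H.verts.card → ¬ F.expansion.IsCopyIn H →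
      (∀ v ∈ H.verts, c v < ℓ) → (pc r ℓ - ζ) * (H.verts.card : ℝ) ^ r ≤ H.edges.card → 
      ((badT H c).card : ℝ) ≤ ζ * (H.verts.card : ℝ) ^ r → ∃ c', Nice ℓ H c' ε := by
  obtain ⟨η, hη, N, hN⟩ := rec_nice ℓ hr hrl F hF hb ε hε
  have hr0 : (0:ℝ) < r := by exact_mod_cast (by omega : 0 < r)
  set x0 : ℝ := min (η / 2) (η / 2 / (4 * r ^ 2)) with hx0
  have hx0p : 0 < x0 := by positivity
  have hx1 : x0 ≤ η / 2 := min_le_left _ _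
  have hx2 : 2 * x0 ≤ (η / 2) / (2 * r ^ 2) := by
    have : x0 ≤ η / 2 / (4 * r ^ 2) := min_le_right _ _
    calc 2 * x0 ≤ 2 * (η / 2 / (4 * r ^ 2)) := by linarith
      _ = _ := by field_simp; norm_num
  refine ⟨x0 * η / 16, by positivity, N + ⌈1 / x0⌉₊, ?_⟩
  intro H c hn hfree hc he hbad
  have hnx : 1 ≤ x0 * H.verts.card := by
    have h1 := Nat.le_ceil (1 / x0)
    have h2 : ((⌈1 / x0⌉₊ : ℕ) : ℝ) ≤ H.verts.card := by exact_mod_cast (by omega : ⌈1 / x0⌉₊ ≤ H.verts.card)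
    have h3 := h1.trans h2
    rw [div_le_iff₀ hx0p] at h3
    linarith
  have he' : (pc r ℓ - x0 * η / 8) * (H.verts.card : ℝ) ^ r ≤ (rainG H c).edges.card := by
    have h1 : ((rainG H c).edges.card : ℝ) + (badT H c).card = H.edges.card := by exact_mod_cast rain_card H c
    nlinarith
  have hlow := low_set ℓ hr hrl H c hc (x0 * η / 8) (η / 2) x0 (by positivity) hx2 (by
    have : 2 * (x0 * η / 8) / (η / 2) = x0 / 2 := by field_simp; norm_num
    rw [this]; linarith) hx0p he' hnx
  set Z := H.verts.filter (fun z => ((rainG H c).deg z : ℝ) ≤ (r * pc r ℓ - η / 2) * (H.verts.card : ℝ) ^ (r-1)) with hZ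
  refine hN H c (H.verts \ Z) ⟨sdiff_subset, hc, ?_, ?_⟩ (by omega) hfree
  · have : H.verts \ (H.verts \ Z) ⊆ Z := by
      intro v hv
      simp only [Finset.mem_sdiff, not_and, not_not] at hv
      exact hv.2 hv.1
    have h1 : ((H.verts \ (H.verts \ Z)).card : ℝ) ≤ Z.card := by exact_mod_cast card_le_card this
    have h2 : x0 * (H.verts.card : ℝ) ≤ η * H.verts.card := by gcongr; linarith
    linarith
  · intro u hu
    obtain ⟨hu1, hu2⟩ := Finset.mem_sdiff.mp hu
    have h1 := cdeg_ge hr H c Z x0 hlow u hu2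
    have h2 : (r * pc r ℓ - η / 2) * (H.verts.card : ℝ) ^ (r-1) < (rainG H c).deg u := by
      by_contra h
      exact hu2 (mem_filter.mpr ⟨hu1, not_lt.mp h⟩)
    have h3 : 0 ≤ (H.verts.card : ℝ) ^ (r-1) := by positivity
    nlinarith

end PartJ

section PartK
open Finset
open scoped Classical
variable {r : ℕ}

theorem nice_bad (ℓ : ℕ) (hr : 2 ≤ r) (H : HGraph r) (c : ℕ → ℕ) (ε : ℝ) (h : Nice ℓ H c ε) :
    ((badT H c).card : ℝ) ≤ ε * (H.verts.card : ℝ) ^ r := by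
  have hsub : badT H c ⊆ H.verts.biUnion (fun z => badE H c z) := by
    intro e he
    obtain ⟨h1, h2⟩ := mem_filter.mp he
    have : e.Nonempty := by
      rw [← card_pos, H.edges_card e h1]; omega
    obtain ⟨z, hz⟩ := this
    exact mem_biUnion.mpr ⟨z, H.edges_sub e h1 hz, mem_filter.mpr ⟨h1, hz, h2⟩⟩
  have h1 : ((badT H c).card : ℝ) ≤ ∑ z ∈ H.verts, ((badE H c z).card : ℝ) := by
    exact_mod_cast (card_le_card hsub).trans card_biUnion_le
  have h2 : ∑ z ∈ H.verts, ((badE H c z).card : ℝ) ≤ H.verts.card * (ε * (H.verts.card : ℝ) ^ (r-1)) := by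
    rw [← nsmul_eq_mul]; exact sum_le_card_nsmul _ _ _ h.bad
  have hpow : (H.verts.card : ℝ) ^ r = H.verts.card * (H.verts.card : ℝ) ^ (r-1) := by
    rw [← pow_succ']; congr 1; omega
  rw [hpow]; linarith

/-- self-improvement of colourings -/
theorem self_improve (ℓ : ℕ) (hr : 2 ≤ r) (hrl : r ≤ ℓ) (F : HGraph r) (hF : F.verts.card = ℓ + 1)
    (hb : CondB ℓ F) : ∃ ω : ℝ, 0 < ω ∧ ∀ η : ℝ, 0 < η → ∃ ζ : ℝ, 0 < ζ ∧ ∃ N : ℕ,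
      ∀ (H : HGraph r) (c : ℕ → ℕ), N ≤ H.verts.card → ¬ F.expansion.IsCopyIn H →
      (∀ v ∈ H.verts, c v < ℓ) → (pc r ℓ - ζ) * (H.verts.card : ℝ) ^ r ≤ H.edges.card → 
      ((badT H c).card : ℝ) ≤ ω * (H.verts.card : ℝ) ^ r → ∃ c' : ℕ → ℕ, (∀ v ∈ H.verts, c' v < ℓ) ∧ 
        ((badT H c').card : ℝ) ≤ η * (H.verts.card : ℝ) ^ r := by
  obtain ⟨η0, hη0, N0, hcore⟩ := core ℓ hr hrl F hF hb 1 one_pos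
  have hr0 : (0:ℝ) < r := by exact_mod_cast (by omega : 0 < r)
  obtain ⟨η1, hη1, hη1'⟩ : ∃ η1 : ℝ, 0 < η1 ∧ η1 = η0 / 4 := ⟨_, by positivity, rfl⟩
  set x0 : ℝ := min (η0 / 4) (η1 / (4 * r ^ 2)) with hx0
  have hx0p : 0 < x0 := by positivity
  have hx1 : x0 ≤ η0 / 4 := min_le_left _ _
  have hx2 : x0 ≤ η1 / (4 * r ^ 2) := min_le_right _ _
  have hx2' : 2 * x0 ≤ η1 / (2 * r ^ 2) := by
    calc 2 * x0 ≤ 2 * (η1 / (4 * r ^ 2)) := by linarith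
      _ = _ := by field_simp; norm_num
  obtain ⟨ε, hε, hε1, hε2⟩ : ∃ ε : ℝ, 0 < ε ∧ ε ≤ x0 * η1 / 8 ∧ ε ≤ η0 / 4 :=
    ⟨min (x0 * η1 / 8) (η0 / 4), by positivity, min_le_left _ _, min_le_right _ _⟩
  obtain ⟨ω, hω, N1, hst⟩ := stab1 ℓ hr hrl F hF hb ε hε
  refine ⟨ω, hω, fun η hη => ?_⟩
  obtain ⟨ζ, hζ, hζ1, hζ2, hζ3⟩ : ∃ ζ : ℝ, 0 < ζ ∧ ζ ≤ ω ∧ ζ ≤ x0 * η1 / 8 ∧ ζ ≤ η * η1 / 2 :=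
    ⟨min ω (min (x0 * η1 / 8) (η * η1 / 2)), by positivity, min_le_left _ _,
      (min_le_right _ _).trans (min_le_left _ _), (min_le_right _ _).trans (min_le_right _ _)⟩
  refine ⟨ζ, hζ, N0 + N1 + ⌈1 / x0⌉₊ + 1, ?_⟩
  intro H c hn hfree hc he hbad
  have hn0 : 0 < H.verts.card := by omega
  have hnpos : (0:ℝ) < H.verts.card := by exact_mod_cast hn0
  have hnx : 1 ≤ x0 * H.verts.card := by
    have h1 := Nat.le_ceil (1 / x0)
    have h2 : ((⌈1 / x0⌉₊ : ℕ) : ℝ) ≤ H.verts.card := by exact_mod_cast (by omega : ⌈1 / x0⌉₊ ≤ H.verts.card)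
    have h3 := h1.trans h2
    rw [div_le_iff₀ hx0p] at h3
    linarith
  have hPp : 0 < (H.verts.card : ℝ) ^ r := by positivity
  have hQp : 0 < (H.verts.card : ℝ) ^ (r-1) := by positivity
  obtain ⟨c', hnice⟩ := hst H c (by omega) hfree hc (by nlinarith) hbad
  refine ⟨c', hnice.col, ?_⟩
  have hbt := nice_bad ℓ hr H c' ε hnice
  have he' : (pc r ℓ - x0 * η1 / 4) * (H.verts.card : ℝ) ^ r ≤ (rainG H c').edges.card := by
    have h1 : ((rainG H c').edges.card : ℝ) + (badT H c').card = H.edges.card := by exact_mod_cast rain_card H c'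
    nlinarith
  have hlow := low_set ℓ hr hrl H c' hnice.col (x0 * η1 / 4) η1 x0 hη1 hx2' (by
    have : 2 * (x0 * η1 / 4) / η1 = x0 / 2 := by field_simp; norm_num
    rw [this]; linarith) hx0p he' hnx
  set Z := H.verts.filter (fun z => (H.deg z : ℝ) ≤ (r * pc r ℓ - η1) * (H.verts.card : ℝ) ^ (r-1)) with hZ
  have hZlow : (Z.card : ℝ) ≤ x0 * H.verts.card := by
    refine le_trans ?_ hlow
    have : Z.card ≤ _ := card_le_card (monotone_filter_right H.verts (q := fun z => ((rainG H c').deg z : ℝ) ≤ (r * pc r ℓ - η1) * (H.verts.card : ℝ) ^ (r-1)) ?_)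
    · exact_mod_cast this
    · intro z hz1 hz
      have h1 : (rainG H c').deg z ≤ H.deg z := by have := rain_deg H c' z; omega
      have h1' : ((rainG H c').deg z : ℝ) ≤ H.deg z := by exact_mod_cast h1
      linarith
  have hZs : Z ⊆ H.verts := filter_subset _ _
  have hG : Good ℓ H c' (H.verts \ Z) η0 := by
    refine ⟨sdiff_subset, hnice.col, ?_, ?_⟩
    · have : H.verts \ (H.verts \ Z) ⊆ Z := by
        intro v hv
        simp only [Finset.mem_sdiff, not_and, not_not] at hv
        exact hv.2 hv.1
      have h1 : ((H.verts \ (H.verts \ Z)).card : ℝ) ≤ Z.card := by exact_mod_cast card_le_card this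
      have h2 : x0 * (H.verts.card : ℝ) ≤ η0 * H.verts.card := by gcongr; linarith
      linarith
    · intro u hu
      obtain ⟨hu1, hu2⟩ := Finset.mem_sdiff.mp hu
      have h1 := cdeg_ge hr H c' Z x0 hZlow u hu2
      have h2 : (r * pc r ℓ - η1) * (H.verts.card : ℝ) ^ (r-1) < H.deg u := by
        by_contra h
        exact hu2 (mem_filter.mpr ⟨hu1, not_lt.mp h⟩)
      have h3 := hnice.bad u hu1
      have h4 : ((rainG H c').deg u : ℝ) + (badE H c' u).card = H.deg u := by exact_mod_cast rain_deg H c' u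
      nlinarith
  have hrain : ∀ e ∈ H.edges, e ⊆ H.verts \ Z → Set.InjOn c' (e : Set ℕ) := fun e he hs p hp p' hp' h =>
    (hcore H c' _ hG (by omega) hfree).1 e he p hp p' hp' (hs hp) (hs hp') h
  have hdel := del_real ℓ hr hrl H Z hZs ζ η1 hη1 hn0 he (fun z hz => (mem_filter.mp hz).2)
    (rain_induce_le ℓ hr hrl H c' hnice.col Z hZs hrain) (by
      rw [div_le_iff₀ hnpos]
      refine hZlow.trans ?_
      gcongr
      linarith)
  have hbs : badT H c' ⊆ Z.biUnion (fun z => H.edges.filter (fun e => z ∈ e)) := by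
    intro e he
    obtain ⟨h1, h2⟩ := mem_filter.mp he
    by_contra hcon
    apply h2
    apply hrain e h1
    intro v hv
    refine Finset.mem_sdiff.mpr ⟨H.edges_sub e h1 hv, fun hvZ => hcon ?_⟩
    exact mem_biUnion.mpr ⟨v, hvZ, mem_filter.mpr ⟨h1, hv⟩⟩
  have h5 : (badT H c').card ≤ Z.card * H.verts.card ^ (r-1) := by
    refine (card_le_card hbs).trans (card_biUnion_le.trans ?_)
    rw [← smul_eq_mul]
    exact sum_le_card_nsmul _ _ _ (fun z _ => deg_le H z)
  have h6 : ((badT H c').card : ℝ) ≤ Z.card * (H.verts.card : ℝ) ^ (r-1) := by exact_mod_cast h5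
  have h7 : 2 * ζ / η1 ≤ η := by rw [div_le_iff₀ hη1]; linarith
  have hpow : (H.verts.card : ℝ) ^ r = H.verts.card * (H.verts.card : ℝ) ^ (r-1) := by
    rw [← pow_succ']; congr 1; omega
  calc ((badT H c').card : ℝ) ≤ Z.card * (H.verts.card : ℝ) ^ (r-1) := h6
    _ ≤ (η * H.verts.card) * (H.verts.card : ℝ) ^ (r-1) := by
        gcongr
        exact hdel.trans (by gcongr)
    _ = _ := by rw [hpow]; ring

theorem edges_of_mindeg (H : HGraph r) (hr : 2 ≤ r) (p : ℝ) 
    (hd : ∀ v ∈ H.verts, (r * p) * (H.verts.card : ℝ) ^ (r-1) ≤ H.deg v) :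
    p * (H.verts.card : ℝ) ^ r ≤ H.edges.card := by
  have h1 : ∑ v ∈ H.verts, (H.deg v : ℝ) = r * H.edges.card := by exact_mod_cast handshake H
  have h2 := card_nsmul_le_sum H.verts (fun v => (H.deg v : ℝ)) _ hd
  rw [h1, nsmul_eq_mul] at h2
  have hpow : (H.verts.card : ℝ) ^ r = H.verts.card * (H.verts.card : ℝ) ^ (r-1) := by
    rw [← pow_succ']; congr 1; omega
  have hr0 : (0:ℝ) < r := by exact_mod_cast (by omega : 0 < r)
  rw [hpow]
  refine le_of_mul_le_mul_left ?_ hr0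
  linarith

theorem mindeg (ℓ : ℕ) (hr : 2 ≤ r) (hrl : r ≤ ℓ) (F : HGraph r) (hF : F.verts.card = ℓ + 1)
    (hb : CondB ℓ F) : ∃ ε : ℝ, 0 < ε ∧ ∃ ω : ℝ, 0 < ω ∧ ∃ N : ℕ,
      ∀ (H : HGraph r) (c : ℕ → ℕ), N ≤ H.verts.card → ¬ F.expansion.IsCopyIn H →
      (∀ v ∈ H.verts, c v < ℓ) → (∀ v ∈ H.verts, (r * pc r ℓ - ε) * (H.verts.card : ℝ) ^ (r-1) ≤ H.deg v) → 
      ((badT H c).card : ℝ) ≤ ω * (H.verts.card : ℝ) ^ r → IsKlSub r ℓ H := by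
  obtain ⟨η0, hη0, N0, hcore⟩ := core ℓ hr hrl F hF hb 1 one_pos
  obtain ⟨ω, hω, N1, hst⟩ := stab1 ℓ hr hrl F hF hb (η0 / 2) (by positivity)
  refine ⟨min (η0 / 2) ω, by positivity, ω, hω, N0 + N1, ?_⟩
  intro H c hn hfree hc hd hbad
  have hr1 : (1:ℝ) ≤ r := by exact_mod_cast (by omega : 1 ≤ r)
  have hQp : 0 ≤ (H.verts.card : ℝ) ^ (r-1) := by positivity
  have e1 : min (η0/2) ω ≤ η0 / 2 := min_le_left _ _
  have e2 : min (η0/2) ω ≤ ω := min_le_right _ _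
  have he := edges_of_mindeg H hr (pc r ℓ - ω) (fun v hv => by
    refine le_trans ?_ (hd v hv)
    gcongr
    nlinarith)
  obtain ⟨c', hnice⟩ := hst H c (by omega) hfree hc he hbad
  have hG : Good ℓ H c' H.verts η0 := by
    refine ⟨subset_rfl, hnice.col, by simp; positivity, ?_⟩
    intro u hu
    have h1 := cdeg_ge hr H c' ∅ 0 (by simp) u (by simp)
    rw [sdiff_empty] at h1
    have h2 := hd u hu
    have h3 := hnice.bad u hu
    have h4 : ((rainG H c').deg u : ℝ) + (badE H c' u).card = H.deg u := by exact_mod_cast rain_deg H c' u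
    nlinarith
  exact ⟨c', hnice.col, fun e he u hu v hv h => (hcore H c' _ hG (by omega) hfree).1 e he u hu v hv
    (H.edges_sub e he hu) (H.edges_sub e he hv) h⟩

end PartK

section PartL
open Finset
open scoped Classical
variable {r : ℕ}

/-- the link of a vertex -/
noncomputable def lk (H : HGraph r) (x : ℕ) : Finset (Finset ℕ) :=
  (H.edges.filter (fun e => x ∈ e)).image (fun e => e.erase x)

theorem mem_lk (H : HGraph r) (x : ℕ) (A : Finset ℕ) : A ∈ lk H x ↔ x ∉ A ∧ insert x A ∈ H.edges := by
  rw [lk, mem_image]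
  constructor
  · rintro ⟨e, he, rfl⟩
    obtain ⟨h1, h2⟩ := mem_filter.mp he
    exact ⟨notMem_erase _ _, by rw [insert_erase h2]; exact h1⟩
  · rintro ⟨h1, h2⟩
    exact ⟨insert x A, mem_filter.mpr ⟨h2, mem_insert_self _ _⟩, erase_insert h1⟩

theorem lk_card (H : HGraph r) (x : ℕ) : (lk H x).card = H.deg x := by
  rw [lk, card_image_of_injOn]
  · rfl
  · intro e he f hf h
    have h1 := (mem_filter.mp he).2
    have h2 := (mem_filter.mp hf).2
    beta_reduce at h
    rw [← insert_erase h1, ← insert_erase h2, h]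

def Unc (H : HGraph r) (u v : ℕ) : Prop := ∀ e ∈ H.edges, u ∈ e → v ∉ e

theorem unc_lk {H : HGraph r} {u v : ℕ} (huv : u ≠ v) (h : Unc H u v) (A : Finset ℕ) (hA : A ∈ lk H u) : v ∉ A := by
  rw [mem_lk] at hA
  intro hv
  exact h _ hA.2 (mem_insert_self _ _) (mem_insert_of_mem hv)

/-- replace `v` by a clone of `u` -/
noncomputable def clone (H : HGraph r) (u v : ℕ) (huv : u ≠ v) (hv : v ∈ H.verts) (h : Unc H u v) : HGraph r where
  verts := H.verts
  edges := H.edges.filter (fun e => v ∉ e) ∪ (lk H u).image (fun A => insert v A)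
  edges_sub := by
    intro e he
    rcases mem_union.mp he with he | he
    · exact H.edges_sub e (mem_filter.mp he).1
    · obtain ⟨A, hA, rfl⟩ := mem_image.mp he
      refine insert_subset hv ?_
      exact (subset_insert u A).trans (H.edges_sub _ ((mem_lk _ _ _).mp hA).2)
  edges_card := by
    intro e he
    rcases mem_union.mp he with he | he
    · exact H.edges_card e (mem_filter.mp he).1
    · obtain ⟨A, hA, rfl⟩ := mem_image.mp he
      have h1 := (mem_lk _ _ _).mp hA
      have h2 := H.edges_card _ h1.2
      rw [card_insert_of_notMem h1.1] at h2
      rw [card_insert_of_notMem (unc_lk huv h A hA)]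
      exact h2

section cl
variable (H : HGraph r) (u v : ℕ) (huv : u ≠ v) (hv : v ∈ H.verts) (h : Unc H u v)

theorem mem_clone (e : Finset ℕ) : e ∈ (clone H u v huv hv h).edges ↔
    (v ∉ e ∧ e ∈ H.edges) ∨ (v ∈ e ∧ e.erase v ∈ lk H u) := by
  show e ∈ H.edges.filter (fun e => v ∉ e) ∪ (lk H u).image (fun A => insert v A) ↔ _
  rw [mem_union, mem_filter, mem_image]
  constructor
  · rintro (h1 | ⟨A, hA, rfl⟩)
    · exact Or.inl ⟨h1.2, h1.1⟩
    · exact Or.inr ⟨mem_insert_self _ _, by rw [erase_insert (unc_lk huv h A hA)]; exact hA⟩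
  · rintro (h1 | h1)
    · exact Or.inl ⟨h1.2, h1.1⟩
    · exact Or.inr ⟨_, h1.2, insert_erase h1.1⟩

theorem clone_card : (clone H u v huv hv h).edges.card + H.deg v = H.edges.card + H.deg u := by
  show (H.edges.filter (fun e => v ∉ e) ∪ (lk H u).image (fun A => insert v A)).card + _ = _
  rw [card_union_of_disjoint, card_image_of_injOn, lk_card]
  · have := card_filter_add_card_filter_not (s := H.edges) (fun e => v ∈ e)
    rw [HGraph.deg.eq_def H v]
    omega
  · intro A hA B hB hAB
    beta_reduce at hAB
    rw [← erase_insert (unc_lk huv h A hA), ← erase_insert (unc_lk huv h B hB), hAB]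
  · rw [disjoint_left]
    intro e he he'
    obtain ⟨A, hA, rfl⟩ := mem_image.mp he'
    exact (mem_filter.mp he).2 (mem_insert_self _ _)

theorem clone_lk_v : lk (clone H u v huv hv h) v = lk H u := by
  ext A
  rw [mem_lk, mem_clone]
  constructor
  · rintro ⟨h1, h2 | h2⟩
    · exact absurd (mem_insert_self _ _) h2.1
    · rw [erase_insert h1] at h2; exact h2.2
  · intro hA
    have := unc_lk huv h A hA
    exact ⟨this, Or.inr ⟨mem_insert_self _ _, by rwa [erase_insert this]⟩⟩

theorem clone_lk (x : ℕ) (hx : x ≠ v) (A : Finset ℕ) : A ∈ lk (clone H u v huv hv h) x ↔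
    (v ∉ A ∧ A ∈ lk H x) ∨ (v ∈ A ∧ u ∉ A ∧ insert u (A.erase v) ∈ lk H x) := by
  rw [mem_lk, mem_clone, mem_lk, mem_lk, mem_lk]
  by_cases hvA : v ∈ A
  · have h1 : v ∈ insert x A := mem_insert_of_mem hvA
    have h2 : (insert x A).erase v = insert x (A.erase v) := erase_insert_of_ne hx
    simp only [hvA, h1, h2, not_true, false_and, true_and, false_or]
    rw [insert_comm u x]
    simp only [mem_insert, mem_erase, not_or, not_and]
    constructor
    · rintro ⟨a, ⟨b, b'⟩, c⟩
      exact ⟨b' huv, ⟨fun hh => b hh.symm, fun _ => a⟩, c⟩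
    · rintro ⟨a, ⟨b, b'⟩, c⟩
      exact ⟨b' hx, ⟨fun hh => b hh.symm, fun _ => a⟩, c⟩
  · have h1 : v ∉ insert x A := by
      rw [mem_insert, not_or]; exact ⟨hx.symm, hvA⟩
    simp only [hvA, h1, not_false_iff, true_and, false_and, or_false]

theorem clone_lk_eq (x y : ℕ) (hx : x ≠ v) (hy : y ≠ v) (hxy : lk H x = lk H y) :
    lk (clone H u v huv hv h) x = lk (clone H u v huv hv h) y := by
  ext A
  rw [clone_lk _ _ _ _ _ _ _ hx, clone_lk _ _ _ _ _ _ _ hy, hxy]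

theorem clone_lk_u : lk (clone H u v huv hv h) u = lk H u := by
  ext A
  rw [clone_lk _ _ _ _ _ _ _ huv]
  constructor
  · rintro (h1 | h1)
    · exact h1.2
    · exact absurd (mem_insert_self _ _) ((mem_lk _ _ _).mp h1.2.2).1
  · intro hA
    exact Or.inl ⟨unc_lk huv h A hA, hA⟩

theorem clone_free (F : HGraph r) (hK : KFree F H) (hu : u ∈ H.verts) : KFree F (clone H u v huv hv h) := by
  rintro ⟨g, ⟨g1, g2, g3⟩, gc⟩
  apply hK
  set φ : ℕ → ℕ := fun x => if x = v then u else x with hφ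
  have key : ∀ e ∈ (clone H u v huv hv h).edges, e.image φ ∈ H.edges := by
    intro e he
    rcases (mem_clone _ _ _ _ _ _ _).mp he with h1 | h1
    · have : e.image φ = e := by
        conv_rhs => rw [← image_id (s := e)]
        apply image_congr
        intro x hx
        have : x ≠ v := fun hh => h1.1 (hh ▸ hx)
        simp [hφ, this]
      rw [this]; exact h1.2
    · have : e.image φ = insert u (e.erase v) := by
        ext y
        simp only [mem_image, mem_insert, mem_erase, hφ]
        constructor
        · rintro ⟨x, hx, rfl⟩
          split_ifs with hh
          · exact Or.inl rfl
          · exact Or.inr ⟨hh, hx⟩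
        · rintro (rfl | ⟨h2, h3⟩)
          · exact ⟨v, h1.1, by simp⟩
          · exact ⟨y, h3, by simp [h2]⟩
      rw [this]; exact ((mem_lk _ _ _).mp h1.2).2
  have nouv : ∀ e ∈ (clone H u v huv hv h).edges, u ∈ e → v ∈ e → False := by
    intro e he hu1 hv1
    rcases (mem_clone _ _ _ _ _ _ _).mp he with h1 | h1
    · exact h1.1 hv1
    · exact ((mem_lk _ _ _).mp h1.2).1 (mem_erase.mpr ⟨huv, hu1⟩)
  refine ⟨φ ∘ g, ⟨?_, ?_, ?_⟩, ?_⟩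
  · intro x hx y hy hxy
    by_contra hne
    obtain ⟨e, he, h1, h2⟩ := gc x hx y hy hne
    have hgne : g x ≠ g y := fun hh => hne (g1 hx hy hh)
    simp only [Function.comp, hφ] at hxy
    by_cases hxv : g x = v
    · by_cases hyv : g y = v
      · exact hgne (hxv.trans hyv.symm)
      · rw [if_pos hxv, if_neg hyv] at hxy
        exact nouv e he (hxy ▸ h2) (hxv ▸ h1)
    · by_cases hyv : g y = v
      · rw [if_neg hxv, if_pos hyv] at hxy
        exact nouv e he (hxy ▸ h1) (hyv ▸ h2)
      · rw [if_neg hxv, if_neg hyv] at hxy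
        exact hgne hxy
  · intro x hx
    have := g2 x hx
    simp only [Function.comp, hφ]
    split_ifs
    · exact hu
    · exact this
  · intro e he
    rw [← image_image]
    exact key _ (g3 e he)
  · intro x hx y hy hxy
    obtain ⟨e, he, h1, h2⟩ := gc x hx y hy hxy
    exact ⟨_, key e he, mem_image_of_mem φ h1, mem_image_of_mem φ h2⟩

theorem clone_bad (c : ℕ → ℕ) : (badT H c).card ≤ (badT (clone H u v huv hv h) c).card + H.verts.card ^ (r-1) := by
  have hsub : badT H c ⊆ badT (clone H u v huv hv h) c ∪ H.edges.filter (fun e => v ∈ e) := by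
    intro e he
    obtain ⟨h1, h2⟩ := mem_filter.mp he
    rw [mem_union]
    by_cases hve : v ∈ e
    · exact Or.inr (mem_filter.mpr ⟨h1, hve⟩)
    · exact Or.inl (mem_filter.mpr ⟨(mem_clone _ _ _ _ _ _ _).mpr (Or.inl ⟨hve, h1⟩), h2⟩)
  have h1 := (card_le_card hsub).trans (card_union_le _ _)
  have h2 : (H.edges.filter (fun e => v ∈ e)).card ≤ _ := deg_le H v
  omega

end cl

/-- number of ordered twin pairs -/
noncomputable def tp (H : HGraph r) : ℕ := ∑ x ∈ H.verts, ∑ y ∈ H.verts, if lk H x = lk H y then 1 else 0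

noncomputable def tw (H : HGraph r) (x : ℕ) : ℕ := (H.verts.filter (fun y => lk H y = lk H x)).card

theorem tp_split (H : HGraph r) (v : ℕ) (hv : v ∈ H.verts) : tp H = 
    (∑ x ∈ H.verts.erase v, ∑ y ∈ H.verts.erase v, if lk H x = lk H y then 1 else 0) + 
    2 * ((H.verts.erase v).filter (fun y => lk H y = lk H v)).card + 1 := by
  rw [tp]
  conv_lhs => rw [← insert_erase hv]
  rw [sum_insert (notMem_erase _ _), sum_insert (notMem_erase _ _)]
  simp_rw [sum_insert (notMem_erase v H.verts)]
  rw [sum_add_distrib, card_filter]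
  have : (∑ y ∈ H.verts.erase v, if lk H v = lk H y then 1 else 0) = 
      ∑ y ∈ H.verts.erase v, if lk H y = lk H v then 1 else 0 :=
    sum_congr rfl fun y _ => by simp only [eq_comm]
  rw [this, if_pos trivial]
  ring

theorem tp_le (H : HGraph r) : tp H ≤ H.verts.card ^ 2 := by
  rw [tp]
  calc _ ≤ ∑ x ∈ H.verts, ∑ y ∈ H.verts, 1 := by
        refine sum_le_sum fun x _ => sum_le_sum fun y _ => ?_
        split_ifs <;> simp
    _ = _ := by simp [sq]

theorem clone_tp (H : HGraph r) (u v : ℕ) (huv : u ≠ v) (hu : u ∈ H.verts) (hv : v ∈ H.verts) (h : Unc H u v)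
    (hne : lk H u ≠ lk H v) (htw : tw H v ≤ tw H u) : tp H < tp (clone H u v huv hv h) := by
  rw [tp_split H v hv, tp_split (clone H u v huv hv h) v hv]
  have hV : (clone H u v huv hv h).verts = H.verts := rfl
  rw [hV]
  have h1 : (∑ x ∈ H.verts.erase v, ∑ y ∈ H.verts.erase v, if lk H x = lk H y then 1 else 0) ≤
      ∑ x ∈ H.verts.erase v, ∑ y ∈ H.verts.erase v, 
        if lk (clone H u v huv hv h) x = lk (clone H u v huv hv h) y then 1 else 0 := by
    refine sum_le_sum fun x hx => sum_le_sum fun y hy => ?_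
    by_cases hxy : lk H x = lk H y
    · rw [if_pos hxy, if_pos (clone_lk_eq H u v huv hv h x y (mem_erase.mp hx).1 (mem_erase.mp hy).1 hxy)]
    · rw [if_neg hxy]; exact Nat.zero_le _
  have h2 : tw H u ≤ ((H.verts.erase v).filter (fun y => lk (clone H u v huv hv h) y = lk (clone H u v huv hv h) v)).card := by
    apply card_le_card
    intro y hy
    obtain ⟨hy1, hy2⟩ := mem_filter.mp hy
    have hyv : y ≠ v := by rintro rfl; exact hne hy2.symm
    refine mem_filter.mpr ⟨mem_erase.mpr ⟨hyv, hy1⟩, ?_⟩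
    rw [clone_lk_eq H u v huv hv h y u hyv huv hy2, clone_lk_u, clone_lk_v]
  have h3 : ((H.verts.erase v).filter (fun y => lk H y = lk H v)).card < tw H v := by
    apply card_lt_card
    rw [ssubset_iff_of_subset (filter_subset_filter _ (erase_subset _ _))]
    exact ⟨v, mem_filter.mpr ⟨hv, rfl⟩, fun hh => (mem_erase.mp (mem_filter.mp hh).1).1 rfl⟩
  omega

/-- symmetrized graphs are blowups -/
theorem twin_swap (H : HGraph r) (e : Finset ℕ) (x x' : ℕ) (hx : x ∈ e) (hx' : x' ∉ e) (hl : lk H x = lk H x') :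
    e ∈ H.edges ↔ insert x' (e.erase x) ∈ H.edges := by
  have h1 : e ∈ H.edges ↔ e.erase x ∈ lk H x := by
    rw [mem_lk, insert_erase hx]; simp
  have h2 : x' ∉ e.erase x := fun h => hx' (mem_of_mem_erase h)
  rw [h1, hl, mem_lk]
  simp [h2]

theorem rep_iff (H : HGraph r) (rep : ℕ → ℕ) (hrep : ∀ x ∈ H.verts, rep x ∈ H.verts ∧ lk H (rep x) = lk H x)
    (hrr : ∀ x ∈ H.verts, ∀ y ∈ H.verts, lk H x = lk H y → rep x = rep y) : ∀ k : ℕ, ∀ e : Finset ℕ, e ⊆ H.verts →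
    (e.filter (fun x => rep x ≠ x)).card = k → Set.InjOn (lk H) e → (e ∈ H.edges ↔ e.image rep ∈ H.edges) := by
  intro k
  induction k with
  | zero =>
    intro e he hk _
    rw [card_eq_zero, filter_eq_empty_iff] at hk
    have : e.image rep = e := by
      conv_rhs => rw [← image_id (s := e)]
      apply image_congr
      intro x hx
      have := hk hx
      simpa using this
    rw [this]
  | succ k ih =>
    intro e he hk hinj
    have : (e.filter (fun x => rep x ≠ x)).Nonempty := by rw [← card_pos]; omega
    obtain ⟨x, hx⟩ := this
    obtain ⟨hx1, hx2⟩ := mem_filter.mp hx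
    have hxV := he hx1
    have hr1 := hrep x hxV
    have hxe : rep x ∉ e := fun hh => hx2 (hinj hh hx1 hr1.2)
    have hrx : rep (rep x) = rep x := hrr _ hr1.1 _ hxV hr1.2
    rw [twin_swap H e x (rep x) hx1 hxe hr1.2.symm]
    have heq : (insert (rep x) (e.erase x)).image rep = e.image rep := by
      rw [image_insert, hrx]
      conv_rhs => rw [← insert_erase hx1, image_insert]
    rw [← heq]
    apply ih
    · exact insert_subset hr1.1 ((erase_subset _ _).trans he)
    · rw [filter_insert, if_neg (by simpa using hrx), filter_erase, card_erase_of_mem hx, hk]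
      rfl
    · intro a ha b hb hab
      rw [coe_insert, Set.mem_insert_iff, mem_coe] at ha hb
      rcases ha with rfl | ha <;> rcases hb with rfl | hb
      · rfl
      · exfalso
        have h3 := hinj hx1 (mem_of_mem_erase hb) (hr1.2.symm.trans hab)
        exact (mem_erase.mp hb).1 h3.symm
      · exfalso
        have h3 := hinj hx1 (mem_of_mem_erase ha) (hr1.2.symm.trans hab.symm)
        exact (mem_erase.mp ha).1 h3.symm
      · exact hinj (mem_of_mem_erase ha) (mem_of_mem_erase hb) hab

theorem symmetrized (ℓ : ℕ) (hr : 2 ≤ r) (F : HGraph r) (H : HGraph r) (hK : KFree F H)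
    (hs : ∀ u ∈ H.verts, ∀ v ∈ H.verts, u ≠ v → Unc H u v → lk H u = lk H v) (b : ℝ) 
    (ha : ∀ H : HGraph r, ¬ F.IsCopyIn H → ¬ IsKlSub r ℓ H → hgLagrangian r H ≤ b) :
    IsKlSub r ℓ H ∨ (r.factorial : ℝ) * H.edges.card ≤ b * (H.verts.card : ℝ) ^ r := by
  have hlinj : ∀ e ∈ H.edges, Set.InjOn (lk H) e := by
    intro e he x hx y hy hxy
    by_contra hne
    have h1 : e.erase x ∈ lk H y := by
      rw [← hxy, mem_lk, insert_erase hx]; exact ⟨notMem_erase _ _, he⟩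
    exact ((mem_lk _ _ _).mp h1).1 (mem_erase.mpr ⟨fun hh => hne hh.symm, hy⟩)
  obtain ⟨ρ, hρ⟩ : ∃ ρ : Finset (Finset ℕ) → ℕ, ∀ x ∈ H.verts, ρ (lk H x) ∈ H.verts ∧ lk H (ρ (lk H x)) = lk H x := by
    refine ⟨fun L => if h : ∃ y ∈ H.verts, lk H y = L then h.choose else 0, fun x hx => ?_⟩
    have h : ∃ y ∈ H.verts, lk H y = lk H x := ⟨x, hx, rfl⟩
    simp only [dif_pos h]
    exact h.choose_spec
  set rep : ℕ → ℕ := fun x => ρ (lk H x) with hrepdef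
  have hrr : ∀ x ∈ H.verts, ∀ y ∈ H.verts, lk H x = lk H y → rep x = rep y := by
    intro x _ y _ hxy
    simp only [hrepdef, hxy]
  have hrinv : ∀ x ∈ H.verts, ∀ y ∈ H.verts, rep x = rep y → lk H x = lk H y := by
    intro x hx y hy hxy
    rw [← (hρ x hx).2, ← (hρ y hy).2]
    exact congrArg (lk H) hxy
  have hiff := rep_iff H rep hρ hrr
  set W := H.induce (H.verts.image rep) with hW
  have hWe : ∀ e ∈ H.edges, e.image rep ∈ W.edges := by
    intro e he
    rw [hW, mem_induce]
    exact ⟨(hiff _ e (H.edges_sub e he) rfl (hlinj e he)).mp he, image_subset_image (H.edges_sub e he)⟩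
  have hrepinj : ∀ e ∈ H.edges, Set.InjOn rep e := fun e he x hx y hy hxy =>
    hlinj e he hx hy (hrinv x (H.edges_sub e he hx) y (H.edges_sub e he hy) hxy)
  have hWF : ¬ F.IsCopyIn W := by
    rintro ⟨f, f1, f2, f3⟩
    apply hK
    have hf2 : ∀ v ∈ F.verts, ∃ x ∈ H.verts, rep x = f v := by
      intro v hv
      have := f2 v hv
      rw [hW] at this
      change f v ∈ H.verts ∩ H.verts.image rep at this
      exact mem_image.mp (mem_inter.mp this).2
    refine ⟨f, ⟨f1, ?_, ?_⟩, ?_⟩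
    · intro v hv
      have := f2 v hv
      change f v ∈ H.verts ∩ H.verts.image rep at this
      exact (mem_inter.mp this).1
    · intro e he
      have := f3 e he
      rw [hW, mem_induce] at this
      exact this.1
    · intro x hx y hy hxy
      by_contra hcon
      push Not at hcon
      obtain ⟨x', hx', hx2⟩ := hf2 x hx
      obtain ⟨y', hy', hy2⟩ := hf2 y hy
      have hne : f x ≠ f y := fun hh => hxy (f1 hx hy hh)
      have := hs (f x) (hx2 ▸ (hρ x' hx').1) (f y) (hy2 ▸ (hρ y' hy').1) hne (fun e he h1 h2 => hcon e he h1 h2)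
      rw [← hx2, ← hy2, (hρ x' hx').2, (hρ y' hy').2] at this
      exact hne (by rw [← hx2, ← hy2]; exact hrr _ hx' _ hy' this)
  by_cases hWK : IsKlSub r ℓ W
  · left
    obtain ⟨f, f1, f2⟩ := hWK
    refine ⟨f ∘ rep, ?_, ?_⟩
    · intro v hv
      apply f1
      change rep v ∈ H.verts ∩ H.verts.image rep
      exact mem_inter.mpr ⟨(hρ v hv).1, mem_image_of_mem _ hv⟩
    · intro e he u hu v hv huv
      have := f2 _ (hWe e he) (rep u) (mem_image_of_mem _ hu) (rep v) (mem_image_of_mem _ hv) huv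
      exact hrepinj e he hu hv this
  · right
    have hblow : IsBlowupOf W H := by
      refine ⟨rep, ?_, ?_⟩
      · intro v hv
        change rep v ∈ H.verts ∩ H.verts.image rep
        exact mem_inter.mpr ⟨(hρ v hv).1, mem_image_of_mem _ hv⟩
      · intro e
        constructor
        · intro he
          exact ⟨H.edges_sub e he, H.edges_card e he, e.image rep, hWe e he, (image_val_of_injOn (hrepinj e he)).symm⟩
        · rintro ⟨h1, h2, f, hf, hfe⟩
          have hinj : Set.InjOn rep e := by
            intro x hx y hy hxy
            refine Multiset.inj_on_of_nodup_map (f := rep) (s := e.val) ?_ x hx y hy hxy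
            rw [hfe]; exact f.nodup
          have hfeq : f = e.image rep := by
            apply val_injective
            rw [image_val_of_injOn hinj, hfe]
          rw [hiff _ e h1 rfl (fun x hx y hy hxy => hinj hx hy (hrr x (h1 hx) y (h1 hy) hxy)), ← hfeq]
          rw [hW, mem_induce] at hf
          exact hf.1
    have h1 := lag_bound W H hr hblow
    have h2 := ha W hWF hWK
    exact h1.trans (by gcongr)

theorem sym_step (H : HGraph r) (h : ¬ ∀ u ∈ H.verts, ∀ v ∈ H.verts, u ≠ v → Unc H u v → lk H u = lk H v) :
    ∃ u v, ∃ huv : u ≠ v, ∃ hu : u ∈ H.verts, ∃ hv : v ∈ H.verts, ∃ hunc : Unc H u v, 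
      H.edges.card ≤ (clone H u v huv hv hunc).edges.card ∧
      H.edges.card * (H.verts.card ^ 2 + 1) + tp H < 
      (clone H u v huv hv hunc).edges.card * (H.verts.card ^ 2 + 1) + tp (clone H u v huv hv hunc) := by
  push Not at h
  obtain ⟨u, hu, v, hv, huv, hunc, hne⟩ := h
  have main : ∀ u v, ∀ huv : u ≠ v, ∀ hu : u ∈ H.verts, ∀ hv : v ∈ H.verts, ∀ hunc : Unc H u v, lk H u ≠ lk H v →
      (H.deg v < H.deg u ∨ (H.deg v = H.deg u ∧ tw H v ≤ tw H u)) →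
      H.edges.card ≤ (clone H u v huv hv hunc).edges.card ∧
      H.edges.card * (H.verts.card ^ 2 + 1) + tp H < 
      (clone H u v huv hv hunc).edges.card * (H.verts.card ^ 2 + 1) + tp (clone H u v huv hv hunc) := by
    intro u v huv hu hv hunc hne hcase
    have h1 := clone_card H u v huv hv hunc
    rcases hcase with h2 | ⟨h2, h3⟩
    · refine ⟨by omega, ?_⟩
      have h4 := tp_le H
      have h5 : H.edges.card + 1 ≤ (clone H u v huv hv hunc).edges.card := by omega
      have h6 := Nat.mul_le_mul_right (H.verts.card ^ 2 + 1) h5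
      rw [add_mul] at h6
      omega
    · have h4 := clone_tp H u v huv hu hv hunc hne h3
      have h5 : H.edges.card = (clone H u v huv hv hunc).edges.card := by omega
      refine ⟨h5.le, ?_⟩
      rw [← h5]; omega
  have hunc' : Unc H v u := fun e he h1 h2 => hunc e he h2 h1
  by_cases hcase : H.deg v < H.deg u ∨ (H.deg v = H.deg u ∧ tw H v ≤ tw H u)
  · exact ⟨u, v, huv, hu, hv, hunc, main u v huv hu hv hunc hne hcase⟩
  · exact ⟨v, u, huv.symm, hv, hu, hunc', main v u huv.symm hv hu hunc' hne.symm (by omega)⟩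

theorem sym_main (ℓ : ℕ) (hr : 2 ≤ r) (hrl : r ≤ ℓ) (F : HGraph r) (hF : F.verts.card = ℓ + 1)
    (hb : CondB ℓ F) (b : ℝ) (hbl : b < (r.factorial : ℝ) * pc r ℓ)
    (ha : ∀ H : HGraph r, ¬ F.IsCopyIn H → ¬ IsKlSub r ℓ H → hgLagrangian r H ≤ b) (η : ℝ) (hη : 0 < η) :
    ∃ ζ : ℝ, 0 < ζ ∧ ∃ N : ℕ, ∀ H : HGraph r, N ≤ H.verts.card → KFree F H → 
      (pc r ℓ - ζ) * (H.verts.card : ℝ) ^ r ≤ H.edges.card → 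
      ∃ c : ℕ → ℕ, (∀ v ∈ H.verts, c v < ℓ) ∧ ((badT H c).card : ℝ) ≤ η * (H.verts.card : ℝ) ^ r := by
  obtain ⟨ω, hω, hSI⟩ := self_improve ℓ hr hrl F hF hb
  obtain ⟨η', hη', hη1, hη2⟩ : ∃ η' : ℝ, 0 < η' ∧ η' ≤ η ∧ η' ≤ ω / 2 :=
    ⟨min η (ω / 2), by positivity, min_le_left _ _, min_le_right _ _⟩
  obtain ⟨ζ1, hζ1, N1, hS⟩ := hSI η' hη'
  have hfac : (0:ℝ) < r.factorial := by exact_mod_cast r.factorial_pos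
  have hgap : 0 < ((r.factorial : ℝ) * pc r ℓ - b) / r.factorial := div_pos (by linarith) hfac
  refine ⟨min ζ1 (((r.factorial : ℝ) * pc r ℓ - b) / r.factorial / 2), by positivity, N1 + ⌈2 / ω⌉₊ + 1, ?_⟩
  set ζ := min ζ1 (((r.factorial : ℝ) * pc r ℓ - b) / r.factorial / 2) with hζ
  have hz1 : ζ ≤ ζ1 := min_le_left _ _
  have hz2 : ζ ≤ ((r.factorial : ℝ) * pc r ℓ - b) / r.factorial / 2 := min_le_right _ _
  have hz3 : b < r.factorial * (pc r ℓ - ζ) := by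
    have : r.factorial * ζ ≤ ((r.factorial : ℝ) * pc r ℓ - b) / 2 := by
      calc r.factorial * ζ ≤ r.factorial * (((r.factorial : ℝ) * pc r ℓ - b) / r.factorial / 2) := by gcongr
        _ = _ := by field_simp
    nlinarith
  have key : ∀ k : ℕ, ∀ H : HGraph r, N1 + ⌈2 / ω⌉₊ + 1 ≤ H.verts.card → KFree F H → 
      (pc r ℓ - ζ) * (H.verts.card : ℝ) ^ r ≤ H.edges.card →
      H.verts.card ^ r * (H.verts.card ^ 2 + 1) + H.verts.card ^ 2 ≤ 
        H.edges.card * (H.verts.card ^ 2 + 1) + tp H + k →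
      ∃ c : ℕ → ℕ, (∀ v ∈ H.verts, c v < ℓ) ∧ ((badT H c).card : ℝ) ≤ η' * (H.verts.card : ℝ) ^ r := by
    intro k
    induction k using Nat.strong_induction_on with
    | _ k ih =>
    intro H hn hK he hk
    have hn0 : 0 < H.verts.card := by omega
    have hnpos : (0:ℝ) < H.verts.card := by exact_mod_cast hn0
    by_cases hs : ∀ u ∈ H.verts, ∀ v ∈ H.verts, u ≠ v → Unc H u v → lk H u = lk H v
    · rcases symmetrized ℓ hr F H hK hs b ha with ⟨c, h1, h2⟩ | h1
      · refine ⟨c, h1, ?_⟩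
        have : badT H c = ∅ := by
          rw [badT, filter_eq_empty_iff]
          intro e he
          rw [not_not]
          exact fun u hu v hv huv => h2 e he u hu v hv huv
        rw [this]; simp; positivity
      · exfalso
        have h2 : (r.factorial : ℝ) * ((pc r ℓ - ζ) * (H.verts.card : ℝ) ^ r) ≤ b * (H.verts.card : ℝ) ^ r :=
          le_trans (by gcongr) h1
        have h3 : b * (H.verts.card : ℝ) ^ r < r.factorial * (pc r ℓ - ζ) * (H.verts.card : ℝ) ^ r :=
          mul_lt_mul_of_pos_right hz3 (by positivity)
        linarith
    · obtain ⟨u, v, huv, hu, hv, hunc, h1, h2⟩ := sym_step H hs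
      set G := clone H u v huv hv hunc with hG
      have hGv : G.verts = H.verts := rfl
      have hGt := tp_le G
      have hGe := card_edges_le G
      rw [hGv] at hGt hGe
      have hGm := Nat.mul_le_mul_right (H.verts.card ^ 2 + 1) hGe
      have h1' : (H.edges.card : ℝ) ≤ G.edges.card := by exact_mod_cast h1
      obtain ⟨c, hc1, hc2⟩ := ih (k - 1) (by omega) G hn (clone_free H u v huv hv hunc F hK hu)
        (by rw [hGv]; linarith) (by rw [hGv]; omega)
      rw [hGv] at hc1 hc2
      refine hS H c (by omega) (exp_free_of_KFree F H hr hK) hc1 ?_ ?_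
      · refine le_trans ?_ he
        gcongr
      · have h3 : ((badT H c).card : ℝ) ≤ (badT G c).card + (H.verts.card : ℝ) ^ (r-1) := by
          exact_mod_cast clone_bad H u v huv hv hunc c
        have hpow : (H.verts.card : ℝ) ^ r = H.verts.card * (H.verts.card : ℝ) ^ (r-1) := by
          rw [← pow_succ']; congr 1; omega
        have h4 : 1 ≤ ω / 2 * H.verts.card := by
          have h1 := Nat.le_ceil (2 / ω)
          have h2 : ((⌈2 / ω⌉₊ : ℕ) : ℝ) ≤ H.verts.card := by exact_mod_cast (by omega : ⌈2 / ω⌉₊ ≤ H.verts.card)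
          have h3 := h1.trans h2
          rw [div_le_iff₀ hω] at h3
          linarith
        have h5 : (H.verts.card : ℝ) ^ (r-1) ≤ ω / 2 * (H.verts.card : ℝ) ^ r := by
          rw [hpow, ← mul_assoc]
          exact le_mul_of_one_le_left (by positivity) h4
        have h6 : η' * (H.verts.card : ℝ) ^ r ≤ ω / 2 * (H.verts.card : ℝ) ^ r := by gcongr
        linarith
  intro H hn hK he
  obtain ⟨c, h1, h2⟩ := key (H.verts.card ^ r * (H.verts.card ^ 2 + 1) + H.verts.card ^ 2) H hn hK he (by omega)
  exact ⟨c, h1, h2.trans (by gcongr)⟩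

end PartL

section PartM
open Finset
open scoped Classical
variable {r : ℕ}

/-- the standing hypotheses -/
structure Hyp (ℓ : ℕ) (F : HGraph r) : Prop where
  hr : 2 ≤ r
  hrl : r ≤ ℓ
  hF : F.verts.card = ℓ + 1
  hb : CondB ℓ F
  ha : ∃ b : ℝ, b < (r.factorial : ℝ) * pc r ℓ ∧
    ∀ H : HGraph r, ¬ F.IsCopyIn H → ¬ IsKlSub r ℓ H → hgLagrangian r H ≤ b

/-- all pairs of the edge are robust -/
def AllRob (H : HGraph r) (K : ℕ) (e : Finset ℕ) : Prop := ∀ x ∈ e, ∀ y ∈ e, x ≠ y → Rob H K x y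

/-- keep the edges all of whose pairs are robust -/
noncomputable def cleanG (H : HGraph r) (K : ℕ) : HGraph r where
  verts := H.verts
  edges := H.edges.filter (fun e => AllRob H K e)
  edges_sub := fun e he => H.edges_sub e (mem_filter.mp he).1
  edges_card := fun e he => H.edges_card e (mem_filter.mp he).1

theorem clean_free (F H : HGraph r) (hr : 2 ≤ r) (h : ¬ F.expansion.IsCopyIn H) : KFree F (cleanG H (Kn F)) := by
  rintro ⟨g, ⟨g1, g2, g3⟩, gc⟩
  apply h
  apply exp_of_rob F H hr g ⟨g1, g2, fun e he => (mem_filter.mp (g3 e he)).1⟩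
  intro p hp
  simp only [upairs, mem_filter, mem_product] at hp
  have hne : p.1 ≠ p.2 := hp.2.1.ne
  obtain ⟨e, he, h1, h2⟩ := gc p.1 hp.1.1 p.2 hp.1.2 hne
  exact (mem_filter.mp he).2 _ h1 _ h2 (fun hh => hne (g1 hp.1.1 hp.1.2 hh))

theorem nonrob_pair (hr : 2 ≤ r) (H : HGraph r) (K x y : ℕ) (hxy : x ≠ y) (h : ¬ Rob H K x y) :
    H.verts.card ^ 2 * (H.edges.filter (fun e => x ∈ e ∧ y ∈ e)).card ≤ K * H.verts.card ^ (r - 1) := by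
  unfold Rob at h
  push Not at h
  obtain ⟨X, hX, hx, hy, hd⟩ := h
  rcases Nat.lt_or_ge 2 r with h3 | h3
  · have hsub : H.edges.filter (fun e => x ∈ e ∧ y ∈ e) ⊆ X.biUnion (fun z => H.edges.filter (fun e => {x, y, z} ⊆ e)) := by
      intro e he
      obtain ⟨h1, h2, h4⟩ := mem_filter.mp he
      obtain ⟨z, hz, hz'⟩ := not_disjoint_iff.mp (hd e h1 h2 h4)
      refine mem_biUnion.mpr ⟨z, hz', mem_filter.mpr ⟨h1, ?_⟩⟩
      intro w hw
      simp only [mem_insert, mem_singleton] at hw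
      rcases hw with rfl | rfl | rfl <;> assumption
    have h1 : (H.edges.filter (fun e => x ∈ e ∧ y ∈ e)).card ≤ X.card * H.verts.card ^ (r-3) := by
      refine (card_le_card hsub).trans (card_biUnion_le.trans ?_)
      rw [← smul_eq_mul]
      refine sum_le_card_nsmul _ _ _ fun z hz => ?_
      have h5 := card_edges_sup H {x, y, z}
      have h6 : ({x, y, z} : Finset ℕ).card = 3 := card_eq_three.mpr
        ⟨x, y, z, hxy, fun hh => hx (hh ▸ hz), fun hh => hy (hh ▸ hz), rfl⟩
      rwa [h6] at h5
    have h2 : H.verts.card ^ (r-1) = H.verts.card ^ 2 * H.verts.card ^ (r-3) := by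
      rw [← pow_add]; congr 1; omega
    rw [h2]
    calc _ ≤ H.verts.card ^ 2 * (X.card * H.verts.card ^ (r-3)) := Nat.mul_le_mul_left _ h1
      _ ≤ H.verts.card ^ 2 * (K * H.verts.card ^ (r-3)) := Nat.mul_le_mul_left _ (Nat.mul_le_mul_right _ hX)
      _ = _ := by ring
  · have : H.edges.filter (fun e => x ∈ e ∧ y ∈ e) = ∅ := by
      rw [filter_eq_empty_iff]
      rintro e he ⟨h1, h2⟩
      obtain ⟨z, hz, hz'⟩ := not_disjoint_iff.mp (hd e he h1 h2)
      have h6 : ({x, y, z} : Finset ℕ).card = 3 := card_eq_three.mpr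
        ⟨x, y, z, hxy, fun hh => hx (hh ▸ hz'), fun hh => hy (hh ▸ hz'), rfl⟩
      have h7 : ({x, y, z} : Finset ℕ).card ≤ e.card := by
        apply card_le_card
        intro w hw
        simp only [mem_insert, mem_singleton] at hw
        rcases hw with rfl | rfl | rfl <;> assumption
      rw [H.edges_card e he] at h7
      omega
    rw [this]; simp

theorem clean_lost (hr : 2 ≤ r) (H : HGraph r) (K : ℕ) :
    (H.edges.filter (fun e => ¬ AllRob H K e)).card ≤ K * H.verts.card ^ (r-1) := by
  set P := (H.verts ×ˢ H.verts).filter (fun p => p.1 ≠ p.2 ∧ ¬ Rob H K p.1 p.2) with hP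
  have hsub : H.edges.filter (fun e => ¬ AllRob H K e) ⊆
      P.biUnion (fun p => H.edges.filter (fun e => p.1 ∈ e ∧ p.2 ∈ e)) := by
    intro e he
    obtain ⟨h1, h2⟩ := mem_filter.mp he
    unfold AllRob at h2
    push Not at h2
    obtain ⟨x, hx, y, hy, hxy, hn⟩ := h2
    refine mem_biUnion.mpr ⟨(x, y), mem_filter.mpr ⟨mem_product.mpr ⟨H.edges_sub e h1 hx, H.edges_sub e h1 hy⟩, hxy, hn⟩,
      mem_filter.mpr ⟨h1, hx, hy⟩⟩
  rcases Nat.eq_zero_or_pos H.verts.card with h0 | h0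
  · have : H.edges.filter (fun e => ¬ AllRob H K e) = ∅ := by
      rw [filter_eq_empty_iff]
      intro e he
      exfalso
      have h1 := card_le_card (H.edges_sub e he)
      rw [H.edges_card e he] at h1
      omega
    rw [this]; simp
  · have hn2 : 0 < H.verts.card ^ 2 := by positivity
    refine Nat.le_of_mul_le_mul_left ?_ hn2
    calc _ ≤ H.verts.card ^ 2 * ∑ p ∈ P, (H.edges.filter (fun e => p.1 ∈ e ∧ p.2 ∈ e)).card :=
          Nat.mul_le_mul_left _ ((card_le_card hsub).trans card_biUnion_le)
      _ = ∑ p ∈ P, H.verts.card ^ 2 * (H.edges.filter (fun e => p.1 ∈ e ∧ p.2 ∈ e)).card := by rw [mul_sum]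
      _ ≤ P.card • (K * H.verts.card ^ (r-1)) := by
          refine sum_le_card_nsmul _ _ _ fun p hp => ?_
          obtain ⟨_, h1, h2⟩ := mem_filter.mp hp
          exact nonrob_pair hr H K p.1 p.2 h1 h2
      _ ≤ _ := by
          rw [smul_eq_mul]
          apply Nat.mul_le_mul_right
          refine (card_filter_le _ _).trans ?_
          rw [card_product, sq]

theorem big_mul (ζ C : ℝ) (hζ : 0 < ζ) (n : ℕ) (hn : ⌈C / ζ⌉₊ ≤ n) : C ≤ ζ * n := by
  have h1 := Nat.le_ceil (C / ζ)
  have h2 : ((⌈C / ζ⌉₊ : ℕ) : ℝ) ≤ n := by exact_mod_cast hn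
  have h3 := h1.trans h2
  rw [div_le_iff₀ hζ] at h3
  linarith

theorem stab (ℓ : ℕ) (F : HGraph r) (hy : Hyp ℓ F) (η : ℝ) (hη : 0 < η) :
    ∃ ζ : ℝ, 0 < ζ ∧ ∃ N : ℕ, ∀ H : HGraph r, N ≤ H.verts.card → ¬ F.expansion.IsCopyIn H →
      (pc r ℓ - ζ) * (H.verts.card : ℝ) ^ r ≤ H.edges.card → 
      ∃ c : ℕ → ℕ, (∀ v ∈ H.verts, c v < ℓ) ∧ ((badT H c).card : ℝ) ≤ η * (H.verts.card : ℝ) ^ r := by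
  obtain ⟨b, hb1, hb2⟩ := hy.ha
  obtain ⟨ζ, hζ, N, hN⟩ := sym_main ℓ hy.hr hy.hrl F hy.hF hy.hb b hb1 hb2 (η / 2) (by positivity)
  have hr := hy.hr
  refine ⟨ζ / 2, by positivity, N + ⌈(Kn F : ℝ) / (ζ / 2)⌉₊ + ⌈(Kn F : ℝ) / (η / 2)⌉₊, ?_⟩
  intro H hn hfree he
  have hpow : (H.verts.card : ℝ) ^ r = H.verts.card * (H.verts.card : ℝ) ^ (r-1) := by
    rw [← pow_succ']; congr 1; omega
  have hl := clean_lost hr H (Kn F)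
  have hl' : ((H.edges.filter (fun e => ¬ AllRob H (Kn F) e)).card : ℝ) ≤ 
      Kn F * (H.verts.card : ℝ) ^ (r-1) := by exact_mod_cast hl
  have h1 := big_mul (ζ / 2) (Kn F) (by positivity) H.verts.card (by omega)
  have h2 := big_mul (η / 2) (Kn F) (by positivity) H.verts.card (by omega)
  have hQ : 0 ≤ (H.verts.card : ℝ) ^ (r-1) := by positivity
  have h3 : (Kn F : ℝ) * (H.verts.card : ℝ) ^ (r-1) ≤ ζ / 2 * (H.verts.card : ℝ) ^ r := by
    rw [hpow, ← mul_assoc]; gcongr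
  have h4 : (Kn F : ℝ) * (H.verts.card : ℝ) ^ (r-1) ≤ η / 2 * (H.verts.card : ℝ) ^ r := by
    rw [hpow, ← mul_assoc]; gcongr
  have h5 : (cleanG H (Kn F)).edges.card + (H.edges.filter (fun e => ¬ AllRob H (Kn F) e)).card = H.edges.card :=
    card_filter_add_card_filter_not _
  have h5' : ((cleanG H (Kn F)).edges.card : ℝ) + (H.edges.filter (fun e => ¬ AllRob H (Kn F) e)).card = H.edges.card := by
    exact_mod_cast h5
  obtain ⟨c, hc1, hc2⟩ := hN (cleanG H (Kn F)) (by change N ≤ H.verts.card; omega) (clean_free F H hr hfree) (by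
    change (pc r ℓ - ζ) * (H.verts.card : ℝ) ^ r ≤ _
    linarith)
  refine ⟨c, hc1, ?_⟩
  change _ ≤ η / 2 * (H.verts.card : ℝ) ^ r at hc2
  have hsub : badT H c ⊆ badT (cleanG H (Kn F)) c ∪ H.edges.filter (fun e => ¬ AllRob H (Kn F) e) := by
    intro e he
    obtain ⟨h1, h2⟩ := mem_filter.mp he
    rw [mem_union]
    by_cases h : AllRob H (Kn F) e
    · exact Or.inl (mem_filter.mpr ⟨mem_filter.mpr ⟨h1, h⟩, h2⟩)
    · exact Or.inr (mem_filter.mpr ⟨h1, h⟩)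
  have h6 : ((badT H c).card : ℝ) ≤ (badT (cleanG H (Kn F)) c).card + (H.edges.filter (fun e => ¬ AllRob H (Kn F) e)).card := by
    exact_mod_cast (card_le_card hsub).trans (card_union_le _ _)
  linarith

theorem degstab (ℓ : ℕ) (F : HGraph r) (hy : Hyp ℓ F) :
    ∃ ε : ℝ, 0 < ε ∧ ∃ N : ℕ, ∀ H : HGraph r, N ≤ H.verts.card → ¬ F.expansion.IsCopyIn H →
      (∀ v ∈ H.verts, (r * pc r ℓ - ε) * (H.verts.card : ℝ) ^ (r-1) ≤ H.deg v) → IsKlSub r ℓ H := by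
  have hr := hy.hr
  obtain ⟨ε, hε, ω, hω, N, hN⟩ := mindeg ℓ hy.hr hy.hrl F hy.hF hy.hb
  obtain ⟨ζ, hζ, N', hN'⟩ := stab ℓ F hy ω hω
  refine ⟨min ε ζ, by positivity, N + N', ?_⟩
  intro H hn hfree hd
  have hr1 : (1:ℝ) ≤ r := by exact_mod_cast (by omega : 1 ≤ r)
  have e1 : min ε ζ ≤ ε := min_le_left _ _
  have e2 : min ε ζ ≤ ζ := min_le_right _ _
  have he := edges_of_mindeg H hr (pc r ℓ - ζ) (fun v hv => by
    refine le_trans ?_ (hd v hv)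
    gcongr
    nlinarith)
  obtain ⟨c, hc1, hc2⟩ := hN' H (by omega) hfree he
  refine hN H c (by omega) hfree hc1 (fun v hv => ?_) hc2
  refine le_trans ?_ (hd v hv)
  gcongr

theorem bounded (ℓ : ℕ) (F : HGraph r) (hy : Hyp ℓ F) (ε : ℝ) (hε : 0 < ε) :
    ∃ ζ : ℝ, 0 < ζ ∧ ∃ N : ℕ, ∀ H : HGraph r, N ≤ H.verts.card → ¬ F.expansion.IsCopyIn H →
      (pc r ℓ - ζ) * (H.verts.card : ℝ) ^ r ≤ H.edges.card → 
      ∀ v ∈ H.verts, (H.deg v : ℝ) ≤ (r * pc r ℓ + ε) * (H.verts.card : ℝ) ^ (r-1) := by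
  obtain ⟨ζ1, hζ1, N1, h1⟩ := stab1 ℓ hy.hr hy.hrl F hy.hF hy.hb ε hε
  obtain ⟨ζ2, hζ2, N2, h2⟩ := stab ℓ F hy ζ1 hζ1
  refine ⟨min ζ1 ζ2, by positivity, N1 + N2, ?_⟩
  intro H hn hfree he
  obtain ⟨c, hc1, hc2⟩ := h2 H (by omega) hfree (le_trans (by gcongr; exact min_le_right _ _) he)
  obtain ⟨c', hc'⟩ := h1 H c (by omega) hfree hc1 (le_trans (by gcongr; exact min_le_left _ _) he) hc2
  exact hc'.deg

theorem bern (k : ℕ) (ℓ m : ℕ) (ε : ℝ) (hε : 0 < ε) (hm : ℓ ≤ m) (hN : ⌈((k * (ℓ + 1) : ℕ) : ℝ) / ε⌉₊ ≤ m) (q : ℝ) (hq0 : 0 ≤ q)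
    (hq : q ≤ 1) : (q - ε) * ((m:ℝ)+1) ^ k ≤ q * ((m:ℝ) - ℓ) ^ k := by
  have h1 := big_mul ε _ hε m hN
  have hm0 : (0:ℝ) < (m:ℝ) + 1 := by positivity
  have hm' : (ℓ:ℝ) ≤ m := by exact_mod_cast hm
  have h2 : 1 + (k:ℝ) * (-((ℓ:ℝ)+1) / (m+1)) ≤ (1 + (-((ℓ:ℝ)+1) / (m+1))) ^ k := by
    apply one_add_mul_le_pow
    rw [le_div_iff₀ hm0]
    linarith
  have h3 : ((m:ℝ) - ℓ) ^ k = ((m:ℝ)+1) ^ k * (1 + (-((ℓ:ℝ)+1) / (m+1))) ^ k := by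
    rw [← mul_pow]; congr 1; field_simp; ring
  have h4 : (k:ℝ) * ((ℓ:ℝ)+1) / (m+1) ≤ ε := by
    rw [div_le_iff₀ hm0]
    push_cast at h1
    linarith
  have h5 : 1 - ε ≤ (1 + (-((ℓ:ℝ)+1) / (m+1))) ^ k := by
    refine le_trans ?_ h2
    have : (k:ℝ) * (-((ℓ:ℝ)+1) / (m+1)) = - ((k:ℝ) * ((ℓ:ℝ)+1) / (m+1)) := by ring
    rw [this]; linarith
  rw [h3]
  have h6 : q - ε ≤ q * (1 + (-((ℓ:ℝ)+1) / (m+1))) ^ k := by nlinarith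
  calc _ ≤ (q * (1 + (-((ℓ:ℝ)+1) / (m+1))) ^ k) * ((m:ℝ)+1) ^ k := by gcongr
    _ = _ := by ring

theorem exact_turan (ℓ : ℕ) (F : HGraph r) (hy : Hyp ℓ F) :
    ∃ N : ℕ, ∀ H : HGraph r, N ≤ H.verts.card → ¬ F.expansion.IsCopyIn H →
      H.edges.card ≤ tau r ℓ H.verts.card ∧ (H.edges.card = tau r ℓ H.verts.card → IsKlSub r ℓ H) := by
  have hr := hy.hr
  have hrl := hy.hrl
  obtain ⟨ε, hε, N1, hD⟩ := degstab ℓ F hy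
  set N0 := N1 + ℓ + ⌈(((r-1) * (ℓ + 1) : ℕ) : ℝ) / ε⌉₊ with hN0
  have key : ∀ d : ℕ, ∀ k : ℕ, ∀ H : HGraph r, H.verts.card = N0 + d → ¬ F.expansion.IsCopyIn H →
      tau r ℓ (N0 + d) + k ≤ H.edges.card → (¬ IsKlSub r ℓ H ∨ 1 ≤ k) → k + d ≤ N0 ^ r := by
    intro d
    induction d with
    | zero =>
      intro k H hv _ he _
      have := card_edges_le H
      rw [hv] at this
      simp only [add_zero] at this he ⊢
      omega
    | succ d ih =>
      intro k H hv hfree he hk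
      by_cases hall : ∀ v ∈ H.verts, tau r ℓ (N0 + (d + 1)) ≤ H.deg v + tau r ℓ (N0 + d)
      · have hKl : IsKlSub r ℓ H := by
          apply hD H (by omega) hfree
          intro v hv'
          have h1 := hall v hv'
          have h1' : (tau r ℓ (N0 + d + 1) : ℝ) ≤ H.deg v + tau r ℓ (N0 + d) := by exact_mod_cast h1
          have h2 := (tau_diff_bounds r ℓ (by omega) (by omega) (N0 + d) (by omega)).1
          have h3 := bern (r-1) ℓ (N0 + d) ε hε (by omega) (by omega) (r * pc r ℓ) 
            (mul_nonneg (Nat.cast_nonneg _) (pc_nonneg _ _)) (pc_le_one r ℓ hr hrl)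
          have h4 : (H.verts.card : ℝ) = ((N0 + d : ℕ) : ℝ) + 1 := by rw [hv]; push_cast; ring
          rw [h4]
          linarith
        rcases hk with hk | hk
        · exact absurd hKl hk
        · have := kl_le_tau ℓ hr (by omega) H hKl
          rw [hv] at this
          omega
      · push Not at hall
        obtain ⟨v, hv', hlt⟩ := hall
        have h1 := card_remove H {v}
        rw [sum_singleton] at h1
        have h2 : (H.induce (H.verts \ {v})).verts.card = N0 + d := by
          rw [verts_remove, card_sdiff_of_subset (by simpa using hv'), hv]; simp
        have := ih (k+1) (H.induce (H.verts \ {v})) h2 (fun hh => hfree (induce_copy _ _ _ hh)) (by omega) (Or.inr (by omega))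
        omega
  refine ⟨N0 + N0 ^ r + 1, ?_⟩
  intro H hn hfree
  obtain ⟨d, hd⟩ := Nat.exists_eq_add_of_le (show N0 ≤ H.verts.card by omega)
  constructor
  · by_contra hcon
    have := key d 1 H hd hfree (by rw [← hd]; omega) (Or.inr le_rfl)
    omega
  · intro he
    by_contra hcon
    have := key d 0 H hd hfree (by rw [← hd]; omega) (Or.inl hcon)
    omega

end PartM

section PartN
open Finset
open scoped Classical
variable {r : ℕ}

/-- a copy inside an induced subgraph gives a vertex set -/
theorem copy_set (E H : HGraph r) (A : Finset ℕ) (h : E.IsCopyIn (H.induce A)) :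
    ∃ S : Finset ℕ, S ⊆ H.verts ∧ S ⊆ A ∧ S.card = E.verts.card ∧ E.IsCopyIn (H.induce S) := by
  obtain ⟨f, f1, f2, f3⟩ := h
  have hs : ∀ v ∈ E.verts, f v ∈ H.verts ∧ f v ∈ A := by
    intro v hv
    have := f2 v hv
    rw [induce_verts] at this
    exact mem_inter.mp this
  refine ⟨E.verts.image f, ?_, ?_, card_image_of_injOn f1, f, f1, ?_, ?_⟩
  · intro w hw
    obtain ⟨v, hv, rfl⟩ := mem_image.mp hw
    exact (hs v hv).1
  · intro w hw
    obtain ⟨v, hv, rfl⟩ := mem_image.mp hw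
    exact (hs v hv).2
  · intro v hv
    rw [induce_verts]
    exact mem_inter.mpr ⟨(hs v hv).1, mem_image_of_mem _ hv⟩
  · intro e he
    rw [mem_induce]
    exact ⟨((mem_induce _ _ _).mp (f3 e he)).1, image_subset_image (E.edges_sub e he)⟩

theorem match_ext (E H : HGraph r) (k : ℕ) (h : E.HasMatching H k) :
    ∃ W : Finset ℕ, W ⊆ H.verts ∧ W.card = k * E.verts.card ∧
      ∀ G : HGraph r, H.verts ⊆ G.verts → H.edges ⊆ G.edges →
        E.IsCopyIn (G.induce (G.verts \ W)) → E.HasMatching G (k + 1) := by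
  obtain ⟨S, h1, h2, h3⟩ := h
  refine ⟨univ.biUnion S, ?_, ?_, ?_⟩
  · intro x hx
    obtain ⟨i, _, hi⟩ := mem_biUnion.mp hx
    exact (h1 i).1 hi
  · rw [card_biUnion (fun i _ j _ hij => h2 i j hij), sum_congr rfl (fun i _ => (h1 i).2)]
    simp
  · intro G hv he hc
    obtain ⟨T, t1, t2, t3, t4⟩ := copy_set E G _ hc
    have hd : ∀ i, Disjoint T (S i) := by
      intro i
      rw [disjoint_left]
      intro x hx hxi
      exact (Finset.mem_sdiff.mp (t2 hx)).2 (mem_biUnion.mpr ⟨i, mem_univ _, hxi⟩)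
    refine ⟨Fin.cons T S, ?_, ?_, ?_⟩
    · intro i
      refine Fin.cases ?_ (fun j => ?_) i
      · exact ⟨t1, t3⟩
      · exact ⟨(h1 j).1.trans hv, (h1 j).2⟩
    · intro i j
      refine Fin.cases ?_ (fun i' => ?_) i <;> refine Fin.cases ?_ (fun j' => ?_) j
      · intro h; exact absurd rfl h
      · intro _; exact hd j'
      · intro _; exact (hd i').symm
      · intro h
        exact h2 i' j' (fun hh => h (by rw [hh]))
    · intro i
      refine Fin.cases ?_ (fun j => ?_) i
      · exact t4
      · refine copy_mono E _ _ ?_ ?_ (h3 j)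
        · rw [induce_verts, induce_verts]
          exact inter_subset_inter_right hv
        · intro e hee
          obtain ⟨a, b⟩ := (mem_induce _ _ _).mp hee
          exact (mem_induce _ _ _).mpr ⟨he a, b⟩

theorem match_zero (E H : HGraph r) : E.HasMatching H 0 :=
  ⟨fun i => i.elim0, fun i => i.elim0, fun i => i.elim0, fun i => i.elim0⟩

/-- degree loss when deleting vertices -/
theorem deg_remove (H : HGraph r) (U : Finset ℕ) (x : ℕ) (hx : x ∉ U) :
    H.deg x ≤ (H.induce (H.verts \ U)).deg x + U.card * H.verts.card ^ (r-2) := by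
  have hsub : H.edges.filter (fun e => x ∈ e) ⊆ (H.induce (H.verts \ U)).edges.filter (fun e => x ∈ e) ∪
      U.biUnion (fun u => H.edges.filter (fun e => x ∈ e ∧ u ∈ e)) := by
    intro e he
    obtain ⟨h1, h2⟩ := mem_filter.mp he
    rw [mem_union]
    by_cases h : ∃ u ∈ U, u ∈ e
    · obtain ⟨u, hu, hue⟩ := h
      exact Or.inr (mem_biUnion.mpr ⟨u, hu, mem_filter.mpr ⟨h1, h2, hue⟩⟩)
    · push Not at h
      refine Or.inl (mem_filter.mpr ⟨(mem_induce _ _ _).mpr ⟨h1, ?_⟩, h2⟩)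
      intro w hw
      exact Finset.mem_sdiff.mpr ⟨H.edges_sub e h1 hw, fun hh => h w hh hw⟩
  refine (card_le_card hsub).trans ((card_union_le _ _).trans ?_)
  refine Nat.add_le_add_left ?_ _
  refine card_biUnion_le.trans ?_
  rw [← smul_eq_mul]
  exact sum_le_card_nsmul _ _ _ fun u hu => card_edges_pair H x u (fun hh => hx (hh ▸ hu))

theorem one_copy (ℓ : ℕ) (F : HGraph r) (hy : Hyp ℓ F) (ε : ℝ) (hε : 0 < ε) :
    ∃ δ : ℝ, 0 < δ ∧ ∃ N : ℕ, ∀ H : HGraph r, N ≤ H.verts.card →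
      (pc r ℓ - δ) * (H.verts.card : ℝ) ^ r ≤ H.edges.card →
      ∀ U : Finset ℕ, U ⊆ H.verts → (U.card : ℝ) ≤ δ * H.verts.card → ∀ x ∈ H.verts, x ∉ U →
      (r * pc r ℓ + ε) * (H.verts.card : ℝ) ^ (r-1) < H.deg x →
      F.expansion.IsCopyIn (H.induce (H.verts \ U)) := by
  have hr := hy.hr
  have hpc := pc_pos r ℓ (by have := hy.hrl; omega) hy.hrl
  obtain ⟨ζ, hζ, N, hN⟩ := bounded ℓ F hy (ε / 2) (by positivity)
  set ζ' := min ζ (pc r ℓ) with hζ'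
  have hz1 : ζ' ≤ ζ := min_le_left _ _
  have hz2 : ζ' ≤ pc r ℓ := min_le_right _ _
  have hz0 : 0 < ζ' := by positivity
  set δ := min (1/2) (min (ζ' / 2) (ε / 2)) with hδ
  have hd1 : δ ≤ 1/2 := min_le_left _ _
  have hd2 : δ ≤ ζ' / 2 := (min_le_right _ _).trans (min_le_left _ _)
  have hd3 : δ ≤ ε / 2 := (min_le_right _ _).trans (min_le_right _ _)
  have hd0 : 0 < δ := by positivity
  refine ⟨δ, hd0, 2 * N + 1, ?_⟩
  intro H hn he U hU hUc x hx hxU hdeg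
  by_contra hcon
  set H' := H.induce (H.verts \ U) with hH'
  have hv : H'.verts.card + U.card = H.verts.card := by
    rw [hH', verts_remove]; exact card_sdiff_add_card_eq_card hU
  have hvR : (H'.verts.card : ℝ) + U.card = H.verts.card := by exact_mod_cast hv
  have hle : (H'.verts.card : ℝ) ≤ H.verts.card := by
    have : (0:ℝ) ≤ U.card := by positivity
    linarith
  have hnR : (2 * N + 1 : ℝ) ≤ H.verts.card := by exact_mod_cast hn
  have hpow : (H.verts.card : ℝ) ^ r = H.verts.card * (H.verts.card : ℝ) ^ (r-1) := by
    rw [← pow_succ']; congr 1; omega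
  have hpow2 : (H.verts.card : ℝ) ^ (r-1) = H.verts.card * (H.verts.card : ℝ) ^ (r-2) := by
    rw [← pow_succ']; congr 1; omega
  have hN' : N ≤ H'.verts.card := by
    have : (N:ℝ) ≤ H'.verts.card := by nlinarith
    exact_mod_cast this
  have hB : (0:ℝ) ≤ (H.verts.card : ℝ) ^ (r-1) := by positivity
  have hB2 : (0:ℝ) ≤ (H.verts.card : ℝ) ^ (r-2) := by positivity
  have hB3 : (0:ℝ) ≤ (H.verts.card : ℝ) ^ r := by positivity
  have hedges : (pc r ℓ - ζ) * (H'.verts.card : ℝ) ^ r ≤ H'.edges.card := by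
    have h1 := card_remove H U
    have h2 : ∑ u ∈ U, H.deg u ≤ U.card * H.verts.card ^ (r-1) := by
      rw [← smul_eq_mul]
      exact sum_le_card_nsmul _ _ _ fun u _ => deg_le H u
    have h3 : (H.edges.card : ℝ) ≤ H'.edges.card + U.card * (H.verts.card : ℝ) ^ (r-1) := by
      exact_mod_cast h1.trans (Nat.add_le_add_left h2 _)
    have h4 : (U.card : ℝ) * (H.verts.card : ℝ) ^ (r-1) ≤ δ * (H.verts.card : ℝ) ^ r := by
      rw [hpow, ← mul_assoc]; gcongr
    calc _ ≤ (pc r ℓ - ζ') * (H'.verts.card : ℝ) ^ r := by gcongr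
      _ ≤ (pc r ℓ - ζ') * (H.verts.card : ℝ) ^ r := by
          have : 0 ≤ pc r ℓ - ζ' := by linarith
          gcongr
      _ ≤ (pc r ℓ - 2 * δ) * (H.verts.card : ℝ) ^ r := by gcongr; linarith
      _ ≤ _ := by linarith
  have hd := hN H' hN' hcon hedges x (by rw [hH', verts_remove]; exact Finset.mem_sdiff.mpr ⟨hx, hxU⟩)
  have h5 := deg_remove H U x hxU
  have h6 : (H.deg x : ℝ) ≤ H'.deg x + U.card * (H.verts.card : ℝ) ^ (r-2) := by exact_mod_cast h5
  have h7 : (U.card : ℝ) * (H.verts.card : ℝ) ^ (r-2) ≤ ε / 2 * (H.verts.card : ℝ) ^ (r-1) := by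
    rw [hpow2, ← mul_assoc]
    have : (U.card : ℝ) ≤ ε / 2 * H.verts.card := hUc.trans (by gcongr)
    gcongr
  have h8 : (r * pc r ℓ + ε / 2) * (H'.verts.card : ℝ) ^ (r-1) ≤ (r * pc r ℓ + ε / 2) * (H.verts.card : ℝ) ^ (r-1) := by
    gcongr
  linarith

theorem extend (ℓ : ℕ) (F : HGraph r) (hy : Hyp ℓ F) (ε : ℝ) (hε : 0 < ε) :
    ∃ δ : ℝ, 0 < δ ∧ ∃ N : ℕ, ∀ H : HGraph r, N ≤ H.verts.card →
      (pc r ℓ - δ) * (H.verts.card : ℝ) ^ r ≤ H.edges.card → ∀ t : ℕ,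
      (((t + 1) * (F.expansion.verts.card + 1) : ℕ) : ℝ) ≤ δ * H.verts.card →
      ∀ X : Finset ℕ, X ⊆ H.verts → 
      (∀ x ∈ X, (r * pc r ℓ + ε) * (H.verts.card : ℝ) ^ (r-1) < H.deg x) →
      ∀ k : ℕ, k + X.card ≤ t + 1 → F.expansion.HasMatching (H.induce (H.verts \ X)) k →
      F.expansion.HasMatching H (k + X.card) := by
  obtain ⟨δ, hδ, N, hN⟩ := one_copy ℓ F hy ε hε
  refine ⟨δ, hδ, N, ?_⟩
  intro H hn he t ht X
  induction X using Finset.induction_on with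
  | empty =>
    intro _ _ k _ hk
    rw [card_empty, add_zero]
    obtain ⟨S, h1, h2, h3⟩ := hk
    refine ⟨S, fun i => ⟨fun x hx => ?_, (h1 i).2⟩, h2, fun i => ?_⟩
    · have := (h1 i).1 hx
      rw [verts_remove] at this
      exact (Finset.mem_sdiff.mp this).1
    · refine copy_mono _ _ _ ?_ ?_ (h3 i)
      · rw [induce_verts, induce_verts, induce_verts]
        exact inter_subset_inter_right inter_subset_left
      · intro e he
        obtain ⟨a, b⟩ := (mem_induce _ _ _).mp he
        exact (mem_induce _ _ _).mpr ⟨((mem_induce _ _ _).mp a).1, b⟩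
  | insert x X hx ih =>
    intro hX hdeg k hk hm
    rw [card_insert_of_notMem hx] at hk ⊢
    have hX1 : X ⊆ H.verts := fun y hy => hX (mem_insert_of_mem hy)
    obtain ⟨W, w1, w2, w3⟩ := match_ext _ _ _ hm
    rw [verts_remove] at w1
    have hcopy := hN H hn he (X ∪ W) (union_subset hX1 (fun w hw => (Finset.mem_sdiff.mp (w1 hw)).1)) (by
      refine le_trans ?_ ht
      have : (X ∪ W).card ≤ (t+1) * (F.expansion.verts.card + 1) := by
        refine (card_union_le _ _).trans ?_
        have h1 : k * F.expansion.verts.card ≤ (t+1) * F.expansion.verts.card := Nat.mul_le_mul_right _ (by omega)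
        rw [mul_add, mul_one]
        omega
      exact_mod_cast this) x (hX (mem_insert_self _ _)) (by
        rw [mem_union]
        rintro (h | h)
        · exact hx h
        · exact (Finset.mem_sdiff.mp (w1 h)).2 (mem_insert_self _ _)) (hdeg x (mem_insert_self _ _))
    have h2 := w3 (H.induce (H.verts \ X)) (by
        rw [verts_remove, verts_remove]
        exact sdiff_subset_sdiff subset_rfl (subset_insert _ _)) (by
        intro e he
        obtain ⟨a, b⟩ := (mem_induce _ _ _).mp he
        exact (mem_induce _ _ _).mpr ⟨a, b.trans (sdiff_subset_sdiff subset_rfl (subset_insert _ _))⟩) (by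
        refine copy_mono _ _ _ ?_ ?_ hcopy
        · rw [verts_remove, verts_remove, verts_remove]
          intro y hy
          simp only [Finset.mem_sdiff, mem_union] at hy ⊢
          tauto
        · intro e he
          obtain ⟨a, b⟩ := (mem_induce _ _ _).mp he
          refine (mem_induce _ _ _).mpr ⟨(mem_induce _ _ _).mpr ⟨a, fun y hy => ?_⟩, fun y hy => ?_⟩
          · have := b hy
            simp only [Finset.mem_sdiff, mem_union] at this ⊢
            tauto
          · have := b hy
            rw [verts_remove]
            simp only [Finset.mem_sdiff, mem_union] at this ⊢
            tauto)
    have h3 := ih hX1 (fun y hy => hdeg y (mem_insert_of_mem hy)) (k+1) (by omega) h2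
    rwa [show k + (X.card + 1) = k + 1 + X.card by omega]

/-- edges meeting `X` -/
theorem split_count (H : HGraph r) (X : Finset ℕ) (hX : X ⊆ H.verts) :
    H.edges.card + (H.verts.card - X.card).choose r ≤ 
      H.verts.card.choose r + (H.induce (H.verts \ X)).edges.card ∧
    (H.edges.card + (H.verts.card - X.card).choose r = 
      H.verts.card.choose r + (H.induce (H.verts \ X)).edges.card ↔
      ∀ e ∈ powersetCard r H.verts, ¬ Disjoint e X → e ∈ H.edges) := by
  set A := H.edges.filter (fun e => Disjoint e X) with hA
  set B := H.edges.filter (fun e => ¬ Disjoint e X) with hB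
  set C := (powersetCard r H.verts).filter (fun e => Disjoint e X) with hC
  set D := (powersetCard r H.verts).filter (fun e => ¬ Disjoint e X) with hD
  have h1 : A.card + B.card = H.edges.card := card_filter_add_card_filter_not _
  have h2 : C.card + D.card = (powersetCard r H.verts).card := card_filter_add_card_filter_not _
  rw [card_powersetCard] at h2
  have h3 : C = powersetCard r (H.verts \ X) := by
    ext e
    simp only [hC, mem_filter, mem_powersetCard, subset_sdiff]
    tauto
  have h4 : C.card = (H.verts.card - X.card).choose r := by
    rw [h3, card_powersetCard, card_sdiff_of_subset hX]
  have h5 : A = (H.induce (H.verts \ X)).edges := by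
    ext e
    rw [mem_induce, hA, mem_filter, subset_sdiff]
    constructor
    · rintro ⟨a, b⟩; exact ⟨a, H.edges_sub e a, b⟩
    · rintro ⟨a, _, b⟩; exact ⟨a, b⟩
  have h6 : B ⊆ D := filter_subset_filter _ (edges_sub_powerset H)
  have h7 := card_le_card h6
  rw [← h5, ← h4]
  refine ⟨by omega, ?_, ?_⟩
  · intro h
    have h8 : B = D := eq_of_subset_of_card_le h6 (by omega)
    intro e he hd
    have : e ∈ B := by rw [h8]; exact mem_filter.mpr ⟨he, hd⟩
    exact (mem_filter.mp this).1
  · intro h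
    have h8 : D ⊆ B := by
      intro e he
      obtain ⟨a, b⟩ := mem_filter.mp he
      exact mem_filter.mpr ⟨h e a b, b⟩
    have := card_le_card h8
    omega

end PartN

section PartO
open Finset
open scoped Classical
variable {r : ℕ}

theorem bern2 (k : ℕ) (n a δ : ℝ) (hn : 0 < n) (han : a ≤ n) (h : (k:ℝ) * a ≤ δ * n) :
    (1 - δ) * n ^ k ≤ (n - a) ^ k := by
  have h2 : 1 + (k:ℝ) * (-a / n) ≤ (1 + (-a / n)) ^ k := by
    apply one_add_mul_le_pow
    rw [le_div_iff₀ hn]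
    linarith
  have h3 : (n - a) ^ k = n ^ k * (1 + (-a / n)) ^ k := by
    rw [← mul_pow]; congr 1; field_simp; ring
  have h4 : (k:ℝ) * a / n ≤ δ := by
    rw [div_le_iff₀ hn]; exact h
  have h5 : (k:ℝ) * (-a / n) = - ((k:ℝ) * a / n) := by ring
  rw [h5] at h2
  rw [h3, mul_comm]
  gcongr
  linarith

theorem choose_diff (r a s : ℕ) (hr : 1 ≤ r) : a.choose r + s * a.choose (r-1) ≤ (a + s).choose r := by
  induction s with
  | zero => simp
  | succ s ih =>
    obtain ⟨q, rfl⟩ : ∃ q, r = q + 1 := ⟨r - 1, by omega⟩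
    simp only [Nat.add_sub_cancel] at ih ⊢
    rw [← add_assoc, Nat.choose_succ_succ']
    have : a.choose q ≤ (a + s).choose q := Nat.choose_le_choose _ (by omega)
    rw [add_mul, one_mul]
    omega

theorem tau_low (ℓ : ℕ) (hr : 1 ≤ r) (hℓ : 0 < ℓ) (m j : ℕ) (hm : ℓ ≤ m) :
    (tau r ℓ m : ℝ) + j * (r * pc r ℓ * ((m : ℝ) - ℓ) ^ (r-1)) ≤ tau r ℓ (m+j) := by
  induction j with
  | zero => simp
  | succ j ih =>
    have h1 := (tau_diff_bounds r ℓ hr hℓ (m + j) (by omega)).1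
    have hp := pc_nonneg r ℓ
    have hm' : (ℓ:ℝ) ≤ m := by exact_mod_cast hm
    have h2 : r * pc r ℓ * ((m : ℝ) - ℓ) ^ (r-1) ≤ r * pc r ℓ * (((m + j : ℕ) : ℝ) - ℓ) ^ (r-1) := by
      have : (0:ℝ) ≤ m - ℓ := by linarith
      push_cast
      gcongr
      linarith [(Nat.cast_nonneg j : (0:ℝ) ≤ j)]
    rw [← add_assoc]
    push_cast at h1 h2 ih ⊢
    linarith

theorem tau_up (ℓ : ℕ) (hr : 1 ≤ r) (hℓ : 0 < ℓ) (m j : ℕ) (hm : ℓ ≤ m) (M : ℝ) (hM : (m:ℝ) + j + ℓ ≤ M) :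
    (tau r ℓ (m+j) : ℝ) ≤ tau r ℓ m + j * (r * pc r ℓ * M ^ (r-1)) := by
  induction j with
  | zero => simp
  | succ j ih =>
    push_cast at hM
    have h1 := (tau_diff_bounds r ℓ hr hℓ (m + j) (by omega)).2
    have hp := pc_nonneg r ℓ
    have h2 : r * pc r ℓ * (((m + j : ℕ) : ℝ) + ℓ) ^ (r-1) ≤ r * pc r ℓ * M ^ (r-1) := by
      push_cast
      gcongr
      linarith
    have h3 := ih (by linarith)
    rw [← add_assoc]
    push_cast at h1 h2 h3 ⊢
    linarith

theorem tau_ge (ℓ : ℕ) (hr : 1 ≤ r) (hℓ : 0 < ℓ) (j : ℕ) :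
    pc r ℓ * (j : ℝ) ^ r ≤ tau r ℓ (ℓ + 1 + j) := by
  induction j with
  | zero => simp [show r ≠ 0 by omega]
  | succ j ih =>
    have h1 := (tau_diff_bounds r ℓ hr hℓ (ℓ + 1 + j) (by omega)).1
    have hp := pc_nonneg r ℓ
    have hj : (0:ℝ) < (j:ℝ) + 1 := by positivity
    have h2 := bern2 r ((j:ℝ)+1) 1 ((r:ℝ) / (j+1)) hj (by linarith [(Nat.cast_nonneg j : (0:ℝ) ≤ j)]) 
      (by rw [mul_one, div_mul_cancel₀ _ hj.ne'])
    have h3 : ((j:ℝ)+1) ^ r = ((j:ℝ)+1) * ((j:ℝ)+1) ^ (r-1) := by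
      rw [← pow_succ']; congr 1; omega
    have h4 : (r:ℝ) / (j+1) * ((j:ℝ)+1) ^ r = r * ((j:ℝ)+1) ^ (r-1) := by
      rw [h3]; field_simp
    have h5 : ((j:ℝ)+1) ^ r ≤ (j:ℝ) ^ r + r * ((j:ℝ)+1) ^ (r-1) := by
      rw [add_sub_cancel_right] at h2
      linarith
    have h6 : ((ℓ + 1 + j : ℕ) : ℝ) - ℓ = (j:ℝ) + 1 := by push_cast; ring
    rw [h6] at h1
    rw [← add_assoc]
    push_cast
    have := mul_le_mul_of_nonneg_left h5 hp
    linarith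

theorem choose_ge (k m : ℕ) (hm : k ≤ m) : ((m:ℝ) - k) ^ k ≤ k.factorial * (m.choose k : ℝ) := by
  have h1 := Nat.pow_sub_le_descFactorial m k
  rw [Nat.descFactorial_eq_factorial_mul_choose] at h1
  have h2 : (m - k) ^ k ≤ k.factorial * m.choose k := 
    le_trans (Nat.pow_le_pow_left (by omega) _) h1
  have h3 : (((m - k : ℕ) : ℝ)) ^ k ≤ k.factorial * (m.choose k : ℝ) := by exact_mod_cast h2
  rwa [Nat.cast_sub hm] at h3

/-- the gap -/
theorem gap_pos (ℓ : ℕ) (hr : 2 ≤ r) (hrl : r ≤ ℓ) : 0 < 1 / ((r-1).factorial : ℝ) - r * pc r ℓ := by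
  have h1 := fac_pc_lt_one r ℓ hr hrl
  have h2 : (r.factorial : ℝ) = r * (r-1).factorial := by
    rw [← Nat.mul_factorial_pred (by omega : r ≠ 0)]; push_cast; ring
  rw [h2] at h1
  have h3 : (0:ℝ) < (r-1).factorial := by exact_mod_cast Nat.factorial_pos _
  rw [sub_pos, lt_div_iff₀ h3]
  linarith

theorem real_fin (s k Q B f q ε : ℝ) (hs : 1 ≤ s) (hks : k ≤ s) (hQ : 0 ≤ Q) (hB : 0 < B) (hf : 1 ≤ f)
    (hq0 : 0 ≤ q) (hq1 : q ≤ 1) (hε : 0 < ε) (hεs : (4 + 2 * Q) * ε < 1 / f - q)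
    (fin : s * ((1 - ε) * B / f) ≤ s * (q * ((1 + 2 * ε) * B)) - (k * Q) * (q * ((1 - ε) * B))
      + k * Q * (q + ε) * B) : False := by
  set g := 1 / f with hg
  have v1 : s * ((1 - ε) * B / f) = s * B * (g - ε * g) := by rw [hg]; ring
  have v2 : s * (q * ((1 + 2 * ε) * B)) - (k * Q) * (q * ((1 - ε) * B))
      + k * Q * (q + ε) * B = s * B * (q + 2 * ε * q) + k * B * (Q * (ε * q + ε)) := by ring
  rw [v1, v2] at fin
  have h1 : ε * q + ε ≤ 2 * ε := by nlinarith
  have w1 : k * B * (Q * (ε * q + ε)) ≤ s * B * (Q * (2 * ε)) := by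
    have h0 : 0 ≤ ε * q + ε := by positivity
    gcongr
  have hsB : 0 < s * B := by positivity
  have w2 : s * B * (g - ε * g) ≤ s * B * (q + 2 * ε * q + Q * (2 * ε)) := by
    have : s * B * (q + 2 * ε * q + Q * (2 * ε)) = s * B * (q + 2 * ε * q) + s * B * (Q * (2 * ε)) := by ring
    linarith
  have w3 := le_of_mul_le_mul_left w2 hsB
  have hf2 : g ≤ 1 := by rw [hg, div_le_one (by linarith)]; exact hf
  have w4 : ε * g ≤ ε := by nlinarith
  have w5 : 2 * ε * q ≤ 2 * ε := by nlinarith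
  linarith

set_option maxHeartbeats 1600000 in
/-- the final arithmetic: if `s ≥ 1` there is a contradiction -/
theorem final_arith (ℓ Q : ℕ) (hr : 2 ≤ r) (hrl : r ≤ ℓ) (ε : ℝ) (hε : 0 < ε) 
    (hεs : (4 + 2 * Q) * ε < 1 / ((r-1).factorial : ℝ) - r * pc r ℓ) (hε1 : ε ≤ 1/2)
    (n x s k : ℕ) (hks : k ≤ s) (hs : 1 ≤ s) 
    (hA : ((r:ℝ)) * (x + s + k * Q + ℓ + r) ≤ ε * n)
    (h : ((n - x).choose r : ℝ) - (n - (x + s)).choose r ≤ (tau r ℓ (n - x - k * Q) : ℝ) - tau r ℓ (n - (x + s))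
      + k * Q * (r * pc r ℓ + ε) * (n:ℝ) ^ (r-1)) : False := by
  have hr1 : (2:ℝ) ≤ r := by exact_mod_cast hr
  have hA' : ((x:ℝ) + s + k * Q + ℓ + r) ≤ n / 2 := by
    have h0 : (0:ℝ) ≤ (x:ℝ) + s + k * Q + ℓ + r := by positivity
    nlinarith [(Nat.cast_nonneg n : (0:ℝ) ≤ n)]
  have hnat : x + s + k * Q + ℓ + r ≤ n := by
    have : ((x + s + k * Q + ℓ + r : ℕ) : ℝ) ≤ n := by
      push_cast
      linarith [(Nat.cast_nonneg n : (0:ℝ) ≤ n)]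
    exact_mod_cast this
  have hn0 : (0:ℝ) < n := by
    have : 0 < n := by omega
    exact_mod_cast this
  set B := (n:ℝ) ^ (r-1) with hB
  have hB0 : 0 < B := by positivity
  set p := pc r ℓ with hp
  have hp0 : 0 ≤ r * p := mul_nonneg (Nat.cast_nonneg _) (pc_nonneg _ _)
  have hp1 : r * p ≤ 1 := pc_le_one r ℓ hr hrl
  set f : ℝ := ((r-1).factorial : ℝ) with hf
  have hf1 : 1 ≤ f := by
    rw [hf]; exact_mod_cast (Nat.factorial_pos (r-1))
  have hx0 : (0:ℝ) ≤ x := Nat.cast_nonneg _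
  have hs0 : (1:ℝ) ≤ s := by exact_mod_cast hs
  have hk0 : (0:ℝ) ≤ k := Nat.cast_nonneg _
  have hQ0 : (0:ℝ) ≤ Q := Nat.cast_nonneg _
  have hkQ : (0:ℝ) ≤ (k:ℝ) * Q := by positivity
  have hl0 : (0:ℝ) ≤ ℓ := Nat.cast_nonneg _
  have hrk : ((r - 1 : ℕ) : ℝ) ≤ r := by exact_mod_cast (by omega : r - 1 ≤ r)
  have hrk0 : (0:ℝ) ≤ ((r - 1 : ℕ) : ℝ) := Nat.cast_nonneg _
  have small : ∀ a : ℝ, 0 ≤ a → a ≤ (x:ℝ) + s + k * Q + ℓ + r → (1 - ε) * B ≤ (n - a) ^ (r-1) := by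
    intro a ha0 ha
    refine bern2 (r-1) n a ε hn0 (by linarith) ?_
    calc ((r-1 : ℕ) : ℝ) * a ≤ r * ((x:ℝ) + s + k * Q + ℓ + r) := by gcongr
      _ ≤ _ := hA
  -- (a)
  have e1 := choose_diff r (n - (x+s)) s (by omega)
  rw [show n - (x + s) + s = n - x by omega] at e1
  have e1' : ((n - (x+s)).choose r : ℝ) + s * ((n - (x+s)).choose (r-1) : ℝ) ≤ (n - x).choose r := by exact_mod_cast e1
  have e2 := choose_ge (r-1) (n - (x+s)) (by omega)
  have e3 : (1 - ε) * B ≤ (((n - (x+s) : ℕ) : ℝ) - ((r-1 : ℕ) : ℝ)) ^ (r-1) := by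
    rw [Nat.cast_sub (by omega)]
    have := small ((x:ℝ) + s + ((r-1 : ℕ) : ℝ)) (by positivity) (by linarith)
    refine this.trans (le_of_eq ?_)
    congr 1; push_cast; ring
  have e4 : (1 - ε) * B / f ≤ (n - (x+s)).choose (r-1) := by
    rw [div_le_iff₀ (by linarith)]
    linarith
  -- tau low
  have t1 := tau_low (r := r) ℓ (by omega) (by omega) (n - x - k * Q) (k * Q) (by omega)
  rw [show n - x - k * Q + k * Q = n - x by omega] at t1
  have t2 : (1 - ε) * B ≤ (((n - x - k * Q : ℕ) : ℝ) - ℓ) ^ (r-1) := by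
    rw [Nat.sub_sub, Nat.cast_sub (by omega)]
    have := small ((x:ℝ) + k * Q + ℓ) (by positivity) (by linarith)
    refine this.trans (le_of_eq ?_)
    congr 1; push_cast; ring
  have t3 : (k * Q : ℝ) * (r * p * ((1 - ε) * B)) ≤ ((k * Q : ℕ) : ℝ) * (r * p * (((n - x - k * Q : ℕ) : ℝ) - ℓ) ^ (r-1)) := by
    push_cast
    gcongr
  -- tau up
  have u1 := tau_up (r := r) ℓ (by omega) (by omega) (n - (x+s)) s (by omega) (n + ℓ) (by
    rw [Nat.cast_sub (by omega)]; push_cast; linarith)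
  rw [show n - (x + s) + s = n - x by omega] at u1
  have u2 : (1 - ε) * ((n:ℝ) + ℓ) ^ (r-1) ≤ B := by
    have := bern2 (r-1) ((n:ℝ)+ℓ) ℓ ε (by positivity) (by linarith) (by
      calc ((r-1 : ℕ) : ℝ) * ℓ ≤ r * ((x:ℝ) + s + k * Q + ℓ + r) := by gcongr; linarith
        _ ≤ ε * n := hA
        _ ≤ _ := by gcongr; linarith)
    rwa [add_sub_cancel_right] at this
  have u3 : ((n:ℝ) + ℓ) ^ (r-1) ≤ (1 + 2 * ε) * B := by
    have h1 : 0 ≤ ((n:ℝ) + ℓ) ^ (r-1) := by positivity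
    have h2 : 1 ≤ (1 + 2 * ε) * (1 - ε) := by nlinarith
    calc ((n:ℝ) + ℓ) ^ (r-1) ≤ ((1 + 2 * ε) * (1 - ε)) * ((n:ℝ) + ℓ) ^ (r-1) := by nlinarith
      _ = (1 + 2 * ε) * ((1 - ε) * ((n:ℝ) + ℓ) ^ (r-1)) := by ring
      _ ≤ _ := by gcongr
  have u4 : (s:ℝ) * (r * p * ((n:ℝ) + ℓ) ^ (r-1)) ≤ s * (r * p * ((1 + 2 * ε) * B)) := by gcongr
  have u5 : (s:ℝ) * ((1 - ε) * B / f) ≤ s * (n - (x+s)).choose (r-1) := by gcongr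
  have fin : (s:ℝ) * ((1 - ε) * B / f) ≤ s * (r * p * ((1 + 2 * ε) * B)) - (k * Q : ℝ) * (r * p * ((1 - ε) * B))
      + k * Q * (r * p + ε) * B := by linarith
  exact real_fin s k Q B f (r * p) ε hs0 (by exact_mod_cast hks) hQ0 hB0 hf1 hp0 hp1 hε hεs fin

end PartO

section PartP
open Finset
open scoped Classical
variable {r : ℕ}

theorem max_match (P : ℕ → Prop) (h0 : P 0) (m : ℕ) : ∃ k, k ≤ m ∧ P k ∧ (k < m → ¬ P (k+1)) := by
  induction m with
  | zero => exact ⟨0, le_rfl, h0, fun h => absurd h (lt_irrefl _)⟩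
  | succ m ih =>
    obtain ⟨k, h1, h2, h3⟩ := ih
    by_cases hk : k < m
    · exact ⟨k, by omega, h2, fun _ => h3 hk⟩
    · have : k = m := by omega
      subst this
      by_cases h : P (k+1)
      · exact ⟨k+1, le_rfl, h, fun h => absurd h (lt_irrefl _)⟩
      · exact ⟨k, by omega, h2, fun _ => h⟩

set_option maxHeartbeats 1600000 in
theorem main_upper (ℓ : ℕ) (F : HGraph r) (hy : Hyp ℓ F) :
    ∃ N : ℕ, ∃ c : ℝ, 0 < c ∧ ∀ H : HGraph r, N ≤ H.verts.card → ∀ t : ℕ, (t:ℝ) ≤ c * H.verts.card →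
      t + ℓ ≤ H.verts.card ∧ (¬ F.expansion.HasMatching H (t+1) →
      H.verts.card.choose r + tau r ℓ (H.verts.card - t) ≤ H.edges.card + (H.verts.card - t).choose r →
      ∃ X : Finset ℕ, X ⊆ H.verts ∧ X.card = t ∧ 
        H.edges.card + (H.verts.card - t).choose r = H.verts.card.choose r + tau r ℓ (H.verts.card - t) ∧
        (∀ e ∈ powersetCard r H.verts, ¬ Disjoint e X → e ∈ H.edges) ∧
        (H.induce (H.verts \ X)).edges.card = tau r ℓ (H.verts.card - t) ∧
        IsKlSub r ℓ (H.induce (H.verts \ X))) := by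
  have hr := hy.hr
  have hrl := hy.hrl
  have hγ := gap_pos (r := r) ℓ hr hrl
  set γ := 1 / ((r-1).factorial : ℝ) - r * pc r ℓ with hγd
  set Q := F.expansion.verts.card with hQ
  have hQ0 : (0:ℝ) ≤ Q := Nat.cast_nonneg _
  set ε := min (1/2) (γ / (2 * (4 + 2 * Q))) with hεd
  have hε : 0 < ε := by positivity
  have hε1 : ε ≤ 1/2 := min_le_left _ _
  have hεs : (4 + 2 * Q) * ε < γ := by
    have h1 : ε ≤ γ / (2 * (4 + 2 * Q)) := min_le_right _ _
    rw [le_div_iff₀ (by positivity)] at h1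
    linarith
  obtain ⟨δ, hδ, N1, hext⟩ := extend ℓ F hy ε hε
  obtain ⟨N2, hex⟩ := exact_turan ℓ F hy
  set μ := min δ ε with hμd
  have hμ : 0 < μ := by positivity
  have hμδ : μ ≤ δ := min_le_left _ _
  have hμε : μ ≤ ε := min_le_right _ _
  have hr0 : (2:ℝ) ≤ r := by exact_mod_cast hr
  have hpc := pc_nonneg r ℓ
  have hpc1 : pc r ℓ ≤ 1 := by
    have := pc_le_one r ℓ hr hrl
    nlinarith
  refine ⟨N1 + 2 * N2 + 1 + ⌈((r * (Q + 1 + ℓ + r) : ℕ) : ℝ) / (μ / 2)⌉₊, μ / (2 * r * (Q + 1)), by positivity, ?_⟩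
  intro H hn t ht
  set n := H.verts.card with hnd
  have hbig := big_mul (μ / 2) _ (by positivity) n (by omega : ⌈((r * (Q + 1 + ℓ + r) : ℕ) : ℝ) / (μ / 2)⌉₊ ≤ n)
  have hn0 : (0:ℝ) < n := by
    have : 0 < n := by omega
    exact_mod_cast this
  have ht' : (r:ℝ) * (t * (Q + 1)) ≤ μ / 2 * n := by
    have h1 : (t:ℝ) * (2 * r * (Q + 1)) ≤ μ * n := by
      calc _ ≤ (μ / (2 * r * (Q + 1)) * n) * (2 * r * (Q + 1)) := by gcongr
        _ = _ := by field_simp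
    linarith
  set D := (t + 1) * (Q + 1) + ℓ + r with hD
  have hDr : (r:ℝ) * D ≤ μ * n := by
    rw [hD]; push_cast at hbig ⊢; linarith
  have hD0 : (0:ℝ) ≤ D := Nat.cast_nonneg _
  have hD1 : (2:ℝ) * D ≤ μ * n := by nlinarith
  have hD2 : (2:ℝ) * D ≤ n := by nlinarith
  have hD3 : 2 * D ≤ n := by exact_mod_cast hD2
  have hDe : D = t * Q + t + Q + 1 + ℓ + r := by rw [hD]; ring
  refine ⟨by omega, ?_⟩
  intro hmat he
  -- density
  have hchle : (n - t).choose r ≤ n.choose r := Nat.choose_le_choose _ (by omega)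
  have hetau : tau r ℓ (n - t) ≤ H.edges.card := by omega
  have hdense : (pc r ℓ - δ) * (n:ℝ) ^ r ≤ H.edges.card := by
    have h1 := tau_ge (r := r) ℓ (by omega) (by omega) (n - t - (ℓ + 1))
    rw [show ℓ + 1 + (n - t - (ℓ + 1)) = n - t by omega] at h1
    have h2 := bern2 r n (t + (ℓ + 1)) δ hn0 (by
      have : ((t + (ℓ + 1) : ℕ) : ℝ) ≤ n := by exact_mod_cast (by omega : t + (ℓ + 1) ≤ n)
      push_cast at this; exact this) (by
      have h3 : ((t + (ℓ + 1) : ℕ) : ℝ) ≤ D := by exact_mod_cast (by omega : t + (ℓ + 1) ≤ D)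
      push_cast at h3
      calc (r:ℝ) * (t + (ℓ + 1)) ≤ r * D := by gcongr
        _ ≤ μ * n := hDr
        _ ≤ δ * n := by gcongr)
    have h4 : (((n - t - (ℓ + 1) : ℕ)) : ℝ) = n - (t + (ℓ + 1)) := by
      rw [Nat.sub_sub, Nat.cast_sub (by omega)]; push_cast; ring
    rw [h4] at h1
    have h5 : (tau r ℓ (n - t) : ℝ) ≤ H.edges.card := by exact_mod_cast hetau
    have h6 : 0 ≤ (n:ℝ) ^ r := by positivity
    have h7 := mul_le_mul_of_nonneg_left h2 hpc
    have h8 : (pc r ℓ - δ) * (n:ℝ) ^ r ≤ pc r ℓ * ((1 - δ) * (n:ℝ) ^ r) := by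
      rw [← mul_assoc]
      gcongr
      nlinarith
    linarith
  have hext' := hext H (by omega) hdense t (by
    have h3 : (((t + 1) * (Q + 1) : ℕ) : ℝ) ≤ D := by exact_mod_cast (by omega : (t+1) * (Q+1) ≤ D)
    calc _ ≤ (D:ℝ) := h3
      _ ≤ μ * n := by linarith
      _ ≤ δ * n := by gcongr)
  set X := H.verts.filter (fun x => (r * pc r ℓ + ε) * (n : ℝ) ^ (r-1) < H.deg x) with hX
  have hXs : X ⊆ H.verts := filter_subset _ _
  have hXd : ∀ x ∈ X, (r * pc r ℓ + ε) * (n : ℝ) ^ (r-1) < H.deg x := fun x hx => (mem_filter.mp hx).2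
  have hXt : X.card ≤ t := by
    by_contra hcon
    obtain ⟨X0, h1, h2⟩ := exists_subset_card_eq (show t + 1 ≤ X.card by omega)
    have h3 := hext' X0 (h1.trans hXs) (fun x hx => hXd x (h1 hx)) 0 (by omega) (match_zero _ _)
    rw [h2, zero_add] at h3
    exact hmat h3
  obtain ⟨k, hk1, hk2, hk3⟩ := max_match (fun k => F.expansion.HasMatching (H.induce (H.verts \ X)) k)
    (match_zero _ _) (t - X.card)
  have hk4 : ¬ F.expansion.HasMatching (H.induce (H.verts \ X)) (k+1) := by
    intro hcon
    rcases Nat.lt_or_ge k (t - X.card) with h | h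
    · exact hk3 h hcon
    · have h3 := hext' X hXs hXd (k+1) (by omega) hcon
      rw [show k + 1 + X.card = t + 1 by omega] at h3
      exact hmat h3
  obtain ⟨W, w1, w2, w3⟩ := match_ext _ _ _ hk2
  rw [← hQ] at w2
  set G := H.induce (H.verts \ X) with hG
  have hGv : G.verts = H.verts \ X := verts_remove H X
  have hGc : G.verts.card = n - X.card := by rw [hGv, card_sdiff_of_subset hXs]
  have hfree : ¬ F.expansion.IsCopyIn (G.induce (G.verts \ W)) := fun hc =>
    hk4 (w3 G subset_rfl subset_rfl hc)
  have hkQ : k * Q ≤ t * Q := Nat.mul_le_mul_right _ (by omega)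
  have hGW : (G.induce (G.verts \ W)).verts.card = n - X.card - W.card := by
    rw [verts_remove, card_sdiff_of_subset w1, hGc]
  have hGe := (hex (G.induce (G.verts \ W)) (by rw [hGW]; omega) hfree).1
  rw [hGW] at hGe
  have hrem := card_remove G W
  have hspl := split_count H X hXs
  rw [← hG, ← hnd] at hspl
  have hdegW : ∀ w ∈ W, (G.deg w : ℝ) ≤ (r * pc r ℓ + ε) * (n : ℝ) ^ (r-1) := by
    intro w hw
    have h1 := w1 hw
    rw [hGv] at h1
    obtain ⟨h2, h3⟩ := Finset.mem_sdiff.mp h1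
    have h4 : ¬ (r * pc r ℓ + ε) * (n : ℝ) ^ (r-1) < H.deg w := fun hh => h3 (mem_filter.mpr ⟨h2, hh⟩)
    have h5 : (G.deg w : ℝ) ≤ H.deg w := by exact_mod_cast induce_deg_le H _ w
    linarith
  obtain ⟨s, hs⟩ : ∃ s, X.card + s = t := ⟨t - X.card, by omega⟩
  rcases Nat.eq_zero_or_pos s with hs0 | hs0
  · -- the tight case
    have hXc : X.card = t := by omega
    have hk0 : k = 0 := by omega
    have hW0 : W = ∅ := by
      rw [← card_eq_zero, w2, hk0, zero_mul]
    rw [hW0] at hGe hrem hfree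
    rw [sum_empty, add_zero] at hrem
    rw [card_empty, Nat.sub_zero, hXc] at hGe
    rw [hXc] at hspl
    have hGt : G.edges.card = tau r ℓ (n - t) := by omega
    have hGfree : ¬ F.expansion.IsCopyIn G := by
      intro hc
      apply hfree
      refine copy_mono _ _ _ ?_ ?_ hc
      · rw [verts_remove G ∅, sdiff_empty]
      · intro e he
        rw [sdiff_empty]
        exact (mem_induce _ _ _).mpr ⟨he, G.edges_sub e he⟩
    have heq : H.edges.card + (n - t).choose r = n.choose r + G.edges.card := by omega
    refine ⟨X, hXs, hXc, by omega, hspl.2.mp heq, hGt, ?_⟩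
    have hGc' : G.verts.card = n - t := by rw [hGc, hXc]
    exact (hex G (by omega) hGfree).2 (by rw [hGc']; exact hGt)
  · exfalso
    have hsum : ((∑ w ∈ W, G.deg w : ℕ) : ℝ) ≤ k * Q * (r * pc r ℓ + ε) * (n : ℝ) ^ (r-1) := by
      push_cast
      refine (sum_le_card_nsmul _ _ _ hdegW).trans (le_of_eq ?_)
      rw [w2, nsmul_eq_mul]
      push_cast
      ring
    rw [w2] at hGe
    rw [← hs] at he
    have h1 : (n.choose r : ℝ) + tau r ℓ (n - (X.card + s)) ≤ H.edges.card + (n - (X.card + s)).choose r := by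
      exact_mod_cast he
    have h2 : (H.edges.card : ℝ) + (n - X.card).choose r ≤ n.choose r + G.edges.card := by
      exact_mod_cast hspl.1
    have h3 : (G.edges.card : ℝ) ≤ (G.induce (G.verts \ W)).edges.card + ((∑ w ∈ W, G.deg w : ℕ) : ℝ) := by
      exact_mod_cast hrem
    have h4 : ((G.induce (G.verts \ W)).edges.card : ℝ) ≤ tau r ℓ (n - X.card - k * Q) := by
      exact_mod_cast hGe
    refine final_arith ℓ Q hr hrl ε hε hεs hε1 n X.card s k (by omega) hs0 ?_ (by linarith)
    have h5 : X.card + s + k * Q + ℓ + r ≤ D := by omega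
    have h6 : ((X.card + s + k * Q + ℓ + r : ℕ) : ℝ) ≤ D := by exact_mod_cast h5
    push_cast at h6
    calc _ ≤ (r:ℝ) * D := by gcongr
      _ ≤ μ * n := hDr
      _ ≤ ε * n := by gcongr

end PartP

section PartQ
open Finset
open scoped Classical
variable {r : ℕ}

/-- the target graph -/
def tgt (r ℓ n t : ℕ) : HGraph r := (completeOn r (range t)).join (turanOn r ℓ (Ico t n))

theorem tgt_verts (ℓ n t : ℕ) (ht : t ≤ n) : (tgt r ℓ n t).verts = range n := by
  ext v
  simp only [tgt, HGraph.join, HGraph.ofEdges, completeOn, turanOn, mem_union, mem_range, mem_Ico]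
  omega

theorem tgt_edges (hr : 1 ≤ r) (ℓ n t : ℕ) (ht : t ≤ n) (e : Finset ℕ) :
    e ∈ (tgt r ℓ n t).edges ↔ e ⊆ range n ∧ e.card = r ∧ 
      (¬ Disjoint e (range t) ∨ e ∈ rb (fun v => v % ℓ) (Ico t n) r) := by
  have hv : range t ∪ Ico t n = range n := by
    ext v; simp only [mem_union, mem_range, mem_Ico]; omega
  have h1 : e ∈ (tgt r ℓ n t).edges ↔ ((e ∈ (completeOn r (range t)).edges ∨ e ∈ (turanOn r ℓ (Ico t n)).edges) ∨
      (e ∈ powersetCard r (range t ∪ Ico t n) ∧ (e ∩ range t).Nonempty ∧ (e ∩ Ico t n).Nonempty)) ∧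
      e ⊆ range t ∪ Ico t n ∧ e.card = r := by
    change e ∈ (HGraph.join _ _).edges ↔ _
    simp only [HGraph.join, HGraph.ofEdges, mem_filter, mem_union]
    rfl
  rw [h1, turan_edges, hv]
  have h2 : e ∈ (completeOn r (range t)).edges ↔ e ⊆ range t ∧ e.card = r := by
    simp only [completeOn, HGraph.ofEdges, mem_filter, mem_powersetCard]
    tauto
  rw [h2]
  have hnd : ¬ Disjoint e (range t) ↔ (e ∩ range t).Nonempty := by
    rw [disjoint_iff_inter_eq_empty, ← ne_eq, nonempty_iff_ne_empty]
  constructor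
  · rintro ⟨h, ha, hb⟩
    refine ⟨ha, hb, ?_⟩
    rcases h with (⟨h, _⟩ | h) | ⟨_, h, _⟩
    · left
      rw [hnd, inter_eq_left.mpr h]
      rw [← card_pos]; omega
    · exact Or.inr h
    · exact Or.inl (hnd.mpr h)
  · rintro ⟨ha, hb, h⟩
    refine ⟨?_, ha, hb⟩
    rcases h with h | h
    · by_cases hx : (e ∩ Ico t n).Nonempty
      · exact Or.inr ⟨mem_powersetCard.mpr ⟨ha, hb⟩, hnd.mp h, hx⟩
      · refine Or.inl (Or.inl ⟨?_, hb⟩)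
        intro v hv'
        by_contra hcon
        apply hx
        refine ⟨v, mem_inter.mpr ⟨hv', ?_⟩⟩
        have := ha hv'
        rw [mem_range] at this hcon
        rw [mem_Ico]; omega
    · exact Or.inl (Or.inr h)

theorem sdiff_range (n t : ℕ) : range n \ range t = Ico t n := by
  ext v; simp only [Finset.mem_sdiff, mem_range, mem_Ico]; omega

theorem tgt_card (hr : 1 ≤ r) (ℓ n t : ℕ) (hℓ : 0 < ℓ) (ht : t ≤ n) :
    (tgt r ℓ n t).edges.card + (n - t).choose r = n.choose r + tau r ℓ (n - t) := by
  have h1 := (split_count (tgt r ℓ n t) (range t) (by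
    rw [tgt_verts ℓ n t ht]; exact range_subset_range.mpr ht)).2
  rw [tgt_verts ℓ n t ht, card_range, card_range] at h1
  have h2 := h1.mpr (by
    intro e he hd
    obtain ⟨a, b⟩ := mem_powersetCard.mp he
    exact (tgt_edges hr ℓ n t ht e).mpr ⟨a, b, Or.inl hd⟩)
  rw [h2]
  congr 1
  rw [← card_turan (r := r) ℓ hℓ t n ht, turan_edges]
  congr 1
  ext e
  rw [mem_induce, tgt_edges hr ℓ n t ht, sdiff_range]
  constructor
  · rintro ⟨⟨_, _, h⟩, hs⟩
    rcases h with h | h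
    · exfalso
      apply h
      rw [disjoint_left]
      intro v hv hv'
      have := hs hv
      rw [mem_Ico] at this
      rw [mem_range] at hv'
      omega
    · exact h
  · intro h
    obtain ⟨a, b, _⟩ := mem_rb.mp h
    refine ⟨⟨a.trans ?_, b, Or.inr h⟩, a⟩
    rw [← sdiff_range]; exact sdiff_subset

theorem tgt_match (ℓ : ℕ) (F : HGraph r) (hy : Hyp ℓ F) (n t : ℕ) (ht : t ≤ n) :
    ¬ F.expansion.HasMatching (tgt r ℓ n t) (t+1) := by
  have hr := hy.hr
  have hrl := hy.hrl
  rintro ⟨S, h1, h2, h3⟩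
  have hmeet : ∀ i, ∃ v ∈ S i, v ∈ range t := by
    intro i
    by_contra hcon
    push Not at hcon
    apply exp_free_of_KFree F (turanOn r ℓ (Ico t n)) hr
      (KFree_of_KlSub ℓ F _ hy.hF (turan_kl ℓ (by omega) _))
    have hS : S i ⊆ Ico t n := by
      intro v hv
      have h4 := (h1 i).1 hv
      rw [tgt_verts ℓ n t ht, mem_range] at h4
      have h5 := hcon v hv
      rw [mem_range] at h5
      rw [mem_Ico]; omega
    refine copy_mono _ _ _ ?_ ?_ (h3 i)
    · rw [induce_verts]
      exact inter_subset_right.trans hS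
    · intro e he
      obtain ⟨a, b⟩ := (mem_induce _ _ _).mp he
      obtain ⟨_, _, c⟩ := (tgt_edges (by omega) ℓ n t ht e).mp a
      rw [turan_edges]
      rcases c with c | c
      · exfalso
        apply c
        rw [disjoint_left]
        intro v hv
        exact hcon v (b hv)
      · exact c
  choose g hg1 hg2 using hmeet
  have hinj : Function.Injective g := by
    intro i j hij
    by_contra hne
    exact disjoint_left.mp (h2 i j hne) (hg1 i) (hij ▸ hg1 j)
  have h4 : (univ.image g).card ≤ (range t).card := card_le_card (by
    intro v hv
    obtain ⟨i, _, rfl⟩ := mem_image.mp hv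
    exact hg2 i)
  rw [card_image_of_injective _ hinj, card_univ, Fintype.card_fin, card_range] at h4
  omega

theorem iso_verts (G H : HGraph r) (h : G.Iso H) : G.verts.card = H.verts.card := by
  obtain ⟨f, hf, _⟩ := h
  have h1 : G.verts.image f = H.verts := by
    apply coe_injective
    rw [coe_image]
    exact hf.image_eq
  rw [← h1, card_image_of_injOn hf.injOn]

theorem iso_edges (G H : HGraph r) (h : G.Iso H) : G.edges.card = H.edges.card := by
  obtain ⟨f, hf, hfe⟩ := h
  have h1 : G.edges.image (fun e => e.image f) = H.edges := by
    ext e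
    constructor
    · intro he
      obtain ⟨e', he', rfl⟩ := mem_image.mp he
      exact (hfe e' (edges_sub_powerset G he')).mp he'
    · intro he
      have hs := H.edges_sub e he
      set e' := G.verts.filter (fun v => f v ∈ e) with he'
      have h2 : e'.image f = e := by
        ext w
        constructor
        · intro hw
          obtain ⟨v, hv, rfl⟩ := mem_image.mp hw
          exact (mem_filter.mp hv).2
        · intro hw
          obtain ⟨v, hv, rfl⟩ := hf.surjOn (mem_coe.mpr (hs hw))
          exact mem_image_of_mem _ (mem_filter.mpr ⟨mem_coe.mp hv, hw⟩)
      have h3 : e' ⊆ G.verts := filter_subset _ _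
      have h4 : e'.card = r := by
        rw [← H.edges_card e he, ← h2, card_image_of_injOn (hf.injOn.mono (coe_subset.mpr h3))]
      refine mem_image.mpr ⟨e', (hfe e' (mem_powersetCard.mpr ⟨h3, h4⟩)).mpr (by rw [h2]; exact he), h2⟩
  rw [← h1, card_image_of_injOn]
  intro a ha b hb hab
  have ha' := G.edges_sub a (mem_coe.mp ha)
  have hb' := G.edges_sub b (mem_coe.mp hb)
  apply coe_injective
  refine (hf.injOn.image_eq_image_iff (coe_subset.mpr ha') (coe_subset.mpr hb')).mp ?_
  have := congrArg (fun s : Finset ℕ => (s : Set ℕ)) hab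
  simpa using this

theorem iso_match (E G H : HGraph r) (h : G.Iso H) (k : ℕ) (hm : E.HasMatching G k) : E.HasMatching H k := by
  obtain ⟨f, hf, hfe⟩ := h
  obtain ⟨S, h1, h2, h3⟩ := hm
  refine ⟨fun i => (S i).image f, fun i => ⟨?_, ?_⟩, fun i j hij => ?_, fun i => ?_⟩
  · intro w hw
    obtain ⟨v, hv, rfl⟩ := mem_image.mp hw
    exact mem_coe.mp (hf.mapsTo (mem_coe.mpr ((h1 i).1 hv)))
  · rw [card_image_of_injOn (hf.injOn.mono (coe_subset.mpr (h1 i).1)), (h1 i).2]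
  · rw [disjoint_left]
    intro w hw hw'
    obtain ⟨v, hv, rfl⟩ := mem_image.mp hw
    obtain ⟨v', hv', he⟩ := mem_image.mp hw'
    have := hf.injOn (mem_coe.mpr ((h1 j).1 hv')) (mem_coe.mpr ((h1 i).1 hv)) he
    subst this
    exact disjoint_left.mp (h2 i j hij) hv hv'
  · obtain ⟨g, g1, g2, g3⟩ := h3 i
    have hg : ∀ v ∈ E.verts, g v ∈ G.verts ∧ g v ∈ S i := by
      intro v hv
      have := g2 v hv
      rw [induce_verts] at this
      exact mem_inter.mp this
    refine ⟨f ∘ g, ?_, ?_, ?_⟩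
    · intro a ha b hb hab
      exact g1 ha hb (hf.injOn (mem_coe.mpr (hg a ha).1) (mem_coe.mpr (hg b hb).1) hab)
    · intro v hv
      rw [induce_verts]
      exact mem_inter.mpr ⟨mem_coe.mp (hf.mapsTo (mem_coe.mpr (hg v hv).1)), mem_image_of_mem _ (hg v hv).2⟩
    · intro e he
      obtain ⟨a, b⟩ := (mem_induce _ _ _).mp (g3 e he)
      rw [mem_induce, ← image_image]
      exact ⟨(hfe _ (edges_sub_powerset G a)).mp a, image_subset_image b⟩

theorem iso_tgt (ℓ n t : ℕ) (hr : 2 ≤ r) (hrl : r ≤ ℓ) (ht : t + ℓ ≤ n) (H : HGraph r) (hn : H.verts.card = n)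
    (X : Finset ℕ) (hX : X ⊆ H.verts) (hXc : X.card = t)
    (hfull : ∀ e ∈ powersetCard r H.verts, ¬ Disjoint e X → e ∈ H.edges)
    (he : (H.induce (H.verts \ X)).edges.card = tau r ℓ (n - t))
    (hk : IsKlSub r ℓ (H.induce (H.verts \ X))) : H.Iso (tgt r ℓ n t) := by
  have hc : (H.verts \ X).card = n - t := by rw [card_sdiff_of_subset hX, hn, hXc]
  obtain ⟨c, c1, c2, c3⟩ := kl_eq ℓ hr hrl _ hk (by rw [verts_remove, hc]; omega) (by rw [verts_remove, hc]; exact he)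
  rw [verts_remove] at c1 c2 c3
  obtain ⟨f, f1, f2⟩ := exists_colour_bij ℓ (by omega) (H.verts \ X) c c1 c3 t n (by omega) hc
  obtain ⟨g, g1⟩ := bij_of_card X (range t) (by rw [hXc, card_range])
  have hdis : Disjoint X (H.verts \ X) := disjoint_sdiff
  have hdis2 : Disjoint (range t) (Ico t n) := by rw [← sdiff_range]; exact disjoint_sdiff
  have hbij := bij_union g1 f1 hdis hdis2
  rw [union_sdiff_of_subset hX, ← sdiff_range, union_sdiff_of_subset (range_subset_range.mpr (by omega : t ≤ n))] at hbij
  set φ := (fun x => if x ∈ X then g x else f x) with hφ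
  refine ⟨φ, by rw [tgt_verts ℓ n t (by omega)]; exact hbij, ?_⟩
  intro e hee
  obtain ⟨e1, e2⟩ := mem_powersetCard.mp hee
  have hinj : Set.InjOn φ e := hbij.injOn.mono (coe_subset.mpr e1)
  have hsub : e.image φ ⊆ range n := by
    intro w hw
    obtain ⟨v, hv, rfl⟩ := mem_image.mp hw
    exact mem_coe.mp (hbij.mapsTo (mem_coe.mpr (e1 hv)))
  have hcard : (e.image φ).card = r := by rw [card_image_of_injOn hinj, e2]
  rw [tgt_edges (by omega) ℓ n t (by omega)]
  by_cases hd : Disjoint e X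
  · have hes : e ⊆ H.verts \ X := subset_sdiff.mpr ⟨e1, hd⟩
    have hφf : ∀ v ∈ e, φ v = f v := fun v hv => by
      rw [hφ]; exact if_neg (disjoint_left.mp hd hv)
    have him : e.image φ ⊆ Ico t n := by
      intro w hw
      obtain ⟨v, hv, rfl⟩ := mem_image.mp hw
      rw [hφf v hv]
      exact mem_coe.mp (f1.mapsTo (mem_coe.mpr (hes hv)))
    have h1 : e ∈ H.edges ↔ Set.InjOn c e := by
      have : e ∈ H.edges ↔ e ∈ (H.induce (H.verts \ X)).edges := by
        rw [mem_induce]; exact ⟨fun h => ⟨h, hes⟩, fun h => h.1⟩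
      rw [this, c2, mem_rb]
      exact ⟨fun h => h.2.2, fun h => ⟨hes, e2, h⟩⟩
    rw [h1]
    constructor
    · intro hci
      refine ⟨hsub, hcard, Or.inr (mem_rb.mpr ⟨him, hcard, ?_⟩)⟩
      intro a ha b hb hab
      obtain ⟨u, hu, rfl⟩ := mem_image.mp (mem_coe.mp ha)
      obtain ⟨v, hv, rfl⟩ := mem_image.mp (mem_coe.mp hb)
      have hab' : φ u % ℓ = φ v % ℓ := hab
      rw [hφf u hu, hφf v hv] at hab'
      rw [hci (mem_coe.mpr hu) (mem_coe.mpr hv) ((f2 u (hes hu) v (hes hv)).mpr hab')]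
    · rintro ⟨_, _, h | h⟩
      · exfalso
        exact h (hdis2.symm.mono_left him)
      · obtain ⟨_, _, hi⟩ := mem_rb.mp h
        intro u hu v hv huv
        have hu' := mem_coe.mp hu
        have hv' := mem_coe.mp hv
        have h4 := (f2 u (hes hu') v (hes hv')).mp huv
        rw [← hφf u hu', ← hφf v hv'] at h4
        exact hinj hu hv (hi (mem_coe.mpr (mem_image_of_mem _ hu')) (mem_coe.mpr (mem_image_of_mem _ hv')) h4)
  · refine ⟨fun _ => ⟨hsub, hcard, Or.inl ?_⟩, fun _ => hfull e hee hd⟩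
    obtain ⟨v, hv, hvX⟩ := not_disjoint_iff.mp hd
    refine not_disjoint_iff.mpr ⟨φ v, mem_image_of_mem _ hv, ?_⟩
    have : φ v = g v := by rw [hφ]; exact if_pos hvX
    rw [this]
    exact mem_coe.mp (g1.mapsTo (mem_coe.mpr hvX))

theorem main_thm (ℓ : ℕ) (F : HGraph r) (hy : Hyp ℓ F) :
    ∃ N₀ : ℕ, ∃ cF : ℝ, 0 < cF ∧ ∀ n : ℕ, N₀ ≤ n → ∀ t : ℕ, (t:ℝ) ≤ cF * n → ∀ H : HGraph r,
      (IsExtremalMatchingFree r n t F.expansion H ↔ H.Iso (tgt r ℓ n t)) := by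
  have hr := hy.hr
  have hrl := hy.hrl
  obtain ⟨N, c, hc, hmain⟩ := main_upper ℓ F hy
  refine ⟨N, c, hc, ?_⟩
  intro n hn t ht H
  -- `t ≤ n`
  have htn : t + ℓ ≤ n := by
    have h := (hmain (emptyOn r (range n)) (by simpa [emptyOn, HGraph.ofEdges] using hn) t 
      (by simpa [emptyOn, HGraph.ofEdges] using ht)).1
    simpa [emptyOn, HGraph.ofEdges] using h
  have hTv : (tgt r ℓ n t).verts.card = n := by rw [tgt_verts ℓ n t (by omega), card_range]
  have hTc := tgt_card (r := r) (by omega) ℓ n t (by omega) (by omega)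
  have hTm := tgt_match ℓ F hy n t (by omega)
  have hbdd : BddAbove {m | ∃ H : HGraph r, H.verts.card = n ∧ ¬ F.expansion.HasMatching H (t+1) ∧ H.edges.card = m} := by
    refine ⟨n ^ r, ?_⟩
    rintro m ⟨G, g1, _, rfl⟩
    rw [← g1]
    exact card_edges_le G
  have hup : ∀ G : HGraph r, G.verts.card = n → ¬ F.expansion.HasMatching G (t+1) → 
      G.edges.card ≤ (tgt r ℓ n t).edges.card := by
    intro G g1 g2
    by_contra hcon
    obtain ⟨X, _, _, h3, _⟩ := (hmain G (by omega) t (by rw [g1]; exact ht)).2 g2 (by rw [g1]; omega)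
    rw [g1] at h3
    omega
  have hex : exMatchN r n t F.expansion = (tgt r ℓ n t).edges.card := by
    apply le_antisymm
    · refine csSup_le ⟨_, _, hTv, hTm, rfl⟩ ?_
      rintro m ⟨G, g1, g2, rfl⟩
      exact hup G g1 g2
    · exact le_csSup hbdd ⟨_, hTv, hTm, rfl⟩
  constructor
  · rintro ⟨h1, h2, h3⟩
    rw [hex] at h3
    obtain ⟨X, x1, x2, _, x4, x5, x6⟩ := (hmain H (by omega) t (by rw [h1]; exact ht)).2 h2 (by rw [h1]; omega)
    rw [h1] at x5
    exact iso_tgt ℓ n t hr hrl htn H h1 X x1 x2 x4 x5 x6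
  · intro h
    refine ⟨(iso_verts _ _ h).trans hTv, fun hm => hTm (iso_match _ _ _ h _ hm), ?_⟩
    rw [hex, iso_edges _ _ h]

end PartQ

/-- the density Corrádi–Hajnal theorem for expansions of members
of the family `𝓕_{ℓ+1}^r`. -/
theorem statement_12 (ℓ r : ℕ) (hr : 2 ≤ r) (hℓ : r ≤ ℓ)
    (F : HGraph r) (hFv : F.verts.card = ℓ + 1)
    (ha : ∃ b : ℝ, b < (∏ i ∈ Finset.range r, ((ℓ : ℝ) - i)) / (ℓ : ℝ) ^ r ∧
      ∀ H : HGraph r, ¬ F.IsCopyIn H → ¬ IsKlSub r ℓ H → hgLagrangian r H ≤ b)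
    (hb : (∃ v ∈ F.verts, ∀ e ∈ F.edges, v ∉ e) ∨ F.IsCopyIn (BGraph r ℓ)) :
    ∃ N₀ : ℕ, ∃ cF : ℝ, 0 < cF ∧ ∀ n : ℕ, N₀ ≤ n → ∀ t : ℕ, (t : ℝ) ≤ cF * n →
      ∀ H : HGraph r, IsExtremalMatchingFree r n t F.expansion H ↔
        H.Iso ((completeOn r (Finset.range t)).join (turanOn r ℓ (Finset.Ico t n))) := by
  have hpe := pc_eq_prod r ℓ hℓ
  obtain ⟨b, hb1, hb2⟩ := ha
  exact main_thm ℓ F ⟨hr, hℓ, hFv, hb, b, by rw [hpe]; exact hb1, hb2⟩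

end DensityCH
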